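/- Let M be a compact PL d-manifold and f : M → ℝ a PL Morse function with exactly two critical points. Then M is PL homeomorphic to the d-sphere S^d. -/

import Mathlib

open Geometry Set

noncomputable section

variable {E F : Type} [NormedAddCommGroup E] [NormedSpace ℝ E]
  [NormedAddCommGroup F] [NormedSpace ℝ F]

/-- A map is affine on the simplex spanned by the finite set `s`:
it preserves convex combinations of the points of `s`. -/
def AffineOnSimplex (φ : E → F) (s : Finset E) : Prop :=
  ∀ w : E → ℝ, (∀ x ∈ s, 0 ≤ w x) → (∑ x ∈ s, w x) = 1 →
    φ (∑ x ∈ s, w x • x) = ∑ x ∈ s, w x • φ x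

/-- A map is piecewise linear on a set `S` if `S` carries a finite simplicial complex
structure on whose simplices the map is affine. -/
def IsPLMapOn (φ : E → F) (S : Set E) : Prop :=
  ∃ K : SimplicialComplex ℝ E, K.faces.Finite ∧ K.space = S ∧
    ∀ s ∈ K.faces, AffineOnSimplex φ s

/-- `φ` is a PL homeomorphism from `S` onto `T`. -/
def IsPLHomeoOn (φ : E → F) (S : Set E) (T : Set F) : Prop :=
  Set.BijOn φ S T ∧ IsPLMapOn φ S ∧
    ∃ ψ : F → E, IsPLMapOn ψ T ∧ (∀ x ∈ S, ψ (φ x) = x) ∧ (∀ y ∈ T, φ (ψ y) = y)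

/-- Two sets (polyhedra) are PL homeomorphic. -/
def ArePLHomeo (S : Set E) (T : Set F) : Prop := ∃ φ : E → F, IsPLHomeoOn φ S T

/-- The boundary of the standard `d+1`-dimensional simplex: a standard PL `d`-sphere. -/
def stdSphere (d : ℕ) : Set (Fin (d + 2) → ℝ) :=
  {x ∈ stdSimplex ℝ (Fin (d + 2)) | ∃ i, x i = 0}

/-- `S` is a PL `d`-ball. -/
def IsPLBall (S : Set E) (d : ℕ) : Prop := ArePLHomeo S (stdSimplex ℝ (Fin (d + 1)))

/-- `S` is a PL `d`-sphere. -/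
def IsPLSphere (S : Set E) (d : ℕ) : Prop := ArePLHomeo S (stdSphere d)

namespace Geometry.SimplicialComplex

/-- A generic PL function on a simplicial complex: affine on each simplex and
injective on the vertices. -/
structure IsGenericPL (K : SimplicialComplex ℝ E) (f : E → ℝ) : Prop where
  affineOn : ∀ s ∈ K.faces, AffineOnSimplex f s
  injOn : Set.InjOn f K.vertices

/-- The closed star of a vertex: union of the closed simplices containing it. -/
def starSpace (K : SimplicialComplex ℝ E) (v : E) : Set E :=
  ⋃ s ∈ {s ∈ K.faces | v ∈ s}, convexHull ℝ (s : Set E)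

/-- The link of a vertex: union of the faces of the star not containing the vertex. -/
def linkSpace (K : SimplicialComplex ℝ E) (v : E) : Set E :=
  ⋃ s ∈ {s ∈ K.faces | v ∉ s ∧ ∃ t ∈ K.faces, v ∈ t ∧ s ⊆ t}, convexHull ℝ (s : Set E)

/-- The sublevel set of `f` at level `a`, inside the underlying space of `K`. -/
def sublevel (K : SimplicialComplex ℝ E) (f : E → ℝ) (a : ℝ) : Set E :=
  {x ∈ K.space | f x ≤ a}

/-- The superlevel set of `f` at level `a`. -/
def superlevel (K : SimplicialComplex ℝ E) (f : E → ℝ) (a : ℝ) : Set E :=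
  {x ∈ K.space | a ≤ f x}

/-- The lower link `lk⁻(v)` of a vertex. -/
def lowerLink (K : SimplicialComplex ℝ E) (f : E → ℝ) (v : E) : Set E :=
  {x ∈ K.linkSpace v | f x ≤ f v}

/-- The upper link `lk⁺(v)` of a vertex. -/
def upperLink (K : SimplicialComplex ℝ E) (f : E → ℝ) (v : E) : Set E :=
  {x ∈ K.linkSpace v | f v ≤ f x}

/-- A combinatorial `d`-manifold (without boundary): a finite simplicial complex,
pure of dimension `d`, in which the link of every vertex is a PL `(d-1)`-sphere. -/
structure IsCombinatorialManifold (K : SimplicialComplex ℝ E) (d : ℕ) : Prop where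
  finite : K.faces.Finite
  nonempty : K.faces.Nonempty
  pure : ∀ s ∈ K.faces, ∃ t ∈ K.faces, s ⊆ t ∧ t.card = d + 1
  linkSphere : ∀ v ∈ K.vertices, IsPLSphere (K.linkSpace v) (d - 1)

/-- `f` has a local PL chart at `v` in which it is given by the model function `g`. -/
def HasPLChartAt (K : SimplicialComplex ℝ E) (f : E → ℝ) (v : E) (d : ℕ)
    (g : (Fin d → ℝ) → ℝ) : Prop :=
  ∃ (N : Set E) (φ : E → Fin d → ℝ),
    N ⊆ K.space ∧ N ∈ nhdsWithin v K.space ∧ φ v = 0 ∧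
    IsPLHomeoOn φ N (Set.pi Set.univ fun _ : Fin d => Set.Icc (-1 : ℝ) 1) ∧
    ∀ x ∈ N, f x = f v + g (φ x)

/-- A point is strongly regular if `f` can be used as the last coordinate of a PL chart. -/
def StronglyRegularAt (K : SimplicialComplex ℝ E) (f : E → ℝ) (v : E) (d : ℕ) : Prop :=
  ∃ hd : 0 < d, K.HasPLChartAt f v d fun x => x ⟨d - 1, Nat.sub_lt hd one_pos⟩

/-- A vertex is non-degenerate critical of index `k` if in a local PL chart
`f = f(v) - |x₁| - ⋯ - |x_k| + |x_{k+1}| + ⋯ + |x_d|`. -/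
def NondegenerateCriticalAt (K : SimplicialComplex ℝ E) (f : E → ℝ) (v : E)
    (d k : ℕ) : Prop :=
  k ≤ d ∧ K.HasPLChartAt f v d fun x =>
    ∑ i : Fin d, if (i : ℕ) < k then -|x i| else |x i|

/-- A PL Morse function: a generic PL function all of whose vertices are strongly
regular or non-degenerate critical. -/
def IsPLMorse (K : SimplicialComplex ℝ E) (f : E → ℝ) (d : ℕ) : Prop :=
  K.IsGenericPL f ∧ ∀ v ∈ K.vertices,
    K.StronglyRegularAt f v d ∨ ∃ k, K.NondegenerateCriticalAt f v d k

end Geometry.SimplicialComplex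

end

set_option linter.unusedSectionVars false

namespace PLReeb

/-! ### Affine functions as a predicate -/

section Affine

variable {V W X Y : Type*} [AddCommGroup V] [Module ℝ V] [AddCommGroup W] [Module ℝ W]
  [AddCommGroup X] [Module ℝ X] [AddCommGroup Y] [Module ℝ Y]

/-- A function between real vector spaces is affine. -/
@[fun_prop]
def IsAff (g : V → W) : Prop := ∃ a : V →ᵃ[ℝ] W, ⇑a = g

@[fun_prop]
theorem isAff_id : IsAff (fun x : V => x) := ⟨AffineMap.id ℝ V, rfl⟩

@[fun_prop]
theorem isAff_const (c : W) : IsAff (fun _ : V => c) := ⟨AffineMap.const ℝ V c, rfl⟩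

@[fun_prop]
theorem IsAff.comp {g : W → X} {h : V → W} (hg : IsAff g) (hh : IsAff h) :
    IsAff (fun x => g (h x)) := by
  obtain ⟨a, rfl⟩ := hg
  obtain ⟨b, rfl⟩ := hh
  exact ⟨a.comp b, rfl⟩

@[fun_prop]
theorem IsAff.fst {g : V → W × X} (hg : IsAff g) : IsAff (fun x => (g x).1) := by
  obtain ⟨a, rfl⟩ := hg
  exact ⟨(AffineMap.fst : W × X →ᵃ[ℝ] W).comp a, rfl⟩

@[fun_prop]
theorem IsAff.snd {g : V → W × X} (hg : IsAff g) : IsAff (fun x => (g x).2) := by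
  obtain ⟨a, rfl⟩ := hg
  exact ⟨(AffineMap.snd : W × X →ᵃ[ℝ] X).comp a, rfl⟩

@[fun_prop]
theorem IsAff.prodMk {g : V → W} {h : V → X} (hg : IsAff g) (hh : IsAff h) :
    IsAff (fun x => (g x, h x)) := by
  obtain ⟨a, rfl⟩ := hg
  obtain ⟨b, rfl⟩ := hh
  exact ⟨a.prod b, rfl⟩

@[fun_prop]
theorem IsAff.add {g h : V → W} (hg : IsAff g) (hh : IsAff h) :
    IsAff (fun x => g x + h x) := by
  obtain ⟨a, rfl⟩ := hg
  obtain ⟨b, rfl⟩ := hh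
  exact ⟨a + b, rfl⟩

@[fun_prop]
theorem IsAff.sub {g h : V → W} (hg : IsAff g) (hh : IsAff h) :
    IsAff (fun x => g x - h x) := by
  obtain ⟨a, rfl⟩ := hg
  obtain ⟨b, rfl⟩ := hh
  exact ⟨a - b, rfl⟩

@[fun_prop]
theorem IsAff.neg {g : V → W} (hg : IsAff g) : IsAff (fun x => - g x) := by
  obtain ⟨a, rfl⟩ := hg
  exact ⟨-a, rfl⟩

@[fun_prop]
theorem IsAff.const_smul {g : V → W} (c : ℝ) (hg : IsAff g) : IsAff (fun x => c • g x) := by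
  obtain ⟨a, rfl⟩ := hg
  exact ⟨c • a, rfl⟩

@[fun_prop]
theorem IsAff.const_mul {g : V → ℝ} (c : ℝ) (hg : IsAff g) : IsAff (fun x => c * g x) := by
  obtain ⟨a, rfl⟩ := hg
  exact ⟨c • a, rfl⟩

@[fun_prop]
theorem IsAff.smul_const {g : V → ℝ} (hg : IsAff g) (w : W) : IsAff (fun x => g x • w) := by
  obtain ⟨a, rfl⟩ := hg
  exact ⟨((LinearMap.id : ℝ →ₗ[ℝ] ℝ).smulRight w).toAffineMap.comp a, rfl⟩

@[fun_prop]
theorem IsAff.mul_const {g : V → ℝ} (hg : IsAff g) (c : ℝ) : IsAff (fun x => g x * c) :=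
  hg.smul_const c

@[fun_prop]
theorem IsAff.div_const {g : V → ℝ} (hg : IsAff g) (c : ℝ) : IsAff (fun x => g x / c) := by
  simpa only [div_eq_mul_inv] using hg.mul_const c⁻¹

@[fun_prop]
theorem isAff_linearMap (l : V →ₗ[ℝ] W) : IsAff (fun x => l x) := ⟨l.toAffineMap, rfl⟩

@[fun_prop]
theorem isAff_pi {ι : Type*} {g : V → ι → ℝ} (hg : ∀ i, IsAff (fun x => g x i)) : IsAff g := by
  choose a ha using hg
  exact ⟨AffineMap.pi a, by ext x i; exact congrFun (ha i) x⟩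

@[fun_prop]
theorem isAff_apply {ι : Type*} (i : ι) : IsAff (fun x : ι → ℝ => x i) :=
  ⟨(LinearMap.proj i).toAffineMap, rfl⟩

theorem IsAff.sum {ι : Type*} (s : Finset ι) {g : ι → V → W}
    (hg : ∀ i ∈ s, IsAff (g i)) : IsAff (fun x => ∑ i ∈ s, g i x) := by
  classical
  induction s using Finset.induction_on with
  | empty => simpa using isAff_const (0 : W)
  | insert i s hi ih =>
    simp only [Finset.sum_insert hi]
    exact (hg i (by simp)).add (ih fun j hj => hg j (by simp [hj]))

end Affine

/-! ### Semilinear sets -/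

section Semilinear

variable {V W X Y : Type*} [AddCommGroup V] [Module ℝ V] [AddCommGroup W] [Module ℝ W]
  [AddCommGroup X] [Module ℝ X] [AddCommGroup Y] [Module ℝ Y]

/-- A set is semilinear if membership depends only on the signs of finitely many affine
functionals. -/
def SL (S : Set V) : Prop :=
  ∃ A : Finset (V →ᵃ[ℝ] ℝ), ∀ x y,
    (∀ a ∈ A, SignType.sign (a x) = SignType.sign (a y)) → x ∈ S → y ∈ S

theorem SL.compl {S : Set V} (hS : SL S) : SL Sᶜ := by
  obtain ⟨A, hA⟩ := hS
  exact ⟨A, fun x y h hx hy => hx (hA y x (fun a ha => (h a ha).symm) hy)⟩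

theorem SL.inter {S T : Set V} (hS : SL S) (hT : SL T) : SL (S ∩ T) := by
  classical
  obtain ⟨A, hA⟩ := hS
  obtain ⟨B, hB⟩ := hT
  refine ⟨A ∪ B, fun x y h hx => ⟨hA x y (fun a ha => h a ?_) hx.1, hB x y (fun a ha => h a ?_) hx.2⟩⟩
  · exact Finset.mem_union_left _ ha
  · exact Finset.mem_union_right _ ha

theorem SL.union {S T : Set V} (hS : SL S) (hT : SL T) : SL (S ∪ T) := by
  have := (hS.compl.inter hT.compl).compl
  rwa [Set.compl_inter, compl_compl, compl_compl] at this

theorem SL.univ : SL (Set.univ : Set V) := ⟨∅, fun _ _ _ _ => trivial⟩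

theorem SL.empty : SL (∅ : Set V) := ⟨∅, fun _ _ _ h => h⟩

theorem SL.diff {S T : Set V} (hS : SL S) (hT : SL T) : SL (S \ T) := hS.inter hT.compl

theorem SL.and {P Q : V → Prop} (hP : SL {x | P x}) (hQ : SL {x | Q x}) :
    SL {x | P x ∧ Q x} := hP.inter hQ

theorem SL.or {P Q : V → Prop} (hP : SL {x | P x}) (hQ : SL {x | Q x}) :
    SL {x | P x ∨ Q x} := hP.union hQ

theorem SL.biUnion {ι : Type*} {s : Set ι} (hs : s.Finite) {S : ι → Set V}
    (h : ∀ i ∈ s, SL (S i)) : SL (⋃ i ∈ s, S i) := by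
  induction s, hs using Set.Finite.induction_on with
  | empty => simpa using SL.empty
  | insert _ _ ih =>
    rw [Set.biUnion_insert]
    exact (h _ (Set.mem_insert _ _)).union (ih fun i hi => h i (Set.mem_insert_of_mem _ hi))

theorem SL.iInter {ι : Type*} [Finite ι] {S : ι → Set V} (h : ∀ i, SL (S i)) :
    SL (⋂ i, S i) := by
  have := (SL.biUnion (Set.finite_univ (α := ι)) (S := fun i => (S i)ᶜ) fun i _ => (h i).compl).compl
  simpa using this

theorem SL.forall {ι : Type*} [Finite ι] {P : ι → V → Prop} (h : ∀ i, SL {x | P i x}) :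
    SL {x | ∀ i, P i x} := by
  simpa only [Set.ofPred_forall] using SL.iInter h

theorem SL.preimage {S : Set W} (hS : SL S) {g : V → W} (hg : IsAff g) : SL {x | g x ∈ S} := by
  classical
  obtain ⟨A, hA⟩ := hS
  obtain ⟨b, rfl⟩ := hg
  refine ⟨A.image fun a => a.comp b, fun x y h hx => hA (b x) (b y) (fun a ha => ?_) hx⟩
  exact h _ (Finset.mem_image_of_mem _ ha)

theorem SL.nonneg {g : V → ℝ} (hg : IsAff g) : SL {x | 0 ≤ g x} := by
  obtain ⟨a, rfl⟩ := hg
  refine ⟨{a}, fun x y h hx => ?_⟩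
  have h := h a (by simp)
  simp only [Set.mem_ofPred_eq] at hx ⊢
  rwa [← sign_nonneg_iff, ← h, sign_nonneg_iff]

theorem SL.le {g h : V → ℝ} (hg : IsAff g) (hh : IsAff h) : SL {x | g x ≤ h x} := by
  simpa using SL.nonneg (hh.sub hg)

theorem SL.eq_real {g h : V → ℝ} (hg : IsAff g) (hh : IsAff h) : SL {x | g x = h x} := by
  simpa only [le_antisymm_iff] using (SL.le hg hh).and (SL.le hh hg)

theorem SL.eq [FiniteDimensional ℝ W] {g h : V → W} (hg : IsAff g) (hh : IsAff h) :
    SL {x | g x = h x} := by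
  let b := Module.finBasis ℝ W
  have : {x | g x = h x} = {x | ∀ i, b.repr (g x) i = b.repr (h x) i} := by
    ext x
    exact ⟨fun e i => by rw [show g x = h x from e], fun e => b.repr.injective (Finsupp.ext e)⟩
  rw [this]
  refine SL.forall fun i => SL.eq_real ?_ ?_
  · exact (isAff_linearMap (b.coord i)).comp hg
  · exact (isAff_linearMap (b.coord i)).comp hh

/-- Fourier–Motzkin elimination of one real variable. -/
theorem SL.exists_real {S : Set (V × ℝ)} (hS : SL S) : SL {x | ∃ t, (x, t) ∈ S} := by
  classical
  obtain ⟨A, hA⟩ := hS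
  let root : (V × ℝ →ᵃ[ℝ] ℝ) → (V →ᵃ[ℝ] ℝ) := fun a =>
    (-(a.linear (0, 1))⁻¹) • a.comp ((AffineMap.id ℝ V).prod (AffineMap.const ℝ V 0))
  let R : Finset (V →ᵃ[ℝ] ℝ) := A.image root
  let one : V →ᵃ[ℝ] ℝ := AffineMap.const ℝ V 1
  let T : Finset (V →ᵃ[ℝ] ℝ) :=
    ((R ×ˢ R).image fun p => (2⁻¹ : ℝ) • (p.1 + p.2)) ∪ (R.image fun p => p + one) ∪
      (R.image fun p => p - one) ∪ {0}
  have hroot : ∀ a : V × ℝ →ᵃ[ℝ] ℝ, ∀ x t, a.linear (0, 1) ≠ 0 →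
      a (x, t) = a.linear (0, 1) * (t - root a x) := by
    intro a x t h
    have h1 : a (x, t) = a (x, 0) + t * a.linear (0, 1) := by
      have := a.map_vadd (x, 0) (t • ((0 : V), (1 : ℝ)))
      simp only [map_smul, vadd_eq_add, smul_eq_mul] at this
      rw [← add_comm, ← this]
      simp
    have h2 : root a x = -(a.linear (0, 1))⁻¹ * a (x, 0) := by simp [root]
    rw [h1, h2]
    field_simp
    ring
  have hconst : ∀ a : V × ℝ →ᵃ[ℝ] ℝ, ∀ x t t', a.linear (0, 1) = 0 →
      a (x, t) = a (x, t') := by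
    intro a x t t' h
    have := a.map_vadd (x, t') ((t - t') • ((0 : V), (1 : ℝ)))
    rw [map_smul, h] at this
    simpa using this
  have sample : ∀ x t, ∃ τ ∈ T, ∀ r ∈ R, SignType.sign (t - r x) = SignType.sign (τ x - r x) := by
    intro x t
    by_cases h0 : ∃ r ∈ R, r x = t
    · obtain ⟨r, hr, rfl⟩ := h0
      refine ⟨r, ?_, fun _ _ => rfl⟩
      refine Finset.mem_union_left _ (Finset.mem_union_left _ (Finset.mem_union_left _ ?_))
      refine Finset.mem_image.2 ⟨(r, r), by simp [hr], ?_⟩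
      ext y
      simp
      ring
    push Not at h0
    have key : ∀ s : ℝ, (∀ r ∈ R, r x < t → r x < s) → (∀ r ∈ R, t < r x → s < r x) →
        ∀ r ∈ R, SignType.sign (t - r x) = SignType.sign (s - r x) := by
      intro s h1 h2 r hr
      rcases lt_or_gt_of_ne (h0 r hr) with h | h
      · rw [sign_pos (sub_pos.2 h), sign_pos (sub_pos.2 (h1 r hr h))]
      · rw [sign_neg (sub_neg.2 h), sign_neg (sub_neg.2 (h2 r hr h))]
    let L := R.filter fun r => r x < t
    let U := R.filter fun r => t < r x
    rcases L.eq_empty_or_nonempty with hL | hL <;> rcases U.eq_empty_or_nonempty with hU | hU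
    · refine ⟨0, by simp [T], key _ (fun r hr h => ?_) (fun r hr h => ?_)⟩
      · exact absurd (show r ∈ L from Finset.mem_filter.2 ⟨hr, h⟩) (by simp [hL])
      · exact absurd (show r ∈ U from Finset.mem_filter.2 ⟨hr, h⟩) (by simp [hU])
    · obtain ⟨u, hu, hmin⟩ := U.exists_min_image (fun r => r x) hU
      refine ⟨u - one, ?_, key _ (fun r hr h => ?_) (fun r hr h => ?_)⟩
      · refine Finset.mem_union_left _ (Finset.mem_union_right _ ?_)
        exact Finset.mem_image_of_mem _ (Finset.mem_filter.1 hu).1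
      · exact absurd (show r ∈ L from Finset.mem_filter.2 ⟨hr, h⟩) (by simp [hL])
      · have := hmin r (Finset.mem_filter.2 ⟨hr, h⟩)
        simp [one]
        linarith
    · obtain ⟨u, hu, hmax⟩ := L.exists_max_image (fun r => r x) hL
      refine ⟨u + one, ?_, key _ (fun r hr h => ?_) (fun r hr h => ?_)⟩
      · refine Finset.mem_union_left _ (Finset.mem_union_left _ (Finset.mem_union_right _ ?_))
        exact Finset.mem_image_of_mem _ (Finset.mem_filter.1 hu).1
      · have := hmax r (Finset.mem_filter.2 ⟨hr, h⟩)
        simp [one]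
        linarith
      · exact absurd (show r ∈ U from Finset.mem_filter.2 ⟨hr, h⟩) (by simp [hU])
    · obtain ⟨u, hu, hmin⟩ := U.exists_min_image (fun r => r x) hU
      obtain ⟨l, hl, hmax⟩ := L.exists_max_image (fun r => r x) hL
      have hu' := Finset.mem_filter.1 hu
      have hl' := Finset.mem_filter.1 hl
      refine ⟨(2⁻¹ : ℝ) • (l + u), ?_, key _ (fun r hr h => ?_) (fun r hr h => ?_)⟩
      · refine Finset.mem_union_left _ (Finset.mem_union_left _ (Finset.mem_union_left _ ?_))
        exact Finset.mem_image.2 ⟨(l, u), by simp [hl'.1, hu'.1], rfl⟩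
      · have := hmax r (Finset.mem_filter.2 ⟨hr, h⟩)
        simp
        linarith [hu'.2, hl'.2]
      · have := hmin r (Finset.mem_filter.2 ⟨hr, h⟩)
        simp
        linarith [hu'.2, hl'.2]
  refine ⟨(A ×ˢ T).image fun p => p.1.comp ((AffineMap.id ℝ V).prod p.2), ?_⟩
  rintro x y h ⟨t, ht⟩
  obtain ⟨τ, hτ, hs⟩ := sample x t
  refine ⟨τ y, hA (x, τ x) _ (fun a ha => ?_) (hA (x, t) _ (fun a ha => ?_) ht)⟩
  · exact h _ (Finset.mem_image.2 ⟨(a, τ), by simp [ha, hτ], rfl⟩)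
  · by_cases h0 : a.linear (0, 1) = 0
    · rw [hconst a x t (τ x) h0]
    · rw [hroot a x t h0, hroot a x (τ x) h0, sign_mul, sign_mul,
        hs _ (Finset.mem_image_of_mem _ ha)]

theorem SL.exists_fin (n : ℕ) {V : Type*} [AddCommGroup V] [Module ℝ V]
    {S : Set (V × (Fin n → ℝ))} (hS : SL S) : SL {x | ∃ t, (x, t) ∈ S} := by
  induction n with
  | zero =>
    have : {x | ∃ t, (x, t) ∈ S} = {x | (x, (0 : Fin 0 → ℝ)) ∈ S} := by
      ext x
      exact ⟨fun ⟨t, ht⟩ => by rwa [Subsingleton.elim t 0] at ht, fun h => ⟨_, h⟩⟩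
    rw [this]
    exact hS.preimage (by fun_prop)
  | succ n ih =>
    have h1 : SL {p : (V × (Fin n → ℝ)) × ℝ | (p.1.1, (Fin.cons p.2 p.1.2 : Fin (n+1) → ℝ)) ∈ S} := by
      refine hS.preimage ?_
      refine IsAff.prodMk (by fun_prop) (isAff_pi fun i => ?_)
      refine Fin.cases ?_ (fun j => ?_) i
      · simp only [Fin.cons_zero]; fun_prop
      · simp only [Fin.cons_succ]; fun_prop
    have h2 := ih h1.exists_real
    convert h2 using 1
    ext x
    constructor
    · rintro ⟨t, ht⟩
      exact ⟨Fin.tail t, t 0, by simpa using ht⟩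
    · rintro ⟨t, r, h⟩
      exact ⟨_, h⟩

/-- Semilinear sets are closed under projection. -/
theorem SL.exists [FiniteDimensional ℝ W] {P : V → W → Prop} (h : SL {p : V × W | P p.1 p.2}) :
    SL {x | ∃ y, P x y} := by
  let e := (Module.finBasis ℝ W).equivFun
  have h1 : SL {p : V × (Fin (Module.finrank ℝ W) → ℝ) | P p.1 (e.symm p.2)} :=
    h.preimage (g := fun p : V × (Fin (Module.finrank ℝ W) → ℝ) => (p.1, e.symm p.2))
      (IsAff.prodMk (by fun_prop)
        ((isAff_linearMap (e.symm : (Fin (Module.finrank ℝ W) → ℝ) →ₗ[ℝ] W)).comp (by fun_prop)))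
  convert SL.exists_fin _ h1 using 1
  ext x
  constructor
  · rintro ⟨y, hy⟩
    exact ⟨e y, by simpa using hy⟩
  · rintro ⟨t, ht⟩
    exact ⟨_, ht⟩

theorem SL.image [FiniteDimensional ℝ V] [FiniteDimensional ℝ W] {S : Set V} (hS : SL S)
    {g : V → W} (hg : IsAff g) : SL (g '' S) :=
  SL.exists (P := fun y x => x ∈ S ∧ g x = y)
    ((hS.preimage (by fun_prop)).and (SL.eq (by fun_prop) (by fun_prop)))

end Semilinear

/-! ### Triangulations described by barycentric weights -/

section Mass

variable {V W : Type*}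

/-- The total mass of a weight. -/
noncomputable def mass : (V →₀ ℝ) →ₗ[ℝ] ℝ := Finsupp.linearCombination ℝ fun _ => (1 : ℝ)

@[simp] theorem mass_single (x : V) (r : ℝ) : mass (Finsupp.single x r) = r := by
  simp [mass]

theorem mass_eq_sum {μ : V →₀ ℝ} {s : Finset V} (h : μ.support ⊆ s) :
    mass μ = ∑ x ∈ s, μ x := by
  rw [mass, Finsupp.linearCombination_apply, Finsupp.sum_of_support_subset _ h _ (by simp)]
  simp

/-- Convex weights. -/
def IsWeight (μ : V →₀ ℝ) : Prop := (∀ x, 0 ≤ μ x) ∧ mass μ = 1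

theorem IsWeight.support_nonempty {μ : V →₀ ℝ} (h : IsWeight μ) : μ.support.Nonempty := by
  rw [Finset.nonempty_iff_ne_empty]
  intro h0
  have h1 := h.2
  rw [Finsupp.support_eq_empty.1 h0, map_zero] at h1
  exact zero_ne_one h1

theorem IsWeight.mapDomain {μ : V →₀ ℝ} (h : IsWeight μ) (q : V → W) :
    IsWeight (Finsupp.mapDomain q μ) := by
  classical
  refine ⟨fun y => ?_, ?_⟩
  · rw [Finsupp.mapDomain, Finsupp.sum_apply]
    refine Finset.sum_nonneg fun x _ => ?_
    simp only [Finsupp.single_apply]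
    split_ifs
    exacts [h.1 x, le_rfl]
  · rw [← h.2, mass, mass, Finsupp.linearCombination_mapDomain]
    rfl

end Mass

section Weights

variable {V W : Type*} [AddCommGroup V] [Module ℝ V] [AddCommGroup W] [Module ℝ W]

/-- The point with given barycentric weights. -/
noncomputable def bary : (V →₀ ℝ) →ₗ[ℝ] V := Finsupp.linearCombination ℝ id

@[simp] theorem bary_single (x : V) (r : ℝ) : bary (Finsupp.single x r) = r • x := by
  simp [bary]

theorem bary_eq_sum {μ : V →₀ ℝ} {s : Finset V} (h : μ.support ⊆ s) :
    bary μ = ∑ x ∈ s, μ x • x := by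
  rw [bary, Finsupp.linearCombination_apply, Finsupp.sum_of_support_subset _ h _ (by simp)]
  simp

theorem mem_convexHull_iff_weight {s : Finset V} {x : V} :
    x ∈ convexHull ℝ (s : Set V) ↔ ∃ μ : V →₀ ℝ, IsWeight μ ∧ μ.support ⊆ s ∧ bary μ = x := by
  classical
  rw [Finset.mem_convexHull']
  constructor
  · rintro ⟨w, h0, h1, rfl⟩
    refine ⟨Finsupp.indicator s fun y _ => w y, ⟨fun y => ?_, ?_⟩, Finsupp.support_indicator_subset _ _, ?_⟩
    · rw [Finsupp.indicator_apply]
      split_ifs with h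
      exacts [h0 y h, le_rfl]
    · rw [mass_eq_sum (Finsupp.support_indicator_subset _ _), ← h1]
      exact Finset.sum_congr rfl fun y hy => by simp [hy]
    · rw [bary_eq_sum (Finsupp.support_indicator_subset _ _)]
      exact Finset.sum_congr rfl fun y hy => by simp [hy]
  · rintro ⟨μ, h, hs, rfl⟩
    exact ⟨μ, fun y _ => h.1 y, by rw [← mass_eq_sum hs, h.2], (bary_eq_sum hs).symm⟩

/-- The weights carried by the simplices of a family. -/
def weights (F : Set (Finset V)) : Set (V →₀ ℝ) := {μ | IsWeight μ ∧ μ.support ∈ F}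

/-- A finite family of finite sets that is the set of faces of a geometric simplicial complex. -/
structure IsTri (F : Set (Finset V)) : Prop where
  finite : F.Finite
  nonempty : ∀ s ∈ F, s.Nonempty
  down : ∀ s ∈ F, ∀ t ⊆ s, t.Nonempty → t ∈ F
  inj : Set.InjOn bary (weights F)

/-- The union of the simplices of a family. -/
def triSpace (F : Set (Finset V)) : Set V := bary '' weights F

theorem IsTri.mem_weights {F : Set (Finset V)} (h : IsTri F) {μ : V →₀ ℝ} (hμ : IsWeight μ)
    {s : Finset V} (hs : s ∈ F) (hsub : μ.support ⊆ s) : μ ∈ weights F :=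
  ⟨hμ, h.down s hs _ hsub hμ.support_nonempty⟩

theorem IsTri.convexHull_subset {F : Set (Finset V)} (h : IsTri F) {s : Finset V} (hs : s ∈ F) :
    convexHull ℝ (s : Set V) ⊆ triSpace F := by
  intro x hx
  obtain ⟨μ, hμ, hsub, rfl⟩ := mem_convexHull_iff_weight.1 hx
  exact ⟨μ, h.mem_weights hμ hs hsub, rfl⟩

theorem IsTri.triSpace_eq {F : Set (Finset V)} (h : IsTri F) :
    triSpace F = ⋃ s ∈ F, convexHull ℝ (s : Set V) := by
  refine Set.Subset.antisymm ?_ (Set.iUnion₂_subset fun s hs => h.convexHull_subset hs)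
  rintro _ ⟨μ, hμ, rfl⟩
  exact Set.mem_biUnion hμ.2 (mem_convexHull_iff_weight.2 ⟨μ, hμ.1, subset_rfl, rfl⟩)

theorem weight_unique {s : Finset V} (hs : AffineIndependent ℝ ((↑) : s → V)) {μ ν : V →₀ ℝ}
    (hμ : μ.support ⊆ s) (hν : ν.support ⊆ s) (hm : mass μ = mass ν) (hb : bary μ = bary ν) :
    μ = ν := by
  have key := (affineIndependent_iff.1 hs) Finset.univ (fun x => μ x - ν x)
  have h1 : ∑ x : s, (μ x - ν x) = 0 := by
    rw [Finset.sum_coe_sort s fun x => μ x - ν x, Finset.sum_sub_distrib, ← mass_eq_sum hμ,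
      ← mass_eq_sum hν, hm, sub_self]
  have h2 : ∑ x : s, (μ x - ν x) • (x : V) = 0 := by
    rw [Finset.sum_coe_sort s fun x => (μ x - ν x) • x]
    simp only [sub_smul]
    rw [Finset.sum_sub_distrib, ← bary_eq_sum hμ, ← bary_eq_sum hν, hb, sub_self]
  ext x
  by_cases hx : x ∈ s
  · exact sub_eq_zero.1 (key h1 h2 ⟨x, hx⟩ (Finset.mem_univ _))
  · rw [Finsupp.notMem_support_iff.1 fun h => hx (hμ h),
      Finsupp.notMem_support_iff.1 fun h => hx (hν h)]

theorem isTri_faces (K : SimplicialComplex ℝ V) (hK : K.faces.Finite) : IsTri K.faces where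
  finite := hK
  nonempty _ hs := K.nonempty_of_mem_faces hs
  down _ hs _ hts ht := K.down_closed hs hts ht
  inj := by
    classical
    intro μ hμ ν hν h
    have h1 : bary μ ∈ convexHull ℝ ((μ.support ∩ ν.support : Finset V) : Set V) := by
      rw [Finset.coe_inter]
      refine K.inter_subset_convexHull hμ.2 hν.2 ⟨?_, ?_⟩
      · exact mem_convexHull_iff_weight.2 ⟨μ, hμ.1, subset_rfl, rfl⟩
      · exact mem_convexHull_iff_weight.2 ⟨ν, hν.1, subset_rfl, h.symm⟩
    obtain ⟨ξ, hξ, hs, hb⟩ := mem_convexHull_iff_weight.1 h1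
    have e1 : ξ = μ := weight_unique (K.indep hμ.2) (hs.trans Finset.inter_subset_left) subset_rfl
      (by rw [hξ.2, hμ.1.2]) hb
    have e2 : ξ = ν := weight_unique (K.indep hν.2) (hs.trans Finset.inter_subset_right) subset_rfl
      (by rw [hξ.2, hν.1.2]) (hb.trans h)
    rw [← e1, ← e2]

theorem space_eq_triSpace (K : SimplicialComplex ℝ V) (hK : K.faces.Finite) :
    K.space = triSpace K.faces := (isTri_faces K hK).triSpace_eq.symm

theorem IsTri.affineIndependent {F : Set (Finset V)} (h : IsTri F) {s : Finset V} (hs : s ∈ F) :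
    AffineIndependent ℝ ((↑) : s → V) := by
  classical
  have hn : 0 < (s.card : ℝ) := by exact_mod_cast (h.nonempty s hs).card_pos
  rw [affineIndependent_iff_of_fintype]
  intro w h0 h1
  rw [Finset.univ.weightedVSub_eq_linear_combination h0] at h1
  let v : V → ℝ := fun x => if hx : x ∈ s then w ⟨x, hx⟩ else 0
  have hv : ∀ x : s, v x = w x := fun x => by simp [v]
  have h0' : ∑ x ∈ s, v x = 0 := by
    rw [← Finset.sum_coe_sort]; simpa [hv] using h0
  have h1' : ∑ x ∈ s, v x • x = 0 := by
    rw [← Finset.sum_coe_sort]; simpa [hv] using h1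
  obtain ⟨C, hC⟩ : ∃ C : ℝ, 0 < C ∧ ∀ x ∈ s, |v x| ≤ C := by
    refine ⟨1 + ∑ x ∈ s, |v x|, by positivity, fun x hx => ?_⟩
    have := Finset.single_le_sum (f := fun x => |v x|) (fun y _ => abs_nonneg _) hx
    linarith
  let g : ℝ → V →₀ ℝ := fun c => Finsupp.indicator s fun x _ => (s.card : ℝ)⁻¹ + c * v x
  have hsup : ∀ c, (g c).support ⊆ s := fun c => Finsupp.support_indicator_subset _ _
  have hg : ∀ c, ∀ x ∈ s, g c x = (s.card : ℝ)⁻¹ + c * v x := fun c x hx => by simp [g, hx]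
  have hbary : ∀ c, bary (g c) = ∑ x ∈ s, (s.card : ℝ)⁻¹ • x := by
    intro c
    rw [bary_eq_sum (hsup c), Finset.sum_congr rfl fun x hx => by rw [hg c x hx]]
    simp only [add_smul, mul_smul]
    rw [Finset.sum_add_distrib, ← Finset.smul_sum (r := c), h1']
    simp
  have hmass : ∀ c, mass (g c) = 1 := by
    intro c
    rw [mass_eq_sum (hsup c), Finset.sum_congr rfl fun x hx => hg c x hx, Finset.sum_add_distrib,
      ← Finset.mul_sum, h0']
    simp [hn.ne']
  have hwt : ∀ c, |c| ≤ (s.card : ℝ)⁻¹ / C → g c ∈ weights F := by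
    intro c hc
    refine h.mem_weights ⟨fun x => ?_, hmass c⟩ hs (hsup c)
    by_cases hx : x ∈ s
    · rw [hg c x hx]
      have : |c * v x| ≤ (s.card : ℝ)⁻¹ := by
        rw [abs_mul]
        calc |c| * |v x| ≤ ((s.card : ℝ)⁻¹ / C) * C :=
              mul_le_mul hc (hC.2 x hx) (abs_nonneg _) ((abs_nonneg c).trans hc)
          _ = _ := by field_simp [hC.1.ne']
      linarith [neg_abs_le (c * v x)]
    · rw [Finsupp.notMem_support_iff.1 fun h => hx (hsup c h)]
  have hpos : 0 < (s.card : ℝ)⁻¹ / C := div_pos (inv_pos.2 hn) hC.1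
  have e := h.inj (hwt 0 (by simpa using hpos.le)) (hwt _ (abs_of_pos hpos).le)
    (by rw [hbary, hbary])
  intro x
  have := DFunLike.congr_fun e (x : V)
  rw [hg _ _ x.2, hg _ _ x.2, zero_mul, add_zero, left_eq_add, mul_eq_zero] at this
  rw [← hv]
  exact this.resolve_left hpos.ne'

/-- The simplicial complex with a given family of faces. -/
noncomputable def IsTri.complex {F : Set (Finset V)} (h : IsTri F) : SimplicialComplex ℝ V where
  faces := F
  isRelLowerSet_faces := fun _ hs => ⟨h.nonempty _ hs, fun t hts ht => h.down _ hs t hts ht⟩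
  indep hs := h.affineIndependent hs
  inter_subset_convexHull := by
    classical
    rintro s t hs ht x ⟨hxs, hxt⟩
    obtain ⟨μ, hμ, hμs, rfl⟩ := mem_convexHull_iff_weight.1 hxs
    obtain ⟨ν, hν, hνt, hb⟩ := mem_convexHull_iff_weight.1 hxt
    have := h.inj (h.mem_weights hν ht hνt) (h.mem_weights hμ hs hμs) hb
    subst this
    rw [← Finset.coe_inter]
    exact mem_convexHull_iff_weight.2 ⟨ν, hν, Finset.subset_inter hμs hνt, rfl⟩

theorem IsTri.complex_space {F : Set (Finset V)} (h : IsTri F) : h.complex.space = triSpace F :=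
  h.triSpace_eq.symm

theorem isTri_simplex [DecidableEq V] {s : Finset V}
    (hs : AffineIndependent ℝ ((↑) : s → V)) : IsTri {t : Finset V | t ⊆ s ∧ t.Nonempty} where
  finite := s.powerset.finite_toSet.subset fun t ht => by simpa using ht.1
  nonempty _ ht := ht.2
  down _ ht _ hu hne := ⟨hu.trans ht.1, hne⟩
  inj := fun _ hμ _ hν h => weight_unique hs hμ.2.1 hν.2.1 (by rw [hμ.1.2, hν.1.2]) h

/-- The image of a triangulation under a linear map that is injective on it. -/
theorem IsTri.image [DecidableEq W] {F : Set (Finset V)} (h : IsTri F) (p : V →ₗ[ℝ] W)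
    (hp : Set.InjOn p (triSpace F)) :
    IsTri ((fun s : Finset V => s.image p) '' F) ∧
      triSpace ((fun s : Finset V => s.image p) '' F) = p '' triSpace F := by
  classical
  have hvert : ∀ s ∈ F, ∀ x ∈ s, x ∈ triSpace F := fun s hs x hx =>
    h.convexHull_subset hs (subset_convexHull ℝ _ hx)
  let g : W → V := Function.invFunOn p (triSpace F)
  have hgp : ∀ x ∈ triSpace F, g (p x) = x := fun x hx => hp.leftInvOn_invFunOn hx
  have hbary : ∀ μ : V →₀ ℝ, bary (Finsupp.mapDomain p μ) = p (bary μ) := by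
    intro μ
    rw [bary, bary, Finsupp.linearCombination_mapDomain, Finsupp.apply_linearCombination]
    rfl
  have lift : ∀ ν ∈ weights ((fun s : Finset V => s.image p) '' F),
      Finsupp.mapDomain g ν ∈ weights F ∧ Finsupp.mapDomain p (Finsupp.mapDomain g ν) = ν := by
    rintro ν ⟨hν, s, hs, hsup⟩
    have hsup : s.image p = ν.support := hsup
    have h1 : (Finsupp.mapDomain g ν).support ⊆ s := by
      refine Finsupp.mapDomain_support.trans ?_
      rw [← hsup, Finset.image_image]
      intro y hy
      obtain ⟨x, hx, rfl⟩ := Finset.mem_image.1 hy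
      simpa [hgp x (hvert s hs x hx)] using hx
    refine ⟨h.mem_weights (hν.mapDomain g) hs h1, ?_⟩
    rw [← Finsupp.mapDomain_comp]
    conv_rhs => rw [← Finsupp.mapDomain_id (v := ν)]
    refine Finsupp.mapDomain_congr fun y hy => ?_
    rw [← hsup] at hy
    obtain ⟨x, hx, rfl⟩ := Finset.mem_image.1 hy
    simp [hgp x (hvert s hs x hx)]
  have push : ∀ μ ∈ weights F,
      Finsupp.mapDomain p μ ∈ weights ((fun s : Finset V => s.image p) '' F) := by
    intro μ hμ
    refine ⟨hμ.1.mapDomain p, μ.support, hμ.2, ?_⟩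
    refine (Finsupp.mapDomain_support_of_injOn μ fun x hx y hy e => ?_).symm
    exact hp (hvert _ hμ.2 x hx) (hvert _ hμ.2 y hy) e
  refine ⟨⟨h.finite.image _, ?_, ?_, ?_⟩, ?_⟩
  · rintro _ ⟨s, hs, rfl⟩
    exact (h.nonempty s hs).image _
  · rintro _ ⟨s, hs, rfl⟩ t ht hne
    obtain ⟨u, hu, rfl⟩ := Finset.subset_image_iff.1 ht
    exact ⟨u, h.down s hs u hu (Finset.image_nonempty.1 hne), rfl⟩
  · intro μ hμ ν hν e
    obtain ⟨h1, h2⟩ := lift μ hμ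
    obtain ⟨h3, h4⟩ := lift ν hν
    rw [← h2, ← h4, hbary, hbary] at e
    have := h.inj h1 h3 (hp ⟨_, h1, rfl⟩ ⟨_, h3, rfl⟩ e)
    rw [← h2, this, h4]
  · ext y
    constructor
    · rintro ⟨ν, hν, rfl⟩
      obtain ⟨h1, h2⟩ := lift ν hν
      exact ⟨_, ⟨_, h1, rfl⟩, by rw [← hbary, h2]⟩
    · rintro ⟨_, ⟨μ, hμ, rfl⟩, rfl⟩
      exact ⟨_, push μ hμ, hbary μ⟩

end Weights

/-! ### Bisection of triangulations by hyperplanes -/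

section Bisect

variable {V : Type*} [AddCommGroup V] [Module ℝ V]

/-- Every simplex of `F'` lies in a simplex of `F`. -/
def Refines (F' F : Set (Finset V)) : Prop :=
  ∀ s ∈ F', ∃ t ∈ F, (s : Set V) ⊆ convexHull ℝ (t : Set V)

theorem Refines.refl (F : Set (Finset V)) : Refines F F :=
  fun s hs => ⟨s, hs, subset_convexHull ℝ _⟩

theorem Refines.trans {F G H : Set (Finset V)} (h1 : Refines F G) (h2 : Refines G H) :
    Refines F H := by
  intro s hs
  obtain ⟨t, ht, hst⟩ := h1 s hs
  obtain ⟨u, hu, htu⟩ := h2 t ht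
  exact ⟨u, hu, hst.trans (convexHull_min htu (convex_convexHull ℝ _))⟩

/-- All simplices lie on one side of the hyperplane `α = 0`. -/
def Sided (F : Set (Finset V)) (α : V →ᵃ[ℝ] ℝ) : Prop :=
  ∀ s ∈ F, (∀ x ∈ s, 0 ≤ α x) ∨ (∀ x ∈ s, α x ≤ 0)

theorem Sided.of_refines {F' F : Set (Finset V)} {α : V →ᵃ[ℝ] ℝ} (h : Sided F α)
    (hr : Refines F' F) : Sided F' α := by
  intro s hs
  obtain ⟨t, ht, hst⟩ := hr s hs
  rcases h t ht with h | h
  · left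
    have hc : Convex ℝ {x | 0 ≤ α x} := (convex_Ici (0 : ℝ)).affine_preimage α
    exact fun x hx => convexHull_min (fun y hy => h y hy) hc (hst hx)
  · right
    have hc : Convex ℝ {x | α x ≤ 0} := (convex_Iic (0 : ℝ)).affine_preimage α
    exact fun x hx => convexHull_min (fun y hy => h y hy) hc (hst hx)

variable [DecidableEq V]

/-- Stellar subdivision of the edge `{p, q}` at the new vertex `m`. -/
def stellar (F : Set (Finset V)) (p q m : V) : Set (Finset V) :=
  {s | s.Nonempty ∧ ¬(p ∈ s ∧ q ∈ s) ∧
    ((m ∉ s ∧ s ∈ F) ∨ (m ∈ s ∧ insert p (insert q (s.erase m)) ∈ F))}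

theorem IsTri.stellar {F : Set (Finset V)} (h : IsTri F) {p q m : V} {a b : ℝ} (hpq : p ≠ q)
    (he : {p, q} ∈ F) (ha : 0 < a) (hb : 0 < b) (hab : a + b = 1) (hm : m = a • p + b • q) :
    (∀ s ∈ F, m ∉ s) ∧ IsTri (stellar F p q m) ∧ triSpace (stellar F p q m) = triSpace F ∧
      Refines (stellar F p q m) F := by
  have hmF : ∀ s ∈ F, m ∉ s := by
    intro s hs hms
    have h1 : Finsupp.single m (1 : ℝ) ∈ weights F := by
      refine h.mem_weights ⟨fun x => ?_, by simp⟩ hs ?_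
      · rw [Finsupp.single_apply]; split_ifs <;> norm_num
      · exact Finsupp.support_single_subset.trans (by simpa using hms)
    have h2 : Finsupp.single p a + Finsupp.single q b ∈ weights F := by
      refine h.mem_weights ⟨fun x => ?_, by simp [hab]⟩ he ?_
      · rw [Finsupp.add_apply, Finsupp.single_apply, Finsupp.single_apply]
        split_ifs <;> linarith
      · refine Finsupp.support_add.trans (Finset.union_subset ?_ ?_)
        · exact Finsupp.support_single_subset.trans (by simp)
        · exact Finsupp.support_single_subset.trans (by simp)
    have h3 := h.inj h1 h2 (by simp [hm])
    have h4 := DFunLike.congr_fun h3 p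
    have h5 := DFunLike.congr_fun h3 q
    simp only [Finsupp.add_apply, Finsupp.single_apply, hpq, hpq.symm, if_true, if_false] at h4 h5
    split_ifs at h4 h5 with h6 h7
    · exact hpq (h6.symm.trans h7)
    all_goals linarith
  have hmp : m ≠ p := fun e => hmF _ he (by simp [e])
  have hmq : m ≠ q := fun e => hmF _ he (by simp [e])
  obtain ⟨d, hd⟩ : ∃ d, d = Finsupp.single p a + Finsupp.single q b - Finsupp.single m (1 : ℝ) :=
    ⟨_, rfl⟩
  have dm : mass d = 0 := by simp [hd, hab]
  have db : bary d = 0 := by simp [hd, hm]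
  have dap : d p = a := by simp [hd, hpq, hmp]
  have daq : d q = b := by simp [hd, hpq, hmq]
  have dam : d m = -1 := by simp [hd, hmp.symm, hmq.symm]
  have dx : ∀ x, x ≠ p → x ≠ q → x ≠ m → d x = 0 := fun x h1 h2 h3 => by
    simp [hd, h1.symm, h2.symm, h3.symm]
  have collapse : ∀ μ ∈ weights (PLReeb.stellar F p q m), μ + μ m • d ∈ weights F := by
    rintro μ ⟨hμ, -, -, hs⟩
    have hval : ∀ x, (μ + μ m • d) x = μ x + μ m * d x := fun x => by simp
    have hw : IsWeight (μ + μ m • d) := by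
      refine ⟨fun x => ?_, by simp [hμ.2, dm]⟩
      rw [hval]
      have h0 := hμ.1 x
      have h1 := hμ.1 m
      by_cases e1 : x = p
      · rw [e1, dap, ← e1]; positivity
      by_cases e2 : x = q
      · rw [e2, daq, ← e2]; positivity
      by_cases e3 : x = m
      · rw [e3, dam]; linarith
      · rw [dx x e1 e2 e3]; linarith
    rcases hs with ⟨hs, hF⟩ | ⟨hs, hF⟩
    · rw [Finsupp.notMem_support_iff.1 hs, zero_smul, add_zero]
      exact ⟨hμ, hF⟩
    · refine h.mem_weights hw hF fun x hx => ?_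
      rw [Finsupp.mem_support_iff, hval] at hx
      by_cases e1 : x = p
      · simp [e1]
      by_cases e2 : x = q
      · simp [e2]
      by_cases e3 : x = m
      · rw [e3, dam] at hx; exact absurd (by ring) hx
      · rw [dx x e1 e2 e3] at hx
        simp only [Finset.mem_insert, Finset.mem_erase, Finsupp.mem_support_iff]
        exact Or.inr (Or.inr ⟨e3, by simpa using hx⟩)
  have hzero : ∀ μ ∈ weights (PLReeb.stellar F p q m), μ p = 0 ∨ μ q = 0 := by
    rintro μ ⟨-, -, hs, -⟩
    by_contra! hne
    exact hs ⟨Finsupp.mem_support_iff.2 hne.1, Finsupp.mem_support_iff.2 hne.2⟩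
  have hle : ∀ μ ∈ weights (PLReeb.stellar F p q m), ∀ ν ∈ weights (PLReeb.stellar F p q m),
      μ + μ m • d = ν + ν m • d → μ m ≤ ν m := by
    intro μ hμ ν hν e
    by_contra! hlt
    have ep := DFunLike.congr_fun e p
    have eq := DFunLike.congr_fun e q
    simp only [Finsupp.add_apply, Finsupp.smul_apply, smul_eq_mul, dap, daq] at ep eq
    have h1 : 0 < (μ m - ν m) * a := mul_pos (sub_pos.2 hlt) ha
    have h2 : 0 < (μ m - ν m) * b := mul_pos (sub_pos.2 hlt) hb
    have h3 := hμ.1.1 p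
    have h4 := hμ.1.1 q
    rcases hzero ν hν with h5 | h5 <;> nlinarith
  refine ⟨hmF, ⟨?_, fun s hs => hs.1, ?_, ?_⟩, ?_, ?_⟩
  · refine (h.finite.biUnion fun u _ => (insert m u).powerset.finite_toSet).subset fun s hs => ?_
    rcases hs.2.2 with ⟨h1, h2⟩ | ⟨h1, h2⟩
    · exact Set.mem_biUnion h2 (by simp)
    · refine Set.mem_biUnion h2 ?_
      simp only [Finset.coe_powerset, Set.mem_preimage, Set.mem_powerset_iff, Finset.coe_subset]
      intro x hx
      by_cases e : x = m <;> simp [e, hx]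
  · rintro s ⟨-, hs1, hs2⟩ t hts ht
    refine ⟨ht, fun h' => hs1 ⟨hts h'.1, hts h'.2⟩, ?_⟩
    by_cases hmt : m ∈ t
    · right
      refine ⟨hmt, ?_⟩
      rcases hs2 with h' | h'
      · exact absurd (hts hmt) h'.1
      · refine h.down _ h'.2 _ ?_ (by simp)
        exact Finset.insert_subset_insert _ (Finset.insert_subset_insert _
          (Finset.erase_subset_erase _ hts))
    · left
      refine ⟨hmt, ?_⟩
      rcases hs2 with h' | h'
      · exact h.down _ h'.2 _ hts ht
      · refine h.down _ h'.2 _ (fun x hx => ?_) ht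
        have : x ≠ m := fun e => hmt (e ▸ hx)
        simp [this, hts hx]
  · intro μ hμ ν hν e
    have e' : μ + μ m • d = ν + ν m • d :=
      h.inj (collapse μ hμ) (collapse ν hν) (by simp [db, e])
    have : μ m = ν m := le_antisymm (hle μ hμ ν hν e') (hle ν hν μ hμ e'.symm)
    rw [this] at e'
    exact add_right_cancel e'
  · refine Set.Subset.antisymm ?_ ?_
    · rintro _ ⟨μ, hμ, rfl⟩
      exact ⟨_, collapse μ hμ, by simp [db]⟩
    · rintro _ ⟨μ, hμ, rfl⟩
      obtain ⟨c, hc⟩ : ∃ c, c = min (μ p / a) (μ q / b) := ⟨_, rfl⟩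
      have hμm : μ m = 0 := Finsupp.notMem_support_iff.1 (hmF _ hμ.2)
      have hcp : c * a ≤ μ p := by rw [← le_div_iff₀ ha, hc]; exact min_le_left _ _
      have hcq : c * b ≤ μ q := by rw [← le_div_iff₀ hb, hc]; exact min_le_right _ _
      have hc0 : 0 ≤ c := hc ▸ le_min (div_nonneg (hμ.1.1 p) ha.le) (div_nonneg (hμ.1.1 q) hb.le)
      have hval : ∀ x, (μ - c • d) x = μ x - c * d x := fun x => by simp
      have hw : IsWeight (μ - c • d) := by
        refine ⟨fun x => ?_, by simp [hμ.1.2, dm]⟩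
        rw [hval]
        by_cases e1 : x = p
        · rw [e1, dap]; linarith
        by_cases e2 : x = q
        · rw [e2, daq]; linarith
        by_cases e3 : x = m
        · rw [e3, dam]; linarith
        · rw [dx x e1 e2 e3]; linarith [hμ.1.1 x]
      refine ⟨μ - c • d, ⟨hw, hw.support_nonempty, ?_, ?_⟩, by simp [db]⟩
      · rintro ⟨h1, h2⟩
        rw [Finsupp.mem_support_iff, hval] at h1 h2
        rw [dap] at h1
        rw [daq] at h2
        rcases min_choice (μ p / a) (μ q / b) with h3 | h3
        · rw [hc, h3] at h1
          exact h1 (by field_simp; ring)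
        · rw [hc, h3] at h2
          exact h2 (by field_simp; ring)
      · rw [Finsupp.notMem_support_iff, Finsupp.mem_support_iff, hval, dam, hμm]
        by_cases hcz : c = 0
        · left
          rw [hcz]
          exact ⟨by simp, by simpa using hμ.2⟩
        · right
          refine ⟨by simpa using hcz, h.down _ hμ.2 _ ?_ (by simp)⟩
          have hc1 := lt_of_le_of_ne hc0 (Ne.symm hcz)
          have hp' : p ∈ μ.support := Finsupp.mem_support_iff.2 (by nlinarith [mul_pos hc1 ha])
          have hq' : q ∈ μ.support := Finsupp.mem_support_iff.2 (by nlinarith [mul_pos hc1 hb])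
          intro x hx
          by_cases e1 : x = p
          · exact e1 ▸ hp'
          by_cases e2 : x = q
          · exact e2 ▸ hq'
          simp only [Finset.mem_insert, e1, e2, false_or, Finset.mem_erase] at hx
          rw [Finsupp.mem_support_iff, hval, dx x e1 e2 hx.1] at hx
          exact Finsupp.mem_support_iff.2 (by simpa using hx.2)
  · rintro s ⟨-, -, ⟨h1, h2⟩ | ⟨h1, h2⟩⟩
    · exact ⟨s, h2, subset_convexHull ℝ _⟩
    · refine ⟨_, h2, fun x hx => ?_⟩
      by_cases e : x = m
      · rw [e, hm]
        exact convex_convexHull ℝ _ (subset_convexHull ℝ _ (by simp))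
          (subset_convexHull ℝ _ (by simp)) ha.le hb.le hab
      · refine subset_convexHull ℝ _ ?_
        have : x ∈ s := hx
        simp [e, this]

theorem IsTri.exists_sided {F : Set (Finset V)} (h : IsTri F) (α : V →ᵃ[ℝ] ℝ) :
    ∃ F', IsTri F' ∧ triSpace F' = triSpace F ∧ Refines F' F ∧ Sided F' α := by
  let C : Set (Finset V) → Set (V × V) := fun F => {e | α e.1 < 0 ∧ 0 < α e.2 ∧ {e.1, e.2} ∈ F}
  have hfin : ∀ F, IsTri F → (C F).Finite := by
    intro F hF
    refine (hF.finite.biUnion fun s _ => (s ×ˢ s).finite_toSet).subset ?_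
    rintro ⟨x, y⟩ ⟨-, -, h3⟩
    exact Set.mem_biUnion h3 (by simp)
  obtain ⟨n, hn⟩ : ∃ n, n = (C F).ncard := ⟨_, rfl⟩
  induction n using Nat.strong_induction_on generalizing F with
  | _ n ih =>
    by_cases hC : C F = ∅
    · refine ⟨F, h, rfl, Refines.refl F, fun s hs => ?_⟩
      by_contra! hne
      obtain ⟨⟨x, hx, hx'⟩, ⟨y, hy, hy'⟩⟩ := hne
      have : (x, y) ∈ C F :=
        ⟨hx', hy', h.down s hs _ (by simp [Finset.insert_subset_iff, hx, hy]) (by simp)⟩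
      rw [hC] at this
      exact this
    · obtain ⟨⟨p, q⟩, hp, hq, he⟩ := Set.nonempty_iff_ne_empty.2 hC
      simp only at hp hq he
      have hne : p ≠ q := by rintro rfl; linarith
      have hD : 0 < α q - α p := by linarith
      obtain ⟨a, ha'⟩ : ∃ a, a = α q / (α q - α p) := ⟨_, rfl⟩
      obtain ⟨b, hb'⟩ : ∃ b, b = -α p / (α q - α p) := ⟨_, rfl⟩
      have ha : 0 < a := ha' ▸ div_pos hq hD
      have hb : 0 < b := hb' ▸ div_pos (by linarith) hD
      have hab : a + b = 1 := by rw [ha', hb']; field_simp; ring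
      obtain ⟨m, hm⟩ : ∃ m, m = a • p + b • q := ⟨_, rfl⟩
      have hαm : α m = 0 := by
        rw [hm, Convex.combo_affine_apply hab, ha', hb', smul_eq_mul, smul_eq_mul]
        field_simp
        ring
      obtain ⟨hmF, h1, h2, h3⟩ := h.stellar hne he ha hb hab hm
      have hlt : (C (PLReeb.stellar F p q m)).ncard < (C F).ncard := by
        refine Set.ncard_lt_ncard ?_ (hfin F h)
        refine Set.ssubset_iff_of_subset ?_ |>.2 ⟨(p, q), ⟨hp, hq, he⟩, fun hc => ?_⟩
        · rintro ⟨x, y⟩ ⟨hx, hy, -, -, ⟨-, hF⟩ | ⟨hF, -⟩⟩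
          · exact ⟨hx, hy, hF⟩
          · simp only [Finset.mem_insert, Finset.mem_singleton] at hF hx hy
            rcases hF with rfl | rfl <;> linarith
        · exact hc.2.2.2.1 (by simp)
      obtain ⟨F', g1, g2, g3, g4⟩ := ih _ (hn ▸ hlt) h1 rfl
      exact ⟨F', g1, g2.trans h2, g3.trans h3, g4⟩

theorem IsTri.exists_forall_sided {F : Set (Finset V)} (h : IsTri F) (A : Finset (V →ᵃ[ℝ] ℝ)) :
    ∃ F', IsTri F' ∧ triSpace F' = triSpace F ∧ ∀ α ∈ A, Sided F' α := by
  classical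
  induction A using Finset.induction_on with
  | empty => exact ⟨F, h, rfl, by simp⟩
  | insert α A _ ih =>
    obtain ⟨F', h1, h2, h3⟩ := ih
    obtain ⟨G, g1, g2, g3, g4⟩ := h1.exists_sided α
    refine ⟨G, g1, g2.trans h2, fun β hβ => ?_⟩
    rcases Finset.mem_insert.1 hβ with rfl | hβ
    · exact g4
    · exact (h3 β hβ).of_refines g3

end Bisect

section Triangulate

variable {V : Type*} [NormedAddCommGroup V] [NormedSpace ℝ V] [FiniteDimensional ℝ V]

theorem exists_isTri_superset {S : Set V} (hS : Bornology.IsBounded S) :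
    ∃ F : Set (Finset V), IsTri F ∧ S ⊆ triSpace F := by
  classical
  obtain ⟨b, hb, -⟩ := exists_mem_interior_convexHull_affineBasis (Metric.ball_mem_nhds (0 : V) one_pos)
  obtain ⟨δ, hδ, hball⟩ := Metric.isOpen_iff.1 isOpen_interior _ hb
  obtain ⟨R, hR, hSR⟩ := hS.subset_ball_lt 0 0
  let c : ℝ := R / δ
  have hc : 0 < c := div_pos hR hδ
  let e : V ≃ₗ[ℝ] V := LinearEquiv.smulOfNeZero ℝ V c hc.ne'
  have hind : AffineIndependent ℝ (e ∘ b) :=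
    b.ind.map' (e : V →ₗ[ℝ] V).toAffineMap e.injective
  let s : Finset V := Finset.univ.image (e ∘ b)
  have hrange : (s : Set V) = Set.range (e ∘ b) := by simp [s]; rfl
  have hs : AffineIndependent ℝ ((↑) : s → V) := by
    have := hind.range
    rw [← hrange] at this
    exact this
  have htri := isTri_simplex hs
  refine ⟨_, htri, fun x hx => ?_⟩
  have hne : s.Nonempty := by
    have : Nonempty (Fin (Module.finrank ℝ V + 1)) := inferInstance
    simp [s]
  refine htri.convexHull_subset (s := s) ⟨subset_rfl, hne⟩ ?_
  have h1 : c⁻¹ • x ∈ convexHull ℝ (Set.range b) := by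
    refine interior_subset (hball ?_)
    have hx' := hSR hx
    rw [mem_ball_zero_iff] at hx' ⊢
    rw [norm_smul, norm_inv, Real.norm_of_nonneg hc.le]
    rw [inv_mul_lt_iff₀ hc]
    simp only [c]
    rwa [div_mul_cancel₀ _ hδ.ne']
  have h2 : x = e (c⁻¹ • x) := by simp [e, smul_smul, hc.ne']
  rw [hrange, Set.range_comp, h2]
  have := (e : V →ₗ[ℝ] V).image_convexHull (Set.range b)
  rw [LinearEquiv.coe_coe] at this
  rw [← this]
  exact Set.mem_image_of_mem _ h1

/-- Compact semilinear sets can be triangulated. -/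
theorem SL.exists_isTri {S : Set V} (hS : SL S) (hc : IsCompact S) :
    ∃ F : Set (Finset V), IsTri F ∧ triSpace F = S := by
  classical
  obtain ⟨A, hA⟩ := hS
  obtain ⟨F₀, h₀, hS₀⟩ := exists_isTri_superset hc.isBounded
  obtain ⟨F, hF, hsp, hside⟩ := h₀.exists_forall_sided A
  rw [← hsp] at hS₀
  let G : Set (Finset V) := {s ∈ F | convexHull ℝ (s : Set V) ⊆ S}
  have hG : IsTri G :=
    { finite := hF.finite.subset fun s hs => hs.1
      nonempty := fun s hs => hF.nonempty s hs.1
      down := fun s hs t hts ht =>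
        ⟨hF.down s hs.1 t hts ht, (convexHull_mono (by exact_mod_cast hts)).trans hs.2⟩
      inj := hF.inj.mono (show weights G ⊆ weights F from fun μ hμ => ⟨hμ.1, hμ.2.1⟩) }
  refine ⟨G, hG, Set.Subset.antisymm ?_ fun x hx => ?_⟩
  · rw [hG.triSpace_eq]
    exact Set.iUnion₂_subset fun s hs => hs.2
  obtain ⟨μ, hμ, rfl⟩ := hS₀ hx
  have hval : ∀ (a : V →ᵃ[ℝ] ℝ) (ν : V →₀ ℝ), IsWeight ν → ν.support ⊆ μ.support →
      a (bary ν) = ∑ x ∈ μ.support, ν x * a x := by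
    intro a ν hν hsub
    rw [bary_eq_sum hsub]
    have h1 : ∑ x ∈ μ.support, ν x = 1 := by rw [← mass_eq_sum hsub, hν.2]
    have := μ.support.map_affineCombination id ν h1 a
    rw [Finset.affineCombination_eq_linear_combination _ _ _ h1,
      Finset.affineCombination_eq_linear_combination _ _ _ h1] at this
    simpa using this
  have hsign : ∀ a ∈ A, ∀ ν : V →₀ ℝ, IsWeight ν → ν.support = μ.support →
      SignType.sign (a (bary μ)) = SignType.sign (a (bary ν)) := by
    intro a ha ν hν hsup
    rw [hval a ν hν hsup.subset, hval a μ hμ.1 subset_rfl]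
    have hμp : ∀ x ∈ μ.support, 0 < μ x := fun x hx =>
      lt_of_le_of_ne (hμ.1.1 x) (Ne.symm (Finsupp.mem_support_iff.1 hx))
    have hνp : ∀ x ∈ μ.support, 0 < ν x := fun x hx =>
      lt_of_le_of_ne (hν.1 x) (Ne.symm (Finsupp.mem_support_iff.1 (hsup ▸ hx)))
    rcases hside a ha _ hμ.2 with h | h
    · by_cases hz : ∀ x ∈ μ.support, a x = 0
      · rw [Finset.sum_eq_zero fun x hx => by rw [hz x hx, mul_zero],
          Finset.sum_eq_zero fun x hx => by rw [hz x hx, mul_zero]]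
      · push Not at hz
        obtain ⟨x, hx, hne⟩ := hz
        have hpos := lt_of_le_of_ne (h x hx) hne.symm
        rw [sign_pos, sign_pos]
        · exact Finset.sum_pos' (fun y hy => mul_nonneg (hνp y hy).le (h y hy))
            ⟨x, hx, mul_pos (hνp x hx) hpos⟩
        · exact Finset.sum_pos' (fun y hy => mul_nonneg (hμp y hy).le (h y hy))
            ⟨x, hx, mul_pos (hμp x hx) hpos⟩
    · by_cases hz : ∀ x ∈ μ.support, a x = 0
      · rw [Finset.sum_eq_zero fun x hx => by rw [hz x hx, mul_zero],
          Finset.sum_eq_zero fun x hx => by rw [hz x hx, mul_zero]]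
      · push Not at hz
        obtain ⟨x, hx, hne⟩ := hz
        have hneg := lt_of_le_of_ne (h x hx) hne
        rw [sign_neg, sign_neg]
        · exact Finset.sum_neg' (fun y hy => mul_nonpos_of_nonneg_of_nonpos (hνp y hy).le (h y hy))
            ⟨x, hx, mul_neg_of_pos_of_neg (hνp x hx) hneg⟩
        · exact Finset.sum_neg' (fun y hy => mul_nonpos_of_nonneg_of_nonpos (hμp y hy).le (h y hy))
            ⟨x, hx, mul_neg_of_pos_of_neg (hμp x hx) hneg⟩
  refine ⟨μ, ⟨hμ.1, hμ.2, ?_⟩, rfl⟩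
  intro y hy
  obtain ⟨ν, hν, hsub, rfl⟩ := mem_convexHull_iff_weight.1 hy
  have hmem : ∀ t : ℝ, 0 < t → t ≤ 1 → bary ν + t • (bary μ - bary ν) ∈ S := by
    intro t ht0 ht1
    have e : bary ν + t • (bary μ - bary ν) = bary ((1 - t) • ν + t • μ) := by
      simp only [map_add, map_smul]
      module
    have hval' : ∀ x, ((1 - t) • ν + t • μ) x = (1 - t) * ν x + t * μ x := fun x => by simp
    have hw : IsWeight ((1 - t) • ν + t • μ) := by
      refine ⟨fun x => ?_, by simp [hν.2, hμ.1.2]⟩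
      rw [hval']
      have := hν.1 x
      have := hμ.1.1 x
      have : 0 ≤ 1 - t := by linarith
      positivity
    rw [e]
    refine hA _ _ (fun a ha => hsign a ha _ hw ?_) hx
    ext x
    rw [Finsupp.mem_support_iff, Finsupp.mem_support_iff, hval']
    have h1 := hν.1 x
    have h2 := hμ.1.1 x
    have h3 : 0 ≤ (1 - t) * ν x := mul_nonneg (by linarith) h1
    constructor
    · intro hne h0
      have : ν x = 0 := Finsupp.notMem_support_iff.1 fun hx => Finsupp.mem_support_iff.1 (hsub hx) h0
      rw [h0, this] at hne
      simp at hne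
    · intro hne
      have := mul_pos ht0 (lt_of_le_of_ne h2 (Ne.symm hne))
      linarith
  have hlim : Filter.Tendsto (fun t : ℝ => bary ν + t • (bary μ - bary ν)) (nhdsWithin 0 (Set.Ioi 0))
      (nhds (bary ν)) := by
    have : Continuous fun t : ℝ => bary ν + t • (bary μ - bary ν) := by fun_prop
    have h0 := this.tendsto 0
    rw [zero_smul, add_zero] at h0
    exact h0.mono_left nhdsWithin_le_nhds
  refine hc.isClosed.mem_of_tendsto hlim ?_
  filter_upwards [Ioc_mem_nhdsGT (zero_lt_one' ℝ)] with t ht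
  exact hmem t ht.1 ht.2

end Triangulate

section SLOn

variable {V W X : Type*} [NormedAddCommGroup V] [NormedSpace ℝ V] [FiniteDimensional ℝ V]
  [NormedAddCommGroup W] [NormedSpace ℝ W] [FiniteDimensional ℝ W]
  [NormedAddCommGroup X] [NormedSpace ℝ X] [FiniteDimensional ℝ X]
  {φ χ : V → W} {S T : Set V}

/-- The graph of `φ` over `S` is semilinear. -/
def SLOn (φ : V → W) (S : Set V) : Prop := SL {p : V × W | p.1 ∈ S ∧ p.2 = φ p.1}

theorem SLOn.dom (h : SLOn φ S) : SL S := by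
  have := SL.exists (P := fun x y => x ∈ S ∧ y = φ x) h
  simpa using this

theorem SLOn.congr (h : SLOn φ S) (hc : EqOn χ φ S) : SLOn χ S := by
  unfold SLOn at *
  convert h using 1
  ext p
  exact and_congr_right fun hp => by rw [hc hp]

theorem SLOn.mono (h : SLOn φ S) (hT : SL T) (hTS : T ⊆ S) : SLOn φ T := by
  have := (hT.preimage (g := fun p : V × W => p.1) (by fun_prop)).and h
  unfold SLOn
  convert this using 1
  ext p
  exact ⟨fun hp => ⟨hp.1, hTS hp.1, hp.2⟩, fun hp => ⟨hp.1, hp.2.2⟩⟩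

theorem SLOn.union (h : SLOn φ S) (h' : SLOn φ T) : SLOn φ (S ∪ T) := by
  have := h.or h'
  unfold SLOn
  convert this using 1
  ext p
  exact or_and_right

theorem IsAff.slOn (h : IsAff φ) (hS : SL S) : SLOn φ S :=
  (hS.preimage (g := fun p : V × W => p.1) (by fun_prop)).and (SL.eq (by fun_prop) (by fun_prop))

theorem SLOn.exists_and {P : V → W → Prop} (h : SLOn φ S) (hP : SL {p : V × W | P p.1 p.2}) :
    SL {x | x ∈ S ∧ P x (φ x)} := by
  have := SL.exists (P := fun x y => (x ∈ S ∧ y = φ x) ∧ P x y) (SL.and h hP)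
  convert this using 1
  ext x
  exact ⟨fun hx => ⟨_, ⟨hx.1, rfl⟩, hx.2⟩, fun ⟨y, ⟨hx, hy⟩, hp⟩ => ⟨hx, hy ▸ hp⟩⟩

theorem SLOn.comp {χ : W → X} {T : Set W} (hχ : SLOn χ T) (h : SLOn φ S) (hm : MapsTo φ S T) :
    SLOn (fun x => χ (φ x)) S := by
  have := SL.exists (P := fun (p : V × X) (y : W) =>
    (p.1 ∈ S ∧ y = φ p.1) ∧ (y ∈ T ∧ p.2 = χ y))
    ((SL.preimage h (g := fun q : (V × X) × W => (q.1.1, q.2)) (by fun_prop)).and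
      (SL.preimage hχ (g := fun q : (V × X) × W => (q.2, q.1.2)) (by fun_prop)))
  unfold SLOn
  convert this using 1
  ext p
  constructor
  · rintro ⟨h1, h2⟩
    exact ⟨_, ⟨h1, rfl⟩, hm h1, h2⟩
  · rintro ⟨y, ⟨h1, rfl⟩, -, h2⟩
    exact ⟨h1, h2⟩

theorem SLOn.prodMk {χ : V → X} (h : SLOn φ S) (hχ : SLOn χ S) :
    SLOn (fun x => (φ x, χ x)) S := by
  have := (SL.preimage h (g := fun q : V × (W × X) => (q.1, q.2.1)) (by fun_prop)).and
      (SL.preimage hχ (g := fun q : V × (W × X) => (q.1, q.2.2)) (by fun_prop))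
  unfold SLOn
  convert this using 1
  ext ⟨x, y, z⟩
  simp only [mem_ofPred_eq, Prod.mk.injEq]
  tauto

theorem SLOn.pi {ι : Type*} [Fintype ι] {φ : V → ι → ℝ} (hS : SL S)
    (h : ∀ i, SLOn (fun x => φ x i) S) : SLOn φ S := by
  have := (hS.preimage (g := fun p : V × (ι → ℝ) => p.1) (by fun_prop)).and
    (SL.forall fun i => SL.preimage (h i) (g := fun p : V × (ι → ℝ) => (p.1, p.2 i)) (by fun_prop))
  unfold SLOn
  convert this using 1
  ext ⟨x, y⟩
  simp only [mem_ofPred_eq, funext_iff]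
  constructor
  · exact fun hx => ⟨hx.1, fun i => ⟨hx.1, hx.2 i⟩⟩
  · exact fun hx => ⟨hx.1, fun i => (hx.2 i).2⟩

theorem SLOn.image (h : SLOn φ S) : SL (φ '' S) := by
  have := SL.image h (g := fun p : V × W => p.2) (by fun_prop)
  convert this using 1
  ext y
  constructor
  · rintro ⟨x, hx, rfl⟩
    exact ⟨(x, φ x), ⟨hx, rfl⟩, rfl⟩
  · rintro ⟨p, ⟨hx, hy⟩, rfl⟩
    exact ⟨p.1, hx, hy.symm⟩

theorem SLOn.leftInv {ψ : W → V} (h : SLOn φ S) (hψ : LeftInvOn ψ φ S) : SLOn ψ (φ '' S) := by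
  have := SL.preimage h (g := fun p : W × V => (p.2, p.1)) (by fun_prop)
  unfold SLOn
  convert this using 1
  ext ⟨y, x⟩
  constructor
  · rintro ⟨⟨x', hx, rfl⟩, h2⟩
    obtain rfl : x = x' := h2.trans (hψ hx)
    exact ⟨hx, rfl⟩
  · rintro ⟨hx, hy⟩
    replace hy : y = φ x := hy
    subst hy
    exact ⟨⟨x, hx, rfl⟩, (hψ hx).symm⟩

theorem SLOn.exists_real_and {P : V → ℝ → ℝ → Prop} {a b : V → ℝ} (ha : SLOn a S) (hb : SLOn b S)
    (hP : SL {p : V × ℝ × ℝ | P p.1 p.2.1 p.2.2}) : SL {x | x ∈ S ∧ P x (a x) (b x)} :=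
  (ha.prodMk hb).exists_and (P := fun x q => P x q.1 q.2) hP

theorem SLOn.le {a b : V → ℝ} (ha : SLOn a S) (hb : SLOn b S) : SL {x | x ∈ S ∧ a x ≤ b x} :=
  ha.exists_real_and hb (P := fun _ s t => s ≤ t) (SL.le (by fun_prop) (by fun_prop))

theorem SLOn.eq {a b : V → ℝ} (ha : SLOn a S) (hb : SLOn b S) : SL {x | x ∈ S ∧ a x = b x} :=
  ha.exists_real_and hb (P := fun _ s t => s = t) (SL.eq_real (by fun_prop) (by fun_prop))

theorem slOn_max : SLOn (fun p : ℝ × ℝ => max p.1 p.2) univ := by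
  have h1 := IsAff.slOn (φ := fun p : ℝ × ℝ => p.2) (by fun_prop)
    (SL.le (g := fun p : ℝ × ℝ => p.1) (h := fun p => p.2) (by fun_prop) (by fun_prop))
  have h2 := IsAff.slOn (φ := fun p : ℝ × ℝ => p.1) (by fun_prop)
    (SL.le (g := fun p : ℝ × ℝ => p.2) (h := fun p => p.1) (by fun_prop) (by fun_prop))
  convert (h1.congr fun p hp => max_eq_right hp).union (h2.congr fun p hp => max_eq_left hp)
  ext p
  simpa using le_total p.1 p.2

end SLOn

section PLOn

variable {V W X : Type*} [NormedAddCommGroup V] [NormedSpace ℝ V] [FiniteDimensional ℝ V]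
  [NormedAddCommGroup W] [NormedSpace ℝ W] [FiniteDimensional ℝ W]
  [NormedAddCommGroup X] [NormedSpace ℝ X] [FiniteDimensional ℝ X]
  {φ χ : V → W} {S T : Set V}

theorem IsAff.continuous (h : IsAff φ) : Continuous φ := by
  obtain ⟨a, rfl⟩ := h
  exact a.continuous_of_finiteDimensional

/-- Continuous maps with semilinear graph. -/
structure PLOn (φ : V → W) (S : Set V) : Prop where
  cont : ContinuousOn φ S
  sl : SLOn φ S

theorem PLOn.dom (h : PLOn φ S) : SL S := h.sl.dom

theorem PLOn.congr (h : PLOn φ S) (hc : EqOn χ φ S) : PLOn χ S := ⟨h.1.congr hc, h.2.congr hc⟩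

theorem PLOn.mono (h : PLOn φ S) (hT : SL T) (hTS : T ⊆ S) : PLOn φ T :=
  ⟨h.1.mono hTS, h.2.mono hT hTS⟩

theorem PLOn.union (h : PLOn φ S) (h' : PLOn φ T) (hS : IsClosed S) (hT : IsClosed T) :
    PLOn φ (S ∪ T) :=
  ⟨h.1.union_of_isClosed h'.1 hS hT, h.2.union h'.2⟩

theorem IsAff.plOn (h : IsAff φ) (hS : SL S) : PLOn φ S := ⟨h.continuous.continuousOn, h.slOn hS⟩

theorem PLOn.comp {χ : W → X} {T : Set W} (hχ : PLOn χ T) (h : PLOn φ S) (hm : MapsTo φ S T) :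
    PLOn (fun x => χ (φ x)) S :=
  ⟨hχ.1.comp h.1 hm, hχ.2.comp h.2 hm⟩

theorem IsAff.comp_plOn {g : W → X} (hg : IsAff g) (h : PLOn φ S) : PLOn (fun x => g (φ x)) S :=
  (hg.plOn SL.univ).comp h fun _ _ => trivial

theorem PLOn.prodMk {χ : V → X} (h : PLOn φ S) (hχ : PLOn χ S) : PLOn (fun x => (φ x, χ x)) S :=
  ⟨h.1.prodMk hχ.1, h.2.prodMk hχ.2⟩

theorem PLOn.pi {ι : Type*} [Fintype ι] {φ : V → ι → ℝ} (hS : SL S)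
    (h : ∀ i, PLOn (fun x => φ x i) S) : PLOn φ S :=
  ⟨continuousOn_pi.2 fun i => (h i).1, SLOn.pi hS fun i => (h i).2⟩

theorem PLOn.max {a b : V → ℝ} (ha : PLOn a S) (hb : PLOn b S) :
    PLOn (fun x => max (a x) (b x)) S :=
  ⟨(continuous_fst.max continuous_snd).comp_continuousOn (ha.1.prodMk hb.1), slOn_max.comp (ha.2.prodMk hb.2) fun _ _ => trivial⟩

theorem PLOn.neg (h : PLOn φ S) : PLOn (fun x => - φ x) S :=
  IsAff.comp_plOn (g := fun y => -y) (by fun_prop) h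

theorem PLOn.min {a b : V → ℝ} (ha : PLOn a S) (hb : PLOn b S) :
    PLOn (fun x => min (a x) (b x)) S :=
  (ha.neg.max hb.neg).neg.congr fun x _ => by simp [max_neg_neg]

theorem PLOn.abs {a : V → ℝ} (ha : PLOn a S) : PLOn (fun x => |a x|) S := ha.max ha.neg

theorem PLOn.add (h : PLOn φ S) (h' : PLOn χ S) : PLOn (fun x => φ x + χ x) S :=
  IsAff.comp_plOn (g := fun p : W × W => p.1 + p.2) (by fun_prop) (h.prodMk h')

theorem PLOn.sub (h : PLOn φ S) (h' : PLOn χ S) : PLOn (fun x => φ x - χ x) S :=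
  IsAff.comp_plOn (g := fun p : W × W => p.1 - p.2) (by fun_prop) (h.prodMk h')

theorem PLOn.const_smul (c : ℝ) (h : PLOn φ S) : PLOn (fun x => c • φ x) S :=
  IsAff.comp_plOn (g := fun y => c • y) (by fun_prop) h

theorem PLOn.sum {ι : Type*} (s : Finset ι) {φ : ι → V → W} (hS : SL S)
    (h : ∀ i ∈ s, PLOn (φ i) S) : PLOn (fun x => ∑ i ∈ s, φ i x) S := by
  classical
  induction s using Finset.induction_on with
  | empty =>
    refine ⟨by simpa using continuousOn_const, ?_⟩
    simpa using (isAff_const (0 : W)).slOn hS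
  | insert i s hi ih =>
    simp only [Finset.sum_insert hi]
    exact (h i (by simp)).add (ih fun j hj => h j (by simp [hj]))

/-- A map with compact graph is continuous. -/
theorem continuousOn_of_isCompact_graph (h : IsCompact {p : V × W | p.1 ∈ S ∧ p.2 = φ p.1}) :
    ContinuousOn φ S := by
  rw [continuousOn_iff_isClosed]
  intro C hC
  refine ⟨Prod.fst '' ({p : V × W | p.1 ∈ S ∧ p.2 = φ p.1} ∩ Prod.snd ⁻¹' C), ?_, ?_⟩
  · exact ((h.inter_right (hC.preimage continuous_snd)).image continuous_fst).isClosed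
  · ext x
    constructor
    · rintro ⟨h1, h2⟩
      exact ⟨⟨(x, φ x), ⟨⟨h2, rfl⟩, h1⟩, rfl⟩, h2⟩
    · rintro ⟨⟨p, ⟨⟨h1, h2⟩, h3⟩, rfl⟩, h4⟩
      exact ⟨by simpa [← h2] using h3, h4⟩

theorem PLOn.leftInv {ψ : W → V} (h : PLOn φ S) (hS : IsCompact S) (hψ : LeftInvOn ψ φ S) :
    PLOn ψ (φ '' S) := by
  refine ⟨continuousOn_of_isCompact_graph ?_, h.2.leftInv hψ⟩
  convert hS.image_of_continuousOn (h.1.prodMk continuousOn_id) using 1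
  ext ⟨y, x⟩
  constructor
  · rintro ⟨⟨x', hx, rfl⟩, h2⟩
    obtain rfl : x = x' := h2.trans (hψ hx)
    exact ⟨x, hx, rfl⟩
  · rintro ⟨x', hx, h2⟩
    obtain ⟨rfl, rfl⟩ := Prod.mk.inj h2
    exact ⟨⟨x', hx, rfl⟩, (hψ hx).symm⟩

theorem PLOn.image (h : PLOn φ S) : SL (φ '' S) := h.2.image

end PLOn

section PairIso

variable {V W X : Type*} [NormedAddCommGroup V] [NormedSpace ℝ V] [FiniteDimensional ℝ V]
  [NormedAddCommGroup W] [NormedSpace ℝ W] [FiniteDimensional ℝ W]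
  [NormedAddCommGroup X] [NormedSpace ℝ X] [FiniteDimensional ℝ X]

/-- `h` is a PL homeomorphism of compact semilinear pairs `(A, A₀)` and `(B, B₀)`. -/
structure IsPairIso (h : V → W) (A A₀ : Set V) (B B₀ : Set W) : Prop where
  compact : IsCompact A
  pl : PLOn h A
  bij : BijOn h A B
  pair : ∀ x ∈ A, h x ∈ B₀ ↔ x ∈ A₀

/-- PL homeomorphic pairs. -/
def PairIso (A A₀ : Set V) (B B₀ : Set W) : Prop := ∃ h, IsPairIso h A A₀ B B₀

theorem PairIso.refl {A : Set V} (A₀ : Set V) (hA : IsCompact A) (h : SL A) : PairIso A A₀ A A₀ :=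
  ⟨id, hA, IsAff.plOn isAff_id h, bijOn_id A, fun _ _ => Iff.rfl⟩

theorem IsPairIso.symm {h : V → W} {A A₀ : Set V} {B B₀ : Set W} (H : IsPairIso h A A₀ B B₀) :
    IsPairIso (Function.invFunOn h A) B B₀ A A₀ := by
  have hl : LeftInvOn (Function.invFunOn h A) h A := H.bij.injOn.leftInvOn_invFunOn
  have hi := H.bij.invOn_invFunOn
  refine ⟨?_, ?_, ?_, ?_⟩
  · rw [← H.bij.image_eq]; exact H.compact.image_of_continuousOn H.pl.1
  · rw [← H.bij.image_eq]; exact H.pl.leftInv H.compact hl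
  · exact hi.symm.bijOn H.bij.surjOn.mapsTo_invFunOn H.bij.mapsTo
  · intro y hy
    have := H.pair _ (H.bij.surjOn.mapsTo_invFunOn hy)
    rw [hi.2 hy] at this
    exact this.symm

theorem PairIso.symm {A A₀ : Set V} {B B₀ : Set W} (H : PairIso A A₀ B B₀) : PairIso B B₀ A A₀ :=
  let ⟨_, h⟩ := H
  ⟨_, h.symm⟩

theorem IsPairIso.trans {h : V → W} {k : W → X} {A A₀ : Set V} {B B₀ : Set W} {C C₀ : Set X}
    (H : IsPairIso h A A₀ B B₀) (H' : IsPairIso k B B₀ C C₀) :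
    IsPairIso (fun x => k (h x)) A A₀ C C₀ :=
  ⟨H.compact, H'.pl.comp H.pl H.bij.mapsTo, H'.bij.comp H.bij, fun x hx =>
    (H'.pair _ (H.bij.mapsTo hx)).trans (H.pair x hx)⟩

theorem PairIso.trans {A A₀ : Set V} {B B₀ : Set W} {C C₀ : Set X}
    (H : PairIso A A₀ B B₀) (H' : PairIso B B₀ C C₀) : PairIso A A₀ C C₀ :=
  let ⟨_, h⟩ := H
  let ⟨_, h'⟩ := H'
  ⟨_, h.trans h'⟩

end PairIso

section Transfer

variable {E F : Type} [NormedAddCommGroup E] [NormedSpace ℝ E]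
  [NormedAddCommGroup F] [NormedSpace ℝ F]
  {V W : Type} [NormedAddCommGroup V] [NormedSpace ℝ V] [FiniteDimensional ℝ V]
  [NormedAddCommGroup W] [NormedSpace ℝ W] [FiniteDimensional ℝ W]

theorem SL.stdSimplex {ι : Type} [Fintype ι] : SL (stdSimplex ℝ ι) :=
  (SL.forall fun i => SL.le (isAff_const 0) (isAff_apply i)).and
    (SL.eq_real (IsAff.sum _ fun i _ => isAff_apply i) (isAff_const 1))

theorem mem_convexHull_iff_stdSimplex {s : Finset E} {x : E} :
    x ∈ convexHull ℝ (s : Set E) ↔ ∃ w ∈ stdSimplex ℝ s, ∑ y : s, w y • (y : E) = x := by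
  classical
  rw [Finset.mem_convexHull']
  constructor
  · rintro ⟨w, h0, h1, rfl⟩
    refine ⟨fun y => w y, ⟨fun y => h0 y y.2, ?_⟩, ?_⟩
    · rw [← h1, Finset.sum_coe_sort s w]
    · rw [Finset.sum_coe_sort s fun y => w y • y]
  · rintro ⟨w, ⟨h0, h1⟩, rfl⟩
    refine ⟨fun y => if h : y ∈ s then w ⟨y, h⟩ else 0, fun y hy => by simpa [hy] using h0 _, ?_, ?_⟩
    · rw [← h1, ← Finset.sum_coe_sort]
      exact Finset.sum_congr rfl fun y _ => by simp
    · rw [← Finset.sum_coe_sort]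
      exact Finset.sum_congr rfl fun y _ => by simp

theorem _root_.AffineOnSimplex.map_sum {φ : E → F} {s : Finset E} (h : AffineOnSimplex φ s)
    {w : s → ℝ} (hw : w ∈ stdSimplex ℝ s) :
    φ (∑ y : s, w y • (y : E)) = ∑ y : s, w y • φ y := by
  classical
  have := h (fun y => if h : y ∈ s then w ⟨y, h⟩ else 0) (fun y hy => by simpa [hy] using hw.1 _)
    (by rw [← hw.2, ← Finset.sum_coe_sort]; exact Finset.sum_congr rfl fun y _ => by simp)
  rw [← Finset.sum_coe_sort s, ← Finset.sum_coe_sort s] at this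
  simpa only [Finset.coe_mem, dite_true, Subtype.coe_eta] using this

/-- Linear images of graphs of PL maps are compact and semilinear. -/
theorem _root_.IsPLMapOn.sl_image {φ : E → F} {S : Set E} (h : IsPLMapOn φ S) (α : E →ₗ[ℝ] V)
    (β : F →ₗ[ℝ] W) :
    SL ((fun x => (α x, β (φ x))) '' S) ∧ IsCompact ((fun x => (α x, β (φ x))) '' S) := by
  obtain ⟨K, hfin, rfl, haff⟩ := h
  have key : ∀ s ∈ K.faces, (fun x => (α x, β (φ x))) '' (convexHull ℝ (s : Set E)) =
      (fun w : s → ℝ => ∑ y : s, w y • (α y, β (φ y))) '' stdSimplex ℝ s := by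
    intro s hs
    have : ∀ w ∈ stdSimplex ℝ s, ∑ y : s, w y • (α y, β (φ y)) =
        (α (∑ y : s, w y • (y : E)), β (φ (∑ y : s, w y • (y : E)))) := by
      intro w hw
      rw [(haff s hs).map_sum hw]
      simp [Prod.ext_iff, Prod.fst_sum, Prod.snd_sum]
    ext p
    constructor
    · rintro ⟨x, hx, rfl⟩
      obtain ⟨w, hw, rfl⟩ := mem_convexHull_iff_stdSimplex.1 hx
      exact ⟨w, hw, this w hw⟩
    · rintro ⟨w, hw, rfl⟩
      exact ⟨_, mem_convexHull_iff_stdSimplex.2 ⟨w, hw, rfl⟩, (this w hw).symm⟩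
  have haf : ∀ s : Finset E, IsAff (fun w : s → ℝ => ∑ y : s, w y • (α y, β (φ y))) := fun s =>
    IsAff.sum _ fun i _ => (isAff_apply i).smul_const _
  have hU : (fun x => (α x, β (φ x))) '' K.space =
      ⋃ s ∈ K.faces, (fun x => (α x, β (φ x))) '' (convexHull ℝ (s : Set E)) := by
    rw [SimplicialComplex.space, image_iUnion₂]
  rw [hU]
  refine ⟨SL.biUnion hfin fun s hs => ?_, hfin.isCompact_biUnion fun s hs => ?_⟩
  · rw [key s hs]
    exact SL.stdSimplex.image (haf s)
  · rw [key s hs]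
    exact (isCompact_stdSimplex ℝ s).image (haf s).continuous

/-- Maps whose graph is an injective linear image of a compact semilinear set are PL. -/
theorem isPLMapOn_of_sl {Γ : Set V} (hΓ : SL Γ) (hc : IsCompact Γ) (p : V →ₗ[ℝ] E) (q : V →ₗ[ℝ] F)
    (hp : InjOn p Γ) {φ : E → F} (hφ : ∀ z ∈ Γ, φ (p z) = q z) : IsPLMapOn φ (p '' Γ) := by
  classical
  obtain ⟨T, hT, rfl⟩ := hΓ.exists_isTri hc
  obtain ⟨hT', hsp⟩ := hT.image p hp
  refine ⟨hT'.complex, hT'.finite, hT'.complex_space.trans hsp, ?_⟩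
  rintro _ ⟨s, hs, rfl⟩ w h0 h1
  have hsub := hT.convexHull_subset hs
  have hinj : InjOn p s := hp.mono ((subset_convexHull ℝ _).trans hsub)
  have h0' : ∀ z ∈ s, 0 ≤ w (p z) := fun z hz => h0 _ (Finset.mem_image_of_mem _ hz)
  rw [Finset.sum_image hinj] at h1 ⊢
  rw [Finset.sum_image hinj]
  have hz : ∑ z ∈ s, w (p z) • z ∈ triSpace T :=
    hsub (Finset.mem_convexHull'.2 ⟨fun z => w (p z), h0', h1, rfl⟩)
  have hpz : ∑ z ∈ s, w (p z) • p z = p (∑ z ∈ s, w (p z) • z) := by simp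
  rw [hpz, hφ _ hz, map_sum]
  refine Finset.sum_congr rfl fun z hzs => ?_
  rw [map_smul, hφ z (hsub (subset_convexHull ℝ _ hzs))]

theorem _root_.AffineOnSimplex.exists_lipschitz {φ : E → F} {s : Finset E}
    (h : AffineOnSimplex φ s) (hs : AffineIndependent ℝ ((↑) : s → E)) :
    ∃ L : ℝ, 0 ≤ L ∧ ∀ x ∈ convexHull ℝ (s : Set E), ∀ y ∈ convexHull ℝ (s : Set E),
      ‖φ x - φ y‖ ≤ L * ‖x - y‖ := by
  let B : (s → ℝ) →ₗ[ℝ] E × ℝ :=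
    ∑ y : s, (LinearMap.proj y : (s → ℝ) →ₗ[ℝ] ℝ).smulRight ((y : E), (1 : ℝ))
  have hB : ∀ w, B w = (∑ y : s, w y • (y : E), ∑ y : s, w y) := fun w => by
    simp [B, Prod.ext_iff, Prod.fst_sum, Prod.snd_sum]
  let D : (s → ℝ) →ₗ[ℝ] F := ∑ y : s, (LinearMap.proj y : (s → ℝ) →ₗ[ℝ] ℝ).smulRight (φ y)
  have hD : ∀ w, D w = ∑ y : s, w y • φ y := fun w => by simp [D]
  have hker : LinearMap.ker B = ⊥ := by
    rw [LinearMap.ker_eq_bot']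
    intro w hw
    rw [hB, Prod.mk_eq_zero] at hw
    funext y
    exact affineIndependent_iff.1 hs Finset.univ w hw.2 hw.1 y (Finset.mem_univ y)
  obtain ⟨C, -, hC⟩ := B.exists_antilipschitzWith hker
  let D' := LinearMap.toContinuousLinearMap D
  refine ⟨‖D'‖ * C, by positivity, fun x hx y hy => ?_⟩
  obtain ⟨w, hw, rfl⟩ := mem_convexHull_iff_stdSimplex.1 hx
  obtain ⟨v, hv, rfl⟩ := mem_convexHull_iff_stdSimplex.1 hy
  rw [h.map_sum hw, h.map_sum hv, ← hD, ← hD, ← map_sub]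
  have h1 : ‖D (w - v)‖ ≤ ‖D'‖ * ‖w - v‖ := D'.le_opNorm _
  have h2 := hC.le_mul_dist w v
  rw [dist_eq_norm, dist_eq_norm, hB, hB, Prod.mk_sub_mk, hw.2, hv.2, sub_self, Prod.norm_mk,
    norm_zero, max_eq_left (norm_nonneg _)] at h2
  calc _ ≤ _ := h1
    _ ≤ ‖D'‖ * (C * _) := by gcongr
    _ = _ := by ring

/-- PL maps on convex polyhedra are Lipschitz. -/
theorem _root_.IsPLMapOn.exists_lipschitz {φ : V → F} {S : Set V} (h : IsPLMapOn φ S)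
    (β : F →ₗ[ℝ] W) (hS : Convex ℝ S) :
    ∃ L : ℝ, 0 ≤ L ∧ ∀ x ∈ S, ∀ y ∈ S, ‖β (φ x) - β (φ y)‖ ≤ L * ‖x - y‖ := by
  have hcont : ContinuousOn (fun x => β (φ x)) S := by
    have := (h.sl_image LinearMap.id β).2
    refine continuousOn_of_isCompact_graph ?_
    convert this using 1
    ext ⟨x, y⟩
    simp [Prod.ext_iff, eq_comm]
  obtain ⟨K, hfin, rfl, haff⟩ := h
  have hβ : ∀ s ∈ K.faces, AffineOnSimplex (fun x => β (φ x)) s := by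
    intro s hs w h0 h1
    simp only [haff s hs w h0 h1, map_sum, map_smul]
  choose! L hL0 hL using fun s (hs : s ∈ K.faces) => (hβ s hs).exists_lipschitz (K.indep hs)
  let M : ℝ := ∑ s ∈ hfin.toFinset, L s
  have hM : ∀ s ∈ K.faces, L s ≤ M := fun s hs =>
    Finset.single_le_sum (f := L) (fun t ht => hL0 t (by simpa using ht)) (by simpa using hs)
  have hM0 : 0 ≤ M := Finset.sum_nonneg fun t ht => hL0 t (by simpa using ht)
  refine ⟨M, hM0, fun x hx y hy => ?_⟩
  let γ : ℝ → V := fun t => x + t • (y - x)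
  have hγc : Continuous γ := by fun_prop
  have hγS : ∀ t ∈ Icc (0 : ℝ) 1, γ t ∈ K.space := fun t ht => by
    have := hS.add_smul_sub_mem hx hy ht
    exact this
  have hclosed : IsClosed ({t | ‖β (φ (γ t)) - β (φ x)‖ ≤ M * (t * ‖y - x‖)} ∩ Icc (0 : ℝ) 1) := by
    have hg : ContinuousOn (fun t => ‖β (φ (γ t)) - β (φ x)‖ - M * (t * ‖y - x‖)) (Icc 0 1) :=
      (((hcont.comp hγc.continuousOn hγS).sub continuousOn_const).norm).sub (by fun_prop)
    have := hg.preimage_isClosed_of_isClosed isClosed_Icc (isClosed_Iic (a := (0 : ℝ)))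
    convert this using 1
    ext t
    simp [and_comm]
  have hsub := hclosed.Icc_subset_of_forall_exists_gt (by simp [γ]) (by
    rintro t ⟨ht, ht0, ht1⟩ b hb
    have hev : ∀ᶠ r in nhdsWithin t (Ioi t), ∃ s ∈ K.faces, γ r ∈ convexHull ℝ (s : Set V) := by
      filter_upwards [Ioo_mem_nhdsGT ht1] with r hr
      have := hγS r ⟨ht0.trans hr.1.le, hr.2.le⟩
      simpa [SimplicialComplex.space] using this
    have hfr : ∃ s ∈ K.faces, ∃ᶠ r in nhdsWithin t (Ioi t), γ r ∈ convexHull ℝ (s : Set V) := by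
      by_contra hcon
      push Not at hcon
      have := (hfin.eventually_all).2 hcon
      obtain ⟨r, ⟨s, hs, hr⟩, hr'⟩ := (hev.and this).exists
      exact hr' s hs hr
    obtain ⟨s, hs, hfr⟩ := hfr
    have hcl : IsClosed (γ ⁻¹' convexHull ℝ (s : Set V)) :=
      (s.finite_toSet.isCompact_convexHull ℝ).isClosed.preimage hγc
    have hts : γ t ∈ convexHull ℝ (s : Set V) :=
      hcl.closure_subset (mem_closure_iff_frequently.2 (hfr.filter_mono nhdsWithin_le_nhds))
    have hnear : ∀ᶠ r in nhdsWithin t (Ioi t), r ∈ Ioc t b := Ioc_mem_nhdsGT hb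
    obtain ⟨r, hrs, hr⟩ := (hfr.and_eventually hnear).exists
    refine ⟨r, ?_, hr⟩
    have h1 := hL s hs _ hrs _ hts
    have h2 : γ r - γ t = (r - t) • (y - x) := by simp only [γ]; module
    rw [h2, norm_smul, Real.norm_of_nonneg (sub_nonneg.2 hr.1.le)] at h1
    have h3 : L s * ((r - t) * ‖y - x‖) ≤ M * ((r - t) * ‖y - x‖) :=
      mul_le_mul_of_nonneg_right (hM s hs)
        (mul_nonneg (sub_nonneg.2 hr.1.le) (norm_nonneg _))
    have h4 := norm_sub_le_norm_sub_add_norm_sub (β (φ (γ r))) (β (φ (γ t))) (β (φ x))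
    have ht' : ‖β (φ (γ t)) - β (φ x)‖ ≤ M * (t * ‖y - x‖) := ht
    show ‖β (φ (γ r)) - β (φ x)‖ ≤ M * (r * ‖y - x‖)
    nlinarith)
  have h1 : ‖β (φ (γ 1)) - β (φ x)‖ ≤ M * (1 * ‖y - x‖) := hsub ⟨zero_le_one, le_rfl⟩
  have h2 : γ 1 = y := by simp [γ]
  rw [h2, one_mul] at h1
  rwa [norm_sub_rev, norm_sub_rev x]

end Transfer

section Push

variable {V X : Type} [NormedAddCommGroup V] [NormedSpace ℝ V] [FiniteDimensional ℝ V]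
  [NormedAddCommGroup X] [NormedSpace ℝ X] [FiniteDimensional ℝ X]

/-- `Θ` parametrizes a neighbourhood of `x` in `M` by a product `W × [-ε, ε]` on which `f` is,
up to a constant, the second coordinate. -/
structure IsBox (M : Set V) (f : V → ℝ) (x : V) (W : Set X) (ε L : ℝ) (Θ : X × ℝ → V) : Prop where
  compact : IsCompact W
  pos : 0 < ε
  pl : PLOn Θ (W ×ˢ Icc (-ε) ε)
  inj : InjOn Θ (W ×ˢ Icc (-ε) ε)
  maps : MapsTo Θ (W ×ˢ Icc (-ε) ε) M
  val : ∀ w ∈ W, ∀ r ∈ Icc (-ε) ε, f (Θ (w, r)) = f x + r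
  L_nonneg : 0 ≤ L
  lip : ∀ w ∈ W, ∀ r ∈ Icc (-ε) ε, ∀ s ∈ Icc (-ε) ε, ‖Θ (w, r) - Θ (w, s)‖ ≤ L * |r - s|
  nhds : Θ '' (W ×ˢ Icc (-ε) ε) ∈ nhdsWithin x M

/-- A PL function with small Lipschitz constant and values near `c`. -/
structure Slow (M : Set V) (c κ : ℝ) (u : V → ℝ) : Prop where
  pl : PLOn u M
  lip : ∀ y ∈ M, ∀ z ∈ M, |u y - u z| ≤ κ * ‖y - z‖
  near : ∀ y ∈ M, |u y - c| ≤ κ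

theorem Slow.mono {M : Set V} {c κ κ' : ℝ} {u : V → ℝ} (h : Slow M c κ u) (hκ : κ ≤ κ') :
    Slow M c κ' u :=
  ⟨h.pl, fun y hy z hz => (h.lip y hy z hz).trans (by gcongr), fun y hy => (h.near y hy).trans hκ⟩

/-- The part of `M` where `f ≤ u`. -/
def sub (M : Set V) (f u : V → ℝ) : Set V := {y | y ∈ M ∧ f y ≤ u y}

/-- The part of `M` where `f = u`. -/
def lev (M : Set V) (f u : V → ℝ) : Set V := {y | y ∈ M ∧ f y = u y}

theorem isClosed_setOf_le {Y : Type*} [TopologicalSpace Y] {S : Set Y} (hS : IsClosed S)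
    {a b : Y → ℝ} (ha : ContinuousOn a S) (hb : ContinuousOn b S) :
    IsClosed {x | x ∈ S ∧ a x ≤ b x} := by
  have := (ha.sub hb).preimage_isClosed_of_isClosed hS (isClosed_Iic (a := (0 : ℝ)))
  convert this using 1
  ext x
  simp

theorem isClosed_setOf_eq {Y : Type*} [TopologicalSpace Y] {S : Set Y} (hS : IsClosed S)
    {a b : Y → ℝ} (ha : ContinuousOn a S) (hb : ContinuousOn b S) :
    IsClosed {x | x ∈ S ∧ a x = b x} := by
  have := (isClosed_setOf_le hS ha hb).inter (isClosed_setOf_le hS hb ha)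
  convert this using 1
  ext x
  simp only [mem_ofPred_eq, mem_inter_iff, le_antisymm_iff]
  tauto

variable {M : Set V} {f : V → ℝ} {x : V} {W : Set X} {ε L κ : ℝ} {Θ : X × ℝ → V}

/-- The graph of a slow function meets every fibre of a box in exactly one point. -/
theorem IsBox.exists_root (H : IsBox M f x W ε L Θ) (hκ0 : 0 < κ) (hκε : κ ≤ ε)
    (hκL : κ * L ≤ 1 / 2) {u : V → ℝ} (hu : Slow M (f x) κ u) :
    ∃ ρ : X → ℝ, PLOn ρ W ∧ ∀ w ∈ W, ρ w ∈ Icc (-κ) κ ∧ ∀ r ∈ Icc (-ε) ε,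
      (f x + r ≤ u (Θ (w, r)) ↔ r ≤ ρ w) ∧ (f x + r = u (Θ (w, r)) ↔ r = ρ w) := by
  have hsub : Icc (-κ) κ ⊆ Icc (-ε) ε := Icc_subset_Icc (by linarith) hκε
  have hslope : ∀ w ∈ W, ∀ r ∈ Icc (-ε) ε, ∀ s ∈ Icc (-ε) ε, r ≤ s →
      u (Θ (w, s)) - u (Θ (w, r)) ≤ (s - r) / 2 := by
    intro w hw r hr s hs hrs
    have h1 := hu.lip _ (H.maps (mk_mem_prod hw hs)) _ (H.maps (mk_mem_prod hw hr))
    have h2 := H.lip w hw s hs r hr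
    rw [abs_of_nonneg (sub_nonneg.2 hrs)] at h2
    have h3 : κ * ‖Θ (w, s) - Θ (w, r)‖ ≤ κ * (L * (s - r)) := by gcongr
    have h4 := (abs_le.1 h1).2
    nlinarith
  have hucont : ContinuousOn (fun p => u (Θ p)) (W ×ˢ Icc (-ε) ε) :=
    hu.pl.cont.comp H.pl.cont H.maps
  have hex : ∀ w ∈ W, ∃ t ∈ Icc (-κ) κ, f x + t = u (Θ (w, t)) := by
    intro w hw
    have hc : ContinuousOn (fun r => f x + r - u (Θ (w, r))) (Icc (-κ) κ) := by
      refine (continuousOn_const.add continuousOn_id).sub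
        (hucont.comp (f := fun r => (w, r)) (by fun_prop) fun r hr => mk_mem_prod hw (hsub hr))
    have hn : ∀ r ∈ Icc (-κ) κ, |u (Θ (w, r)) - f x| ≤ κ := fun r hr =>
      hu.near _ (H.maps (mk_mem_prod hw (hsub hr)))
    have h1 := abs_le.1 (hn (-κ) ⟨le_rfl, by linarith⟩)
    have h2 := abs_le.1 (hn κ ⟨by linarith, le_rfl⟩)
    obtain ⟨t, ht, h0⟩ := intermediate_value_Icc (by linarith) hc
      (show (0 : ℝ) ∈ Icc _ _ from ⟨by linarith, by linarith⟩)
    exact ⟨t, ht, by simp only at h0; linarith⟩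
  choose! ρ hρ hroot using hex
  have hiff : ∀ w ∈ W, ∀ r ∈ Icc (-ε) ε,
      (f x + r ≤ u (Θ (w, r)) ↔ r ≤ ρ w) ∧ (f x + r = u (Θ (w, r)) ↔ r = ρ w) := by
    intro w hw r hr
    have h0 := hroot w hw
    have hρ' := hsub (hρ w hw)
    rcases lt_trichotomy r (ρ w) with h | h | h
    · have := hslope w hw r hr _ hρ' h.le
      exact ⟨iff_of_true (by linarith) h.le, iff_of_false (by intro; linarith) h.ne⟩
    · subst h
      exact ⟨iff_of_true h0.le le_rfl, iff_of_true h0 rfl⟩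
    · have := hslope w hw _ hρ' r hr h.le
      exact ⟨iff_of_false (by intro; linarith) h.not_ge, iff_of_false (by intro; linarith) h.ne'⟩
  have hgraph : {p : X × ℝ | p.1 ∈ W ∧ p.2 = ρ p.1} =
      {p | p ∈ W ×ˢ Icc (-ε) ε ∧ f x + p.2 = u (Θ p)} := by
    ext ⟨w, r⟩
    constructor
    · rintro ⟨hw, hr⟩
      replace hr : r = ρ w := hr
      have hm := hsub (hρ w hw)
      rw [← hr] at hm
      exact ⟨mk_mem_prod hw hm, (hiff w hw r hm).2.2 hr⟩
    · rintro ⟨hm, he⟩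
      exact ⟨hm.1, (hiff w hm.1 r hm.2).2.1 he⟩
  refine ⟨ρ, ⟨continuousOn_of_isCompact_graph ?_, ?_⟩, fun w hw => ⟨hρ w hw, hiff w hw⟩⟩
  · rw [hgraph]
    have hQ : IsCompact (W ×ˢ Icc (-ε) ε) := H.compact.prod isCompact_Icc
    exact hQ.of_isClosed_subset (isClosed_setOf_eq hQ.isClosed (by fun_prop) hucont) fun p hp => hp.1
  · unfold SLOn
    rw [hgraph]
    have hQ := H.pl.dom
    exact SLOn.eq (IsAff.slOn (by fun_prop) hQ) (hu.pl.sl.comp H.pl.sl H.maps)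

/-- Near a point with a box, slow functions can be increased without changing the PL type of
the region below them. -/
theorem IsBox.push (H : IsBox M f x W ε L Θ) (hM : IsCompact M) (hf : PLOn f M) (hx : x ∈ M) :
    ∃ O : Set V, IsOpen O ∧ x ∈ O ∧ ∃ κ > 0, ∀ u u' : V → ℝ, Slow M (f x) κ u →
      Slow M (f x) κ u' → (∀ y ∈ M, u y ≤ u' y) → (∀ y ∈ M, y ∉ O → u y = u' y) →
      PairIso (sub M f u) (lev M f u) (sub M f u') (lev M f u') := by
  classical
  set Q := W ×ˢ Icc (-ε) ε with hQdef
  have hQ : IsCompact Q := H.compact.prod isCompact_Icc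
  have hB : IsCompact (Θ '' Q) := hQ.image_of_continuousOn H.pl.cont
  obtain ⟨U, hUo, hxU, hUM⟩ := mem_nhdsWithin.1 H.nhds
  obtain ⟨⟨w₀, r₀⟩, hw₀, hx₀⟩ := hUM ⟨hxU, hx⟩
  obtain rfl : r₀ = 0 := by
    have := H.val w₀ hw₀.1 r₀ hw₀.2
    rw [hx₀] at this
    linarith
  obtain ⟨η, hη, hηU⟩ : ∃ η > 0, ∀ w r, (w, r) ∈ Q → dist w w₀ < η → |r| < η → Θ (w, r) ∈ U := by
    have := H.pl.cont (w₀, 0) hw₀ (by rw [hx₀]; exact hUo.mem_nhds hxU)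
    obtain ⟨η, hη, h⟩ := Metric.mem_nhdsWithin_iff.1 this
    refine ⟨η, hη, fun w r hwr h1 h2 => h ⟨?_, hwr⟩⟩
    rw [Metric.mem_ball, Prod.dist_eq]
    exact max_lt h1 (by simpa using h2)
  let B₁ := Θ '' {p | p ∈ Q ∧ η ≤ dist p.1 w₀}
  have hB₁ : IsClosed B₁ := by
    refine (IsCompact.image_of_continuousOn (hQ.of_isClosed_subset
      (isClosed_setOf_le hQ.isClosed (by fun_prop) (by fun_prop)) fun p hp => hp.1)
      (H.pl.cont.mono fun p hp => hp.1)).isClosed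
  refine ⟨U \ B₁, hUo.sdiff hB₁, ⟨hxU, ?_⟩, min (min (ε / 8) (η / 8)) (1 / (2 * (L + 1))), ?_, ?_⟩
  · rintro ⟨p, ⟨hpQ, hp⟩, hpx⟩
    have := H.inj hpQ hw₀ (hpx.trans hx₀.symm)
    rw [this, dist_self] at hp
    linarith
  · have := H.L_nonneg
    have := H.pos
    positivity
  set κ := min (min (ε / 8) (η / 8)) (1 / (2 * (L + 1))) with hκ
  have hL := H.L_nonneg
  have hε := H.pos
  have hκ0 : 0 < κ := by positivity
  have hκε : κ ≤ ε / 8 := (min_le_left _ _).trans (min_le_left _ _)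
  have hκη : κ ≤ η / 8 := (min_le_left _ _).trans (min_le_right _ _)
  have hκL : κ * L ≤ 1 / 2 := by
    have h1 : κ ≤ 1 / (2 * (L + 1)) := min_le_right _ _
    rw [le_div_iff₀ (by positivity)] at h1
    nlinarith
  intro u u' hu hu' hle hO
  obtain ⟨ρ, hρ, hρw⟩ := H.exists_root hκ0 (by linarith) hκL hu
  obtain ⟨ρ', hρ', hρw'⟩ := H.exists_root hκ0 (by linarith) hκL hu'
  have hmem : ∀ w ∈ W, ∀ r, -ε ≤ r → r ≤ ε → (w, r) ∈ Q := fun w hw r h1 h2 => ⟨hw, h1, h2⟩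
  have hρle : ∀ w ∈ W, ρ w ≤ ρ' w := by
    intro w hw
    have hr : ρ w ∈ Icc (-ε) ε := ⟨by linarith [(hρw w hw).1.1], by linarith [(hρw w hw).1.2]⟩
    exact ((hρw' w hw).2 _ hr).1.1 ((((hρw w hw).2 _ hr).1.2 le_rfl).trans
      (hle _ (H.maps ⟨hw, hr⟩)))
  have hρeq : ∀ w ∈ W, η ≤ dist w w₀ → ρ w = ρ' w := by
    intro w hw hd
    have hr : ρ w ∈ Icc (-ε) ε := ⟨by linarith [(hρw w hw).1.1], by linarith [(hρw w hw).1.2]⟩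
    refine ((hρw' w hw).2 _ hr).2.1 ((((hρw w hw).2 _ hr).2.2 rfl).trans
      (hO _ (H.maps ⟨hw, hr⟩) fun h => h.2 ⟨(w, ρ w), ⟨⟨hw, hr⟩, hd⟩, rfl⟩))
  have hoff : ∀ y ∈ M, y ∉ Θ '' Q → u y = u' y := fun y hy hyB =>
    hO y hy fun h => hyB (hUM ⟨h.1, hy⟩)
  let Ψ := Function.invFunOn Θ Q
  have hΨ : LeftInvOn Ψ Θ Q := H.inj.leftInvOn_invFunOn
  have hΨpl : PLOn Ψ (Θ '' Q) := H.pl.leftInv hQ hΨ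
  have hΨm : MapsTo Ψ (Θ '' Q) Q := by rintro _ ⟨p, hp, rfl⟩; rwa [hΨ hp]
  have hBM : Θ '' Q ⊆ M := image_subset_iff.2 H.maps
  let g : X × ℝ → X × ℝ := fun p => (p.1, max p.2 (ρ' p.1 + (2 : ℝ) • (p.2 - ρ p.1)))
  let g' : X × ℝ → X × ℝ := fun p => (p.1, min p.2 (ρ p.1 + (p.2 - ρ' p.1) / 2))
  have hg : ∀ p ∈ Q, p.2 ≤ ρ p.1 → g p ∈ Q ∧ (g p).2 ≤ ρ' p.1 ∧ g' (g p) = p ∧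
      ((g p).2 = ρ' p.1 ↔ p.2 = ρ p.1) := by
    rintro ⟨w, r⟩ ⟨hw, hr0, hr1⟩ hr
    have h1 := hρle w hw
    have h2 := (hρw' w hw).1.2
    have h3 := (hρw w hw).1.1
    simp only [g, g', Prod.mk.injEq, true_and, smul_eq_mul] at *
    refine ⟨hmem w hw _ (hr0.trans (le_max_left _ _)) (max_le hr1 (by linarith)),
      max_le (by linarith) (by linarith), ?_, ?_⟩
    · rcases le_total r (ρ' w + 2 * (r - ρ w)) with h | h
      · rw [max_eq_right h, min_eq_right (by linarith)]; ring
      · rw [max_eq_left h, min_eq_left (by linarith)]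
    · constructor
      · intro h
        rcases max_choice r (ρ' w + 2 * (r - ρ w)) with h' | h' <;> rw [h'] at h <;> linarith
      · rintro rfl
        rw [max_eq_right (by linarith)]; ring
  have hg' : ∀ p ∈ Q, p.2 ≤ ρ' p.1 → g' p ∈ Q ∧ (g' p).2 ≤ ρ p.1 ∧ g (g' p) = p := by
    rintro ⟨w, r⟩ ⟨hw, hr0, hr1⟩ hr
    have h1 := hρle w hw
    have h2 := (hρw' w hw).1.2
    have h3 := (hρw w hw).1.1
    simp only [g, g', Prod.mk.injEq, true_and, smul_eq_mul] at *
    refine ⟨hmem w hw _ (le_min hr0 (by linarith)) ((min_le_left _ _).trans hr1),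
      (min_le_right _ _).trans (by linarith), ?_⟩
    rcases le_total r (ρ w + (r - ρ' w) / 2) with h | h
    · rw [min_eq_left h, max_eq_left (by linarith)]
    · rw [min_eq_right h, max_eq_right (by linarith)]; ring
  let h : V → V := fun y => if y ∈ Θ '' Q then Θ (g (Ψ y)) else y
  let h' : V → V := fun y => if y ∈ Θ '' Q then Θ (g' (Ψ y)) else y
  have hval : ∀ p ∈ Q, (f (Θ p) ≤ u (Θ p) ↔ p.2 ≤ ρ p.1) ∧ (f (Θ p) = u (Θ p) ↔ p.2 = ρ p.1) := by
    rintro ⟨w, r⟩ ⟨hw, hr⟩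
    rw [H.val w hw r hr]
    exact (hρw w hw).2 r hr
  have hval' : ∀ p ∈ Q,
      (f (Θ p) ≤ u' (Θ p) ↔ p.2 ≤ ρ' p.1) ∧ (f (Θ p) = u' (Θ p) ↔ p.2 = ρ' p.1) := by
    rintro ⟨w, r⟩ ⟨hw, hr⟩
    rw [H.val w hw r hr]
    exact (hρw' w hw).2 r hr
  have hhΘ : ∀ p ∈ Q, h (Θ p) = Θ (g p) := fun p hp => by
    simp only [h, if_pos (mem_image_of_mem Θ hp), hΨ hp]
  have hhΘ' : ∀ p ∈ Q, h' (Θ p) = Θ (g' p) := fun p hp => by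
    simp only [h', if_pos (mem_image_of_mem Θ hp), hΨ hp]
  have hhoff : ∀ y, y ∉ Θ '' Q → h y = y := fun y hy => if_neg hy
  have hhoff' : ∀ y, y ∉ Θ '' Q → h' y = y := fun y hy => if_neg hy
  have hid : ∀ y ∈ sub M f u, y ∉ U → h y = y := by
    intro y hy hyU
    by_cases hyB : y ∈ Θ '' Q
    · obtain ⟨⟨w, r⟩, hp, rfl⟩ := hyB
      have hr : r ≤ ρ w := ((hval _ hp).1).1 hy.2
      rw [hhΘ _ hp]
      congr 1
      simp only [g, Prod.mk.injEq, true_and, smul_eq_mul]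
      refine max_eq_left ?_
      by_contra! hcon
      have h2 := (hρw' w hp.1).1.2
      have h3 := (hρw w hp.1).1
      have hd : η ≤ dist w w₀ := by
        by_contra! hd
        exact hyU (hηU w r hp hd (abs_lt.2 ⟨by linarith [h3.1], by linarith [h3.2]⟩))
      rw [← hρeq w hp.1 hd] at hcon
      linarith
    · exact hhoff y hyB
  have hsubpl : SL (sub M f u) := hf.sl.le hu.pl.sl
  have hsubcl : IsClosed (sub M f u) := isClosed_setOf_le hM.isClosed hf.cont hu.pl.cont
  have hgpl : PLOn g Q := by
    have h1 : PLOn (fun p : X × ℝ => p.1) Q := IsAff.plOn (by fun_prop) H.pl.dom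
    have h2 : PLOn (fun p : X × ℝ => p.2) Q := IsAff.plOn (by fun_prop) H.pl.dom
    have h3 := hρ.comp h1 fun p hp => hp.1
    have h4 := hρ'.comp h1 fun p hp => hp.1
    exact h1.prodMk (h2.max (h4.add ((h2.sub h3).const_smul 2)))
  have hBdom : SL (Θ '' Q) := H.pl.image
  have hplB : PLOn h (sub M f u ∩ Θ '' Q) := by
    have hS : SL (sub M f u ∩ Θ '' Q) := hsubpl.inter hBdom
    have h1 : PLOn Ψ (sub M f u ∩ Θ '' Q) := hΨpl.mono hS inter_subset_right
    have h2 : PLOn (fun y => g (Ψ y)) (sub M f u ∩ Θ '' Q) :=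
      hgpl.comp h1 fun y hy => hΨm hy.2
    refine (H.pl.comp h2 ?_).congr fun y hy => if_pos hy.2
    rintro _ ⟨hy, p, hp, rfl⟩
    show g (Ψ (Θ p)) ∈ Q
    rw [hΨ hp]
    exact (hg p hp (((hval p hp).1).1 hy.2)).1
  have hpl : PLOn h (sub M f u) := by
    constructor
    · have h1 : ContinuousOn h (sub M f u \ U) :=
        continuousOn_id.congr fun y hy => hid y hy.1 hy.2
      refine (hplB.cont.union_of_isClosed h1 (hsubcl.inter hB.isClosed)
        (hsubcl.sdiff hUo)).mono fun y hy => ?_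
      by_cases hyU : y ∈ U
      · exact Or.inl ⟨hy, hUM ⟨hyU, hy.1⟩⟩
      · exact Or.inr ⟨hy, hyU⟩
    · have h1 : SLOn h (sub M f u \ Θ '' Q) :=
        (isAff_id.slOn (hsubpl.diff hBdom)).congr fun y hy => hhoff y hy.2
      have := hplB.sl.union h1
      rwa [inter_union_sdiff] at this
  refine ⟨h, hM.of_isClosed_subset hsubcl fun y hy => hy.1, hpl, ?_, ?_⟩
  · refine InvOn.bijOn (f' := h') ⟨?_, ?_⟩ ?_ ?_
    · intro y hy
      by_cases hyB : y ∈ Θ '' Q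
      · obtain ⟨p, hp, rfl⟩ := hyB
        have := hg p hp (((hval p hp).1).1 hy.2)
        rw [hhΘ p hp, hhΘ' _ this.1, this.2.2.1]
      · rw [hhoff y hyB, hhoff' y hyB]
    · intro y hy
      by_cases hyB : y ∈ Θ '' Q
      · obtain ⟨p, hp, rfl⟩ := hyB
        have := hg' p hp (((hval' p hp).1).1 hy.2)
        rw [hhΘ' p hp, hhΘ _ this.1, this.2.2]
      · rw [hhoff' y hyB, hhoff y hyB]
    · intro y hy
      by_cases hyB : y ∈ Θ '' Q
      · obtain ⟨p, hp, rfl⟩ := hyB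
        have := hg p hp (((hval p hp).1).1 hy.2)
        rw [hhΘ p hp]
        exact ⟨H.maps this.1, ((hval' _ this.1).1).2 this.2.1⟩
      · rw [hhoff y hyB]
        exact ⟨hy.1, (hoff y hy.1 hyB) ▸ hy.2⟩
    · intro y hy
      by_cases hyB : y ∈ Θ '' Q
      · obtain ⟨p, hp, rfl⟩ := hyB
        have := hg' p hp (((hval' p hp).1).1 hy.2)
        rw [hhΘ' p hp]
        exact ⟨H.maps this.1, ((hval _ this.1).1).2 this.2.1⟩
      · rw [hhoff' y hyB]
        exact ⟨hy.1, (hoff y hy.1 hyB).symm ▸ hy.2⟩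
  · intro y hy
    by_cases hyB : y ∈ Θ '' Q
    · obtain ⟨p, hp, rfl⟩ := hyB
      have := hg p hp (((hval p hp).1).1 hy.2)
      rw [hhΘ p hp]
      simp only [lev, mem_ofPred_eq, H.maps this.1, H.maps hp, true_and]
      rw [(hval' _ this.1).2, (hval _ hp).2]
      exact this.2.2.2
    · rw [hhoff y hyB]
      simp only [lev, mem_ofPred_eq, hoff y hy.1 hyB]

end Push

section LocalConstancy

variable {n : ℕ} {M : Set (Fin n → ℝ)} {f : (Fin n → ℝ) → ℝ}

theorem exists_bump (x : Fin n → ℝ) {O : Set (Fin n → ℝ)} (hO : IsOpen O) (hx : x ∈ O) :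
    ∃ (Λ : (Fin n → ℝ) → ℝ) (C : ℝ), 0 ≤ C ∧ PLOn Λ univ ∧ (∀ y, Λ y ∈ Icc (0 : ℝ) 1) ∧
      (∀ y z, |Λ y - Λ z| ≤ C * ‖y - z‖) ∧ (∀ y, y ∉ O → Λ y = 0) ∧
      ∀ᶠ y in nhds x, Λ y = 1 := by
  obtain ⟨R, hR, hRO⟩ := Metric.isOpen_iff.1 hO x hx
  let N : (Fin n → ℝ) → ℝ := fun y => ∑ i, |y i - x i|
  have hN : ∀ y z, |N y - N z| ≤ n * ‖y - z‖ := by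
    intro y z
    rw [← Finset.sum_sub_distrib]
    refine (Finset.abs_sum_le_sum_abs _ _).trans ((Finset.sum_le_card_nsmul _ _ ‖y - z‖ ?_).trans_eq
      (by simp))
    intro i _
    refine (abs_abs_sub_abs_le_abs_sub _ _).trans ?_
    rw [sub_sub_sub_cancel_right]
    exact norm_le_pi_norm (y - z) i
  have hNx : ∀ y, ‖y - x‖ ≤ N y := fun y =>
    (pi_norm_le_iff_of_nonneg (Finset.sum_nonneg fun i _ => abs_nonneg _)).2 fun i =>
      Finset.single_le_sum (f := fun i => |y i - x i|) (fun i _ => abs_nonneg _) (Finset.mem_univ i)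
  have hNpl : PLOn N univ := PLOn.sum _ SL.univ fun i _ =>
    (IsAff.plOn (φ := fun y : Fin n → ℝ => y i - x i) (by fun_prop) SL.univ).abs
  have hNc : Continuous N := continuousOn_univ.1 hNpl.cont
  let Λ : (Fin n → ℝ) → ℝ := fun y => max 0 (min 1 (2 - 2 / R * N y))
  refine ⟨Λ, 2 / R * n, by positivity, ?_, fun y => ?_, fun y z => ?_, fun y hy => ?_, ?_⟩
  · have h1 : PLOn (fun y => 2 - 2 / R * N y) univ :=
      IsAff.comp_plOn (g := fun t : ℝ => 2 - 2 / R * t) (by fun_prop) hNpl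
    exact ((isAff_const 0).plOn SL.univ).max (((isAff_const 1).plOn SL.univ).min h1)
  · exact ⟨le_max_left _ _, max_le zero_le_one (min_le_left _ _)⟩
  · have h1 : |Λ y - Λ z| ≤ |(2 - 2 / R * N y) - (2 - 2 / R * N z)| :=
      (abs_max_sub_max_le_max _ _ _ _).trans (max_le (by simp) ((abs_min_sub_min_le_max _ _ _ _).trans
        (max_le (by simp) le_rfl)))
    have h2 : (2 - 2 / R * N y) - (2 - 2 / R * N z) = -(2 / R * (N y - N z)) := by ring
    rw [h2, abs_neg, abs_mul, abs_of_pos (show 0 < 2 / R by positivity)] at h1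
    refine h1.trans ?_
    rw [mul_assoc]
    gcongr
    exact hN y z
  · have h1 : R ≤ N y := by
      refine le_trans ?_ (hNx y)
      rw [← dist_eq_norm]
      by_contra! h
      exact hy (hRO h)
    have h2 : 2 ≤ 2 / R * N y := by
      rw [div_mul_eq_mul_div, le_div_iff₀ hR]
      linarith
    exact max_eq_left ((min_le_right _ _).trans (by linarith))
  · have h0 : N x = 0 := by simp [N]
    have : ∀ᶠ y in nhds x, N y < R / 2 := hNc.continuousAt.eventually_lt_const (by
      rw [h0]; positivity)
    filter_upwards [this] with y hy
    have : 1 ≤ 2 - 2 / R * N y := by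
      have : 2 / R * N y ≤ 2 / R * (R / 2) := by gcongr
      rw [div_mul_div_cancel₀ hR.ne'] at this
      linarith
    simp [Λ, min_eq_left this]

/-- Slow functions can be increased near `x` without changing the PL type of the region below. -/
def Pushable (M : Set (Fin n → ℝ)) (f : (Fin n → ℝ) → ℝ) (c : ℝ) (x : Fin n → ℝ) : Prop :=
  ∃ O : Set (Fin n → ℝ), IsOpen O ∧ x ∈ O ∧ ∃ κ > 0, ∀ u u' : (Fin n → ℝ) → ℝ, Slow M c κ u →
    Slow M c κ u' → (∀ y ∈ M, u y ≤ u' y) → (∀ y ∈ M, y ∉ O → u y = u' y) →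
      PairIso (sub M f u) (lev M f u) (sub M f u') (lev M f u')

theorem sub_congr {u u' : (Fin n → ℝ) → ℝ} (h : ∀ y ∈ M, u y = u' y) : sub M f u = sub M f u' := by
  ext y
  exact and_congr_right fun hy => by rw [h y hy]

theorem lev_congr {u u' : (Fin n → ℝ) → ℝ} (h : ∀ y ∈ M, u y = u' y) : lev M f u = lev M f u' := by
  ext y
  exact and_congr_right fun hy => by rw [h y hy]

/-- `Λ` is a PL Lipschitz function with values in `[0, 1]` such that truncated multiples of `Λ`
can be used to push slow functions. -/
structure IsPusher (M : Set (Fin n → ℝ)) (f : (Fin n → ℝ) → ℝ) (c κ C : ℝ)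
    (Λ : (Fin n → ℝ) → ℝ) : Prop where
  pos : 0 < κ
  C_nonneg : 0 ≤ C
  pl : PLOn Λ univ
  mem : ∀ y, Λ y ∈ Icc (0 : ℝ) 1
  lip : ∀ y z, |Λ y - Λ z| ≤ C * ‖y - z‖
  push : ∀ s t, s ≤ t → |s - c| ≤ κ → |t - c| ≤ κ → ∀ u, Slow M c κ u →
    (∀ y ∈ M, u y ∈ Icc s t) → PairIso (sub M f u) (lev M f u)
      (sub M f fun y => max (u y) (s + (t - s) * Λ y))
      (lev M f fun y => max (u y) (s + (t - s) * Λ y))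

theorem slow_max {c κ κ' C s t : ℝ} {Λ u : (Fin n → ℝ) → ℝ} (hMsl : SL M) (hΛ : PLOn Λ univ)
    (hmem : ∀ y, Λ y ∈ Icc (0 : ℝ) 1) (hlip : ∀ y z, |Λ y - Λ z| ≤ C * ‖y - z‖)
    (hst : s ≤ t) (hs : |s - c| ≤ κ) (ht : |t - c| ≤ κ) (hu : Slow M c κ u)
    (hut : ∀ y ∈ M, u y ∈ Icc s t) (hκ : κ ≤ κ') (hκC : 2 * κ * C ≤ κ') :
    Slow M c κ' (fun y => max (u y) (s + (t - s) * Λ y)) ∧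
      ∀ y ∈ M, max (u y) (s + (t - s) * Λ y) ∈ Icc s t := by
  have hm : ∀ y ∈ M, max (u y) (s + (t - s) * Λ y) ∈ Icc s t := fun y hy =>
    ⟨le_max_of_le_left (hut y hy).1, max_le (hut y hy).2 (by nlinarith [(hmem y).2])⟩
  refine ⟨⟨?_, fun y hy z hz => ?_, fun y hy => ?_⟩, hm⟩
  · exact hu.pl.max (IsAff.comp_plOn (g := fun r : ℝ => s + (t - s) * r) (by fun_prop)
      (hΛ.mono hMsl (subset_univ _)))
  · refine (abs_max_sub_max_le_max _ _ _ _).trans (max_le ?_ ?_)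
    · exact (hu.lip y hy z hz).trans (by gcongr)
    · have h1 : s + (t - s) * Λ y - (s + (t - s) * Λ z) = (t - s) * (Λ y - Λ z) := by ring
      rw [h1, abs_mul, abs_of_nonneg (sub_nonneg.2 hst)]
      have h2 : t - s ≤ 2 * κ := by linarith [(abs_le.1 hs).1, (abs_le.1 ht).2]
      calc (t - s) * |Λ y - Λ z| ≤ 2 * κ * (C * ‖y - z‖) := by
            gcongr
            · linarith [sub_nonneg.2 hst]
            · exact hlip y z
        _ = 2 * κ * C * ‖y - z‖ := by ring
        _ ≤ κ' * ‖y - z‖ := by gcongr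
  · have h1 := hm y hy
    refine le_trans ?_ hκ
    rw [abs_le] at *
    exact ⟨by linarith [h1.1], by linarith [h1.2]⟩

theorem exists_isPusher {c : ℝ} (hM : IsCompact M) (hf : PLOn f M) {S : Set (Fin n → ℝ)}
    (hS : IsCompact S) (hSp : ∀ x ∈ S, Pushable M f c x) :
    ∃ Λ κ C, IsPusher M f c κ C Λ ∧ ∃ N, IsOpen N ∧ S ⊆ N ∧ ∀ y ∈ N, Λ y = 1 := by
  have hMsl := hf.dom
  refine hS.induction_on (p := fun S => ∃ Λ κ C, IsPusher M f c κ C Λ ∧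
    ∃ N, IsOpen N ∧ S ⊆ N ∧ ∀ y ∈ N, Λ y = 1) ?_ ?_ ?_ ?_
  · refine ⟨fun _ => 0, 1, 0, ⟨one_pos, le_rfl, (isAff_const 0).plOn SL.univ, by simp, by simp, ?_⟩,
      ∅, isOpen_empty, subset_rfl, by simp⟩
    intro s t _ _ _ u hu hut
    have : ∀ y ∈ M, max (u y) (s + (t - s) * 0) = u y := fun y hy => by
      simpa using (hut y hy).1
    rw [sub_congr this, lev_congr this]
    exact PairIso.refl _ (hM.of_isClosed_subset (isClosed_setOf_le hM.isClosed hf.cont hu.pl.cont)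
      fun y hy => hy.1) (hf.sl.le hu.pl.sl)
  · rintro S T hST ⟨Λ, κ, C, h, N, hN, hTN, h1⟩
    exact ⟨Λ, κ, C, h, N, hN, hST.trans hTN, h1⟩
  · rintro S₁ S₂ ⟨Λ₁, κ₁, C₁, h₁, N₁, hN₁, hS₁, hone₁⟩ ⟨Λ₂, κ₂, C₂, h₂, N₂, hN₂, hS₂, hone₂⟩
    have hκ₁ := h₁.pos
    have hκ₂ := h₂.pos
    have hC₁ := h₁.C_nonneg
    set κ := min κ₁ (min κ₂ (κ₂ / (2 * (C₁ + 1)))) with hκdef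
    have hκ : 0 < κ := by positivity
    have hκκ₁ : κ ≤ κ₁ := min_le_left _ _
    have hκκ₂ : κ ≤ κ₂ := (min_le_right _ _).trans (min_le_left _ _)
    have hκC : 2 * κ * C₁ ≤ κ₂ := by
      have h : κ ≤ κ₂ / (2 * (C₁ + 1)) := (min_le_right _ _).trans (min_le_right _ _)
      rw [le_div_iff₀ (by positivity)] at h
      nlinarith
    refine ⟨fun y => max (Λ₁ y) (Λ₂ y), κ, max C₁ C₂,
      ⟨hκ, hC₁.trans (le_max_left _ _), h₁.pl.max h₂.pl, fun y =>
        ⟨le_max_of_le_left (h₁.mem y).1, max_le (h₁.mem y).2 (h₂.mem y).2⟩, fun y z => ?_, ?_⟩,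
      N₁ ∪ N₂, hN₁.union hN₂, union_subset_union hS₁ hS₂, ?_⟩
    · refine (abs_max_sub_max_le_max _ _ _ _).trans (max_le ?_ ?_)
      · exact (h₁.lip y z).trans (by gcongr; exact le_max_left _ _)
      · exact (h₂.lip y z).trans (by gcongr; exact le_max_right _ _)
    · intro s t hst hs ht u hu hut
      have e1 := h₁.push s t hst (hs.trans hκκ₁) (ht.trans hκκ₁) u (hu.mono hκκ₁) hut
      obtain ⟨hu₁, hut₁⟩ := slow_max hMsl h₁.pl h₁.mem h₁.lip hst hs ht hu hut hκκ₂ hκC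
      have e2 := h₂.push s t hst (hs.trans hκκ₂) (ht.trans hκκ₂) _ hu₁ hut₁
      have he : (fun y => max (u y) (s + (t - s) * max (Λ₁ y) (Λ₂ y))) = fun y =>
          max (max (u y) (s + (t - s) * Λ₁ y)) (s + (t - s) * Λ₂ y) := by
        funext y
        rw [max_assoc, max_add_add_left, mul_max_of_nonneg _ _ (sub_nonneg.2 hst)]
      rw [he]
      exact e1.trans e2
    · rintro y (hy | hy)
      · simp [hone₁ y hy, (h₂.mem y).2]
      · simp [hone₂ y hy, (h₁.mem y).2]
  · intro x hx
    obtain ⟨O, hO, hxO, κ₀, hκ₀, hpush⟩ := hSp x hx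
    obtain ⟨Λ, C, hC, hpl, hmem, hlip, hoff, hone⟩ := exists_bump x hO hxO
    obtain ⟨N, hN1, hNo, hxN⟩ := eventually_nhds_iff.1 hone
    set κ := min κ₀ (κ₀ / (2 * (C + 1))) with hκdef
    have hκ : 0 < κ := by positivity
    have hκκ : κ ≤ κ₀ := min_le_left _ _
    have hκC : 2 * κ * C ≤ κ₀ := by
      have h : κ ≤ κ₀ / (2 * (C + 1)) := min_le_right _ _
      rw [le_div_iff₀ (by positivity)] at h
      nlinarith
    refine ⟨N, mem_nhdsWithin_of_mem_nhds (hNo.mem_nhds hxN), Λ, κ, C,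
      ⟨hκ, hC, hpl, hmem, hlip, ?_⟩, N, hNo, subset_rfl, hN1⟩
    intro s t hst hs ht u hu hut
    obtain ⟨hu₁, -⟩ := slow_max hMsl hpl hmem hlip hst hs ht hu hut hκκ hκC
    refine hpush _ _ (hu.mono hκκ) hu₁ (fun y _ => le_max_left _ _) fun y hy hyO => ?_
    rw [hoff y hyO, mul_zero, add_zero, max_eq_left (hut y hy).1]

/-- The sublevel pair of `f` at level `t`. -/
def LevelIso (M : Set (Fin n → ℝ)) (f : (Fin n → ℝ) → ℝ) (s t : ℝ) : Prop :=
  PairIso (sub M f fun _ => s) (lev M f fun _ => s) (sub M f fun _ => t) (lev M f fun _ => t)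

theorem exists_levelIso {c : ℝ} (hM : IsCompact M) (hf : PLOn f M)
    (hp : ∀ x ∈ M, f x = c → Pushable M f c x) :
    ∃ δ > 0, ∀ s t, |s - c| ≤ δ → |t - c| ≤ δ → s ≤ t → LevelIso M f s t := by
  have hS : IsCompact (lev M f fun _ => c) := hM.of_isClosed_subset
    (isClosed_setOf_eq hM.isClosed hf.cont continuousOn_const) fun y hy => hy.1
  obtain ⟨Λ, κ, C, h, N, hN, hSN, h1⟩ := exists_isPusher hM hf hS fun x hx => hp x hx.1 hx.2
  obtain ⟨δ, hδ, hδN⟩ : ∃ δ > 0, ∀ y ∈ M, |f y - c| ≤ δ → y ∈ N := by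
    have hK : IsCompact (M \ N) := hM.diff hN
    rcases (M \ N).eq_empty_or_nonempty with h0 | h0
    · exact ⟨1, one_pos, fun y hy _ => by
        by_contra hyN
        exact (h0 ▸ (⟨hy, hyN⟩ : y ∈ M \ N) : y ∈ (∅ : Set _)).elim⟩
    · obtain ⟨z, hz, hmin⟩ := hK.exists_isMinOn h0
        (((hf.cont.mono sdiff_subset).sub continuousOn_const).abs (f := fun y => f y - c))
      have hpos : 0 < |f z - c| := abs_pos.2 fun h0 =>
        hz.2 (hSN ⟨hz.1, sub_eq_zero.1 h0⟩)
      refine ⟨|f z - c| / 2, by positivity, fun y hy hyc => ?_⟩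
      by_contra hyN
      have : |f z - c| ≤ |f y - c| := hmin ⟨hy, hyN⟩
      linarith
  refine ⟨min δ κ, lt_min hδ h.pos, fun s t hs ht hst => ?_⟩
  have hsκ := hs.trans (min_le_right _ _)
  have hsδ := abs_le.1 (hs.trans (min_le_left _ _))
  have htκ := ht.trans (min_le_right _ _)
  have htδ := abs_le.1 (ht.trans (min_le_left _ _))
  have key := h.push s t hst hsκ htκ (fun _ => s)
    ⟨(isAff_const s).plOn hf.dom, fun y _ z _ => by
      simpa using mul_nonneg h.pos.le (norm_nonneg _), fun _ _ => hsκ⟩ fun y _ => ⟨le_rfl, hst⟩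
  have hval : ∀ y, max s (s + (t - s) * Λ y) = s + (t - s) * Λ y := fun y =>
    max_eq_right (by nlinarith [(h.mem y).1])
  have hle : ∀ y, s ≤ s + (t - s) * Λ y ∧ s + (t - s) * Λ y ≤ t := fun y =>
    ⟨by nlinarith [(h.mem y).1], by nlinarith [(h.mem y).2]⟩
  unfold LevelIso
  convert key using 1
  · ext y
    refine and_congr_right fun hy => ?_
    show f y ≤ t ↔ f y ≤ max s (s + (t - s) * Λ y)
    rw [hval]
    refine ⟨fun hyt => ?_, fun hyt => hyt.trans (hle y).2⟩
    by_cases hyN : y ∈ N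
    · rw [h1 y hyN]; linarith
    · by_contra! hcon
      exact hyN (hδN y hy (abs_le.2 ⟨by linarith [(hle y).1], by linarith⟩))
  · ext y
    refine and_congr_right fun hy => ?_
    show f y = t ↔ f y = max s (s + (t - s) * Λ y)
    rw [hval]
    by_cases hyN : y ∈ N
    · rw [h1 y hyN]; simp
    · refine iff_of_false (fun hyt => ?_) (fun hyt => ?_)
      · exact hyN (hδN y hy (abs_le.2 ⟨by linarith, by linarith⟩))
      · exact hyN (hδN y hy (abs_le.2 ⟨by linarith [(hle y).1], by linarith [(hle y).2]⟩))

/-- Sublevel sets over an interval without unpushable points are PL homeomorphic. -/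
theorem levelIso_of_pushable {a b : ℝ} (hM : IsCompact M) (hf : PLOn f M)
    (hp : ∀ x ∈ M, f x ∈ Ioo a b → Pushable M f (f x) x) {s t : ℝ} (hs : s ∈ Ioo a b)
    (ht : t ∈ Ioo a b) : LevelIso M f s t := by
  refine isPreconnected_Ioo.induction₂ (LevelIso M f) (fun c hc => ?_)
    (fun _ _ _ _ _ _ h h' => PairIso.trans h h') (fun _ _ _ _ h => PairIso.symm h) hs ht
  obtain ⟨δ, hδ, h⟩ := exists_levelIso (c := c) hM hf fun x hx hxc => hxc ▸ hp x hx (hxc ▸ hc)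
  filter_upwards [mem_nhdsWithin_of_mem_nhds (Metric.closedBall_mem_nhds c hδ)] with r hr
  rw [Metric.mem_closedBall, Real.dist_eq] at hr
  rcases le_total c r with hcr | hcr
  · exact h c r (by simpa using hδ.le) hr hcr
  · exact (h r c hr (by simpa using hδ.le) hcr).symm

end LocalConstancy

section Chart

variable {n d : ℕ}

/-- The cube `[-1, 1]^d`. -/
def cube (d : ℕ) : Set (Fin d → ℝ) := Set.pi univ fun _ => Icc (-1) 1

theorem mem_cube {y : Fin d → ℝ} : y ∈ cube d ↔ ∀ i, y i ∈ Icc (-1 : ℝ) 1 := mem_univ_pi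

theorem sl_cube : SL (cube d) := by
  have : cube d = {y : Fin d → ℝ | ∀ i, -1 ≤ y i ∧ y i ≤ 1} := by
    ext y
    simp [mem_cube]
  rw [this]
  exact SL.forall fun i => (SL.le (isAff_const _) (isAff_apply i)).and
    (SL.le (isAff_apply i) (isAff_const _))

theorem isCompact_cube : IsCompact (cube d) := isCompact_univ_pi fun _ => isCompact_Icc

theorem convex_cube : Convex ℝ (cube d) := convex_pi fun _ _ => convex_Icc _ _

/-- `ψ` is the inverse of a PL chart of `M` centred at `x` in which `f` is given by `g`. -/
structure IsChart (M : Set (Fin n → ℝ)) (f : (Fin n → ℝ) → ℝ) (x : Fin n → ℝ)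
    (g : (Fin d → ℝ) → ℝ) (ψ : (Fin d → ℝ) → Fin n → ℝ) : Prop where
  pl : PLOn ψ (cube d)
  inj : InjOn ψ (cube d)
  maps : MapsTo ψ (cube d) M
  zero : ψ 0 = x
  val : ∀ y ∈ cube d, f (ψ y) = f x + g y
  lip : ∃ L : ℝ, 0 ≤ L ∧ ∀ y ∈ cube d, ∀ z ∈ cube d, ‖ψ y - ψ z‖ ≤ L * ‖y - z‖
  nhds : ψ '' cube d ∈ nhdsWithin x M

variable {M : Set (Fin n → ℝ)} {f : (Fin n → ℝ) → ℝ} {x : Fin n → ℝ}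

theorem IsChart.neg {g : (Fin d → ℝ) → ℝ} {ψ : (Fin d → ℝ) → Fin n → ℝ}
    (h : IsChart M f x g ψ) : IsChart M (fun y => -f y) x (fun y => -g y) ψ :=
  { h with val := fun y hy => by rw [h.val y hy, neg_add] }

theorem IsChart.pushable {j : Fin d} {ψ : (Fin d → ℝ) → Fin n → ℝ}
    (h : IsChart M f x (fun y => y j) ψ) (hM : IsCompact M) (hf : PLOn f M) (hx : x ∈ M) :
    Pushable M f (f x) x := by
  obtain ⟨L, hL, hlip⟩ := h.lip
  let e : Fin d → ℝ := Pi.single j 1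
  let W : Set (Fin d → ℝ) := {y | y ∈ cube d ∧ y j = 0}
  have hWc : IsCompact W := isCompact_cube.of_isClosed_subset
    (isClosed_setOf_eq isCompact_cube.isClosed (continuous_apply j).continuousOn
      continuousOn_const) fun y hy => hy.1
  have hWsl : SL W := sl_cube.and (SL.eq_real (isAff_apply j) (isAff_const 0))
  have hcoord : ∀ w ∈ W, ∀ r : ℝ, (w + r • e) j = r := fun w hw r => by
    simp [e, hw.2]
  have hcube : ∀ w ∈ W, ∀ r ∈ Icc (-1 : ℝ) 1, w + r • e ∈ cube d := by
    intro w hw r hr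
    rw [mem_cube]
    intro i
    by_cases hi : i = j
    · subst hi
      rwa [hcoord w hw]
    · simpa [e, hi] using mem_cube.1 hw.1 i
  have hmaps : MapsTo (fun p : (Fin d → ℝ) × ℝ => p.1 + p.2 • e) (W ×ˢ Icc (-1) 1) (cube d) :=
    fun p hp => hcube _ hp.1 _ hp.2
  have hWI : SL (W ×ˢ Icc (-1 : ℝ) 1) := by
    have h1 : SL {p : (Fin d → ℝ) × ℝ | p.1 ∈ W} := hWsl.preimage (g := Prod.fst) (by fun_prop)
    exact h1.and ((SL.le (isAff_const _) (by fun_prop)).and (SL.le (by fun_prop) (isAff_const _)))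
  have H : IsBox M f x W 1 (L * ‖e‖) fun p => ψ (p.1 + p.2 • e) :=
    { compact := hWc
      pos := one_pos
      pl := h.pl.comp (IsAff.plOn (by fun_prop) hWI) hmaps
      inj := by
        rintro ⟨w, r⟩ hp ⟨w', r'⟩ hp' heq
        have h1 := h.inj (hmaps hp) (hmaps hp') heq
        have h2 : r = r' := by
          rw [← hcoord w hp.1 r, ← hcoord w' hp'.1 r']
          exact congrFun h1 j
        subst h2
        exact Prod.ext (add_right_cancel h1) rfl
      maps := fun p hp => h.maps (hmaps hp)
      val := fun w hw r hr => by
        show f (ψ (w + r • e)) = f x + r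
        rw [h.val _ (hcube w hw r hr), hcoord w hw]
      L_nonneg := by positivity
      lip := fun w hw r hr s hs => by
        refine (hlip _ (hcube w hw r hr) _ (hcube w hw s hs)).trans_eq ?_
        rw [add_sub_add_left_eq_sub, ← sub_smul, norm_smul, Real.norm_eq_abs]
        ring
      nhds := by
        refine Filter.mem_of_superset h.nhds ?_
        rintro _ ⟨y, hy, rfl⟩
        have hyj := mem_cube.1 hy j
        refine ⟨(y - y j • e, y j), ⟨⟨mem_cube.2 fun i => ?_, by simp [e]⟩, hyj⟩, by simp⟩
        by_cases hi : i = j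
        · subst hi
          simp [e]
        · simpa [e, hi] using mem_cube.1 hy i }
  exact H.push hM hf hx

end Chart

section Carrier

variable {V : Type} [NormedAddCommGroup V] [NormedSpace ℝ V]

theorem exists_open_weight_gt {F : Set (Finset V)} (hF : IsTri F) {μ₀ : V →₀ ℝ}
    (hμ₀ : μ₀ ∈ weights F) {a : V} {δ : ℝ} (hδ : δ < μ₀ a) :
    ∃ U : Set V, IsOpen U ∧ bary μ₀ ∈ U ∧ ∀ μ ∈ weights F, bary μ ∈ U → δ < μ a := by
  classical
  let T : ∀ s : Finset V, (s → ℝ) → V →₀ ℝ := fun s w => ∑ y : s, Finsupp.single (y : V) (w y)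
  have hTa : ∀ (s : Finset V) (w : s → ℝ) (x : V),
      T s w x = ∑ y : s, if (y : V) = x then w y else 0 := fun s w x => by
    simp [T, Finsupp.finsetSum_apply, Finsupp.single_apply]
  have hC : IsCompact (⋃ s ∈ F, (fun w : s → ℝ => ∑ y : s, w y • (y : V)) ''
      {w | w ∈ stdSimplex ℝ s ∧ (∑ y : s, if (y : V) = a then w y else 0) ≤ δ}) := by
    refine hF.finite.isCompact_biUnion fun s _ => IsCompact.image ?_ (by fun_prop)
    refine (isCompact_stdSimplex ℝ s).of_isClosed_subset (isClosed_setOf_le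
      (isCompact_stdSimplex ℝ s).isClosed (Continuous.continuousOn ?_) continuousOn_const)
      fun w hw => hw.1
    refine continuous_finsetSum _ fun y _ => ?_
    split_ifs <;> fun_prop
  refine ⟨_, hC.isClosed.isOpen_compl, fun h => ?_, fun μ hμ h => ?_⟩
  · obtain ⟨s, hs, w, ⟨hw, hwa⟩, hwb⟩ := mem_iUnion₂.1 h
    have hsupp : (T s w).support ⊆ s := by
      intro x hx
      by_contra hxs
      refine Finsupp.mem_support_iff.1 hx ?_
      rw [hTa]
      exact Finset.sum_eq_zero fun y _ => if_neg fun hy : (y : V) = x => hxs (hy ▸ y.2)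
    have hwt : T s w ∈ weights F := by
      refine hF.mem_weights ⟨fun x => ?_, ?_⟩ hs hsupp
      · rw [hTa]
        exact Finset.sum_nonneg fun y _ => by split_ifs <;> simp [hw.1 y]
      · simpa [T] using hw.2
    have : T s w = μ₀ := hF.inj hwt hμ₀ (by rw [← hwb]; simp [T])
    rw [← hTa, this] at hwa
    exact hwa.not_gt hδ
  · by_contra! hμa
    refine h (mem_iUnion₂.2 ⟨μ.support, hμ.2, fun y => μ y, ⟨⟨fun y => hμ.1.1 y, ?_⟩, ?_⟩, ?_⟩)
    · rw [Finset.sum_coe_sort μ.support fun x => μ x, ← mass_eq_sum subset_rfl, hμ.1.2]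
    · rw [Finset.sum_coe_sort μ.support fun x => if x = a then μ x else 0]
      rw [Finset.sum_ite_eq']
      split_ifs with ha
      · exact hμa
      · rwa [Finsupp.notMem_support_iff.1 ha] at hμa
    · show ∑ y : μ.support, μ y • (y : V) = bary μ
      rw [Finset.sum_coe_sort μ.support fun x => μ x • x, bary_eq_sum subset_rfl]

/-- `f` is affine on the simplices of `F`. -/
def AffineOnTri (f : V → ℝ) (F : Set (Finset V)) : Prop :=
  ∀ μ ∈ weights F, f (bary μ) = Finsupp.linearCombination ℝ f μ

theorem exists_segment {F : Set (Finset V)} (hF : IsTri F) {f : V → ℝ} (hf : AffineOnTri f F)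
    {μ₀ : V →₀ ℝ} (hμ₀ : μ₀ ∈ weights F) {a b : V} (ha : a ∈ μ₀.support) (hb : b ∈ μ₀.support)
    (hab : f a < f b) :
    ∃ U : Set V, IsOpen U ∧ bary μ₀ ∈ U ∧ ∃ u : V, ∃ ε > 0, ∀ y ∈ triSpace F, y ∈ U →
      ∀ r ∈ Icc (-ε) ε, y + r • u ∈ triSpace F ∧ f (y + r • u) = f y + r := by
  have hpos : ∀ x ∈ μ₀.support, 0 < μ₀ x := fun x hx =>
    (hμ₀.1.1 x).lt_of_ne' (Finsupp.mem_support_iff.1 hx)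
  obtain ⟨δ, hδ, hδa⟩ := exists_between (lt_min (hpos a ha) (hpos b hb))
  obtain ⟨Ua, hUa, hxa, ha'⟩ := exists_open_weight_gt hF hμ₀ (hδa.trans_le (min_le_left _ _))
  obtain ⟨Ub, hUb, hxb, hb'⟩ := exists_open_weight_gt hF hμ₀ (hδa.trans_le (min_le_right _ _))
  have hD : 0 < f b - f a := sub_pos.2 hab
  refine ⟨Ua ∩ Ub, hUa.inter hUb, ⟨hxa, hxb⟩, (f b - f a)⁻¹ • (b - a), δ * (f b - f a),
    mul_pos hδ hD, ?_⟩
  rintro _ ⟨μ, hμ, rfl⟩ ⟨hya, hyb⟩ r hr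
  have hμa := ha' μ hμ hya
  have hμb := hb' μ hμ hyb
  set t := r * (f b - f a)⁻¹ with ht
  have htr : t * (f b - f a) = r := by rw [ht, inv_mul_cancel_right₀ hD.ne']
  have ht1 : -δ ≤ t := by nlinarith [hr.1]
  have ht2 : t ≤ δ := by nlinarith [hr.2]
  have hne : a ≠ b := fun h => by simp [h] at hab
  let ν : V →₀ ℝ := μ + (Finsupp.single b t - Finsupp.single a t)
  have hν : ν ∈ weights F := by
    classical
    refine hF.mem_weights ⟨fun x => ?_, by simp [ν, hμ.1.2]⟩ hμ.2 fun x hx => ?_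
    · simp only [ν, Finsupp.add_apply, Finsupp.sub_apply, Finsupp.single_apply]
      split_ifs with h1 h2 h2
      · exact (hne (h2.trans h1.symm)).elim
      · subst h1; linarith
      · subst h2; linarith
      · simpa using hμ.1.1 x
    · rw [Finsupp.mem_support_iff] at hx ⊢
      intro h0
      refine hx ?_
      have h1 : b ≠ x := fun h => by subst h; linarith
      have h2 : a ≠ x := fun h => by subst h; linarith
      simp [ν, h0, h1, h2]
  have hbν : bary ν = bary μ + r • (f b - f a)⁻¹ • (b - a) := by
    simp [ν, smul_smul, ← ht, smul_sub]
  rw [← hbν]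
  refine ⟨⟨ν, hν, rfl⟩, ?_⟩
  rw [hf ν hν, hf μ hμ, ← htr]
  simp [ν]
  ring

end Carrier

section NonVertex

variable {n : ℕ} {f : (Fin n → ℝ) → ℝ} {F : Set (Finset (Fin n → ℝ))}

theorem sl_closedBall (x : Fin n → ℝ) {η : ℝ} (hη : 0 ≤ η) : SL (Metric.closedBall x η) := by
  have : Metric.closedBall x η = {y | ∀ i, y i - x i ≤ η ∧ -η ≤ y i - x i} := by
    ext y
    simp only [Metric.mem_closedBall, dist_pi_le_iff hη, Real.dist_eq, abs_le, mem_ofPred_eq]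
    exact forall_congr' fun i => and_comm
  rw [this]
  exact SL.forall fun i => (SL.le (by fun_prop) (isAff_const _)).and
    (SL.le (isAff_const _) (by fun_prop))

/-- Points of the interior of a simplex on which `f` is not constant are pushable. -/
theorem pushable_of_segment (hF : IsTri F) (hfa : AffineOnTri f F) (hM : IsCompact (triSpace F))
    (hf : PLOn f (triSpace F)) {μ : (Fin n → ℝ) →₀ ℝ} (hμ : μ ∈ weights F) {a b : Fin n → ℝ}
    (ha : a ∈ μ.support) (hb : b ∈ μ.support) (hab : f a < f b) :
    Pushable (triSpace F) f (f (bary μ)) (bary μ) := by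
  obtain ⟨U, hU, hxU, u, ε, hε, hseg⟩ := exists_segment hF hfa hμ ha hb hab
  set x := bary μ
  set M := triSpace F
  have hxM : x ∈ M := ⟨μ, hμ, rfl⟩
  obtain ⟨η, hη, hηU⟩ := Metric.nhds_basis_closedBall.mem_iff.1 (hU.mem_nhds hxU)
  let W : Set (Fin n → ℝ) := {y | y ∈ M ∧ f y = f x} ∩ Metric.closedBall x η
  have hWc : IsCompact W := hM.of_isClosed_subset ((isClosed_setOf_eq hM.isClosed hf.cont
    continuousOn_const).inter Metric.isClosed_closedBall) fun y hy => hy.1.1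
  have hWsl : SL W := (hf.sl.eq ((isAff_const (f x)).slOn hf.dom)).inter (sl_closedBall x hη.le)
  have hWI : SL (W ×ˢ Icc (-ε) ε) := by
    have h1 : SL {p : (Fin n → ℝ) × ℝ | p.1 ∈ W} := hWsl.preimage (g := Prod.fst) (by fun_prop)
    exact h1.and ((SL.le (isAff_const _) (by fun_prop)).and (SL.le (by fun_prop) (isAff_const _)))
  have hval : ∀ w ∈ W, ∀ r ∈ Icc (-ε) ε, w + r • u ∈ M ∧ f (w + r • u) = f x + r :=
    fun w hw r hr => by
      obtain ⟨h1, h2⟩ := hseg w hw.1.1 (hηU hw.2) r hr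
      exact ⟨h1, by rw [h2, hw.1.2]⟩
  have H : IsBox M f x W ε ‖u‖ fun p => p.1 + p.2 • u :=
    { compact := hWc
      pos := hε
      pl := IsAff.plOn (by fun_prop) hWI
      inj := by
        rintro ⟨w, r⟩ hp ⟨w', r'⟩ hp' heq
        have h1 := (hval w hp.1 r hp.2).2
        rw [show w + r • u = w' + r' • u from heq, (hval w' hp'.1 r' hp'.2).2] at h1
        have h2 : r' = r := add_left_cancel h1
        subst h2
        exact Prod.ext (add_right_cancel heq) rfl
      maps := fun p hp => (hval _ hp.1 _ hp.2).1
      val := fun w hw r hr => (hval w hw r hr).2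
      L_nonneg := norm_nonneg _
      lip := fun w _ r _ s _ => by
        rw [add_sub_add_left_eq_sub, ← sub_smul, norm_smul, Real.norm_eq_abs, mul_comm]
      nhds := by
        have hc : ContinuousWithinAt (fun y => y - (f y - f x) • u) M x :=
          continuousWithinAt_id.sub (((hf.cont x hxM).sub continuousWithinAt_const).smul
            continuousWithinAt_const)
        have h1 : ∀ᶠ y in nhdsWithin x M, y - (f y - f x) • u ∈ Metric.closedBall x η := by
          refine hc (Metric.closedBall_mem_nhds_of_mem ?_)
          simpa using hη
        have h2 : ∀ᶠ y in nhdsWithin x M, f y ∈ Icc (f x - ε) (f x + ε) :=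
          (hf.cont x hxM) (Icc_mem_nhds (by linarith) (by linarith))
        have h3 : ∀ᶠ y in nhdsWithin x M, y ∈ U :=
          mem_nhdsWithin_of_mem_nhds (hU.mem_nhds hxU)
        filter_upwards [h1, h2, h3, self_mem_nhdsWithin] with y hy1 hy2 hy3 hyM
        have hr : f y - f x ∈ Icc (-ε) ε := ⟨by linarith [hy2.1], by linarith [hy2.2]⟩
        have hr' : -(f y - f x) ∈ Icc (-ε) ε := ⟨by linarith [hr.2], by linarith [hr.1]⟩
        obtain ⟨h4, h5⟩ := hseg y hyM hy3 _ hr'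
        rw [neg_smul, ← sub_eq_add_neg] at h4 h5
        exact ⟨(y - (f y - f x) • u, f y - f x), ⟨⟨⟨h4, by rw [h5]; ring⟩, hy1⟩, hr⟩, by simp⟩ }
  exact H.push hM hf hxM

end NonVertex

section Cone

variable {V : Type} [NormedAddCommGroup V] [NormedSpace ℝ V] [FiniteDimensional ℝ V]

/-- The cone over `S` with apex the origin. -/
def coneSet (S : Set V) : Set V := {x | ∃ t ∈ Icc (0 : ℝ) 1, ∃ y ∈ S, x = t • y}

theorem coneSet_convexHull {s : Finset V} (hs : s.Nonempty) :
    coneSet (convexHull ℝ (s : Set V)) =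
      (fun w : s → ℝ => ∑ y : s, w y • (y : V)) '' {w | (∀ i, 0 ≤ w i) ∧ ∑ i, w i ≤ 1} := by
  ext x
  constructor
  · rintro ⟨t, ht, y, hy, rfl⟩
    obtain ⟨w, hw, rfl⟩ := mem_convexHull_iff_stdSimplex.1 hy
    refine ⟨t • w, ⟨fun i => mul_nonneg ht.1 (hw.1 i), ?_⟩, ?_⟩
    · simp only [Pi.smul_apply, smul_eq_mul, ← Finset.mul_sum, hw.2, mul_one]
      exact ht.2
    · simp [Finset.smul_sum, smul_smul]
  · rintro ⟨w, ⟨hw0, hw1⟩, rfl⟩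
    have hnn : 0 ≤ ∑ i, w i := Finset.sum_nonneg fun i _ => hw0 i
    rcases hnn.eq_or_lt with h0 | h0
    · obtain ⟨a, ha⟩ := hs
      refine ⟨0, ⟨le_rfl, zero_le_one⟩, a, subset_convexHull ℝ _ ha, ?_⟩
      have := (Finset.sum_eq_zero_iff_of_nonneg fun i _ => hw0 i).1 h0.symm
      simp only [zero_smul]
      exact Finset.sum_eq_zero fun i hi => by rw [this i hi, zero_smul]
    · refine ⟨∑ i, w i, ⟨hnn, hw1⟩, ∑ y : s, ((∑ i, w i)⁻¹ * w y) • (y : V),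
        mem_convexHull_iff_stdSimplex.2 ⟨fun y => (∑ i, w i)⁻¹ * w y,
          ⟨fun i => mul_nonneg (inv_nonneg.2 hnn) (hw0 i), ?_⟩, rfl⟩, ?_⟩
      · rw [← Finset.mul_sum, inv_mul_cancel₀ h0.ne']
      · rw [Finset.smul_sum]
        refine Finset.sum_congr rfl fun y _ => ?_
        rw [smul_smul, mul_inv_cancel_left₀ h0.ne']

theorem SL.coneSet {S : Set V} (hS : SL S) (hc : IsCompact S) :
    SL (coneSet S) := by
  obtain ⟨F, hF, rfl⟩ := hS.exists_isTri hc
  have : PLReeb.coneSet (triSpace F) = ⋃ s ∈ F, PLReeb.coneSet (convexHull ℝ (s : Set V)) := by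
    rw [hF.triSpace_eq]
    ext x
    simp only [PLReeb.coneSet, mem_iUnion, mem_ofPred_eq, exists_prop]
    constructor
    · rintro ⟨t, ht, y, ⟨s, hs, hy⟩, rfl⟩
      exact ⟨s, hs, t, ht, y, hy, rfl⟩
    · rintro ⟨s, hs, t, ht, y, hy, rfl⟩
      exact ⟨t, ht, y, ⟨s, hs, hy⟩, rfl⟩
  rw [this]
  refine SL.biUnion hF.finite fun s hs => ?_
  rw [coneSet_convexHull (hF.nonempty s hs)]
  refine SL.image ?_ (IsAff.sum _ fun y _ => (isAff_apply y).smul_const _)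
  exact (SL.forall fun i => SL.le (isAff_const 0) (isAff_apply i)).and
    (SL.le (IsAff.sum _ fun i _ => isAff_apply i) (isAff_const 1))

theorem isCompact_coneSet {S : Set V} (hS : IsCompact S) : IsCompact (coneSet S) := by
  have := (isCompact_Icc (a := (0 : ℝ)) (b := 1)).prod hS
  convert this.image (f := fun p : ℝ × V => p.1 • p.2) (by fun_prop) using 1
  ext x
  constructor
  · rintro ⟨t, ht, y, hy, rfl⟩
    exact ⟨(t, y), ⟨ht, hy⟩, rfl⟩
  · rintro ⟨⟨t, y⟩, ⟨ht, hy⟩, rfl⟩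
    exact ⟨t, ht, y, hy, rfl⟩

end Cone

section Diamond

variable {d : ℕ}

/-- The `ℓ¹` norm. -/
def norm1 (x : Fin d → ℝ) : ℝ := ∑ i, |x i|

theorem norm1_nonneg (x : Fin d → ℝ) : 0 ≤ norm1 x := Finset.sum_nonneg fun _ _ => abs_nonneg _

theorem norm1_smul (t : ℝ) (x : Fin d → ℝ) : norm1 (t • x) = |t| * norm1 x := by
  simp [norm1, abs_mul, Finset.mul_sum]

theorem norm1_eq_zero {x : Fin d → ℝ} : norm1 x = 0 ↔ x = 0 := by
  rw [norm1, Finset.sum_eq_zero_iff_of_nonneg fun _ _ => abs_nonneg _, funext_iff]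
  simp

theorem abs_le_norm1 (x : Fin d → ℝ) (i : Fin d) : |x i| ≤ norm1 x :=
  Finset.single_le_sum (f := fun i => |x i|) (fun _ _ => abs_nonneg _) (Finset.mem_univ i)

theorem norm1_cons (a : ℝ) (x : Fin d → ℝ) :
    norm1 (Fin.cons a x : Fin (d + 1) → ℝ) = |a| + norm1 x := by
  simp [norm1, Fin.sum_univ_succ]

theorem norm1_eq_add_tail (x : Fin (d + 1) → ℝ) : norm1 x = |x 0| + norm1 (Fin.tail x) := by
  rw [← norm1_cons, Fin.cons_self_tail]

theorem plOn_norm1 : PLOn (norm1 : (Fin d → ℝ) → ℝ) univ :=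
  PLOn.sum _ SL.univ fun i _ => ((isAff_apply i).plOn SL.univ).abs

/-- The unit ball of the `ℓ¹` norm. -/
def ball1 (d : ℕ) : Set (Fin d → ℝ) := {x | norm1 x ≤ 1}

/-- The unit sphere of the `ℓ¹` norm. -/
def sphere1 (d : ℕ) : Set (Fin d → ℝ) := {x | norm1 x = 1}

theorem sphere1_subset : sphere1 d ⊆ ball1 d := fun _ hx => le_of_eq hx

theorem sl_ball1 : SL (ball1 d) := by
  have := plOn_norm1.sl.le ((isAff_const (V := Fin d → ℝ) (1 : ℝ)).slOn SL.univ)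
  simpa [ball1] using this

theorem sl_sphere1 : SL (sphere1 d) := by
  have := plOn_norm1.sl.eq ((isAff_const (V := Fin d → ℝ) (1 : ℝ)).slOn SL.univ)
  simpa [sphere1] using this

theorem continuous_norm1 : Continuous (norm1 : (Fin d → ℝ) → ℝ) :=
  continuousOn_univ.1 plOn_norm1.cont

theorem ball1_subset_cube : ball1 d ⊆ cube d := fun x hx =>
  mem_cube.2 fun i => abs_le.1 ((abs_le_norm1 x i).trans hx)

theorem isCompact_ball1 : IsCompact (ball1 d) :=
  isCompact_cube.of_isClosed_subset (isClosed_le continuous_norm1 continuous_const)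
    ball1_subset_cube

theorem isCompact_sphere1 : IsCompact (sphere1 d) :=
  isCompact_ball1.of_isClosed_subset (isClosed_eq continuous_norm1 continuous_const)
    sphere1_subset

/-- The radial extension of `g`. -/
noncomputable def coneMap (g : (Fin d → ℝ) → Fin d → ℝ) (x : Fin d → ℝ) : Fin d → ℝ :=
  norm1 x • g ((norm1 x)⁻¹ • x)

variable {g : (Fin d → ℝ) → Fin d → ℝ}

theorem inv_norm1_smul_mem {x : Fin d → ℝ} (hx : x ≠ 0) : (norm1 x)⁻¹ • x ∈ sphere1 d := by
  have h0 : norm1 x ≠ 0 := fun h => hx (norm1_eq_zero.1 h)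
  show norm1 _ = 1
  rw [norm1_smul, abs_inv, abs_of_nonneg (norm1_nonneg x), inv_mul_cancel₀ h0]

@[simp] theorem coneMap_zero : coneMap g 0 = 0 := by
  simp [coneMap, norm1_eq_zero.2]

theorem coneMap_smul {t : ℝ} (ht : 0 ≤ t) {x : Fin d → ℝ} (hx : x ∈ sphere1 d) :
    coneMap g (t • x) = t • g x := by
  have hx1 : norm1 x = 1 := hx
  have h1 : norm1 (t • x) = t := by rw [norm1_smul, hx1, abs_of_nonneg ht, mul_one]
  rcases ht.eq_or_lt with rfl | ht
  · simp
  · rw [coneMap, h1, inv_smul_smul₀ ht.ne']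

theorem coneMap_eq {x : Fin d → ℝ} (hx : x ∈ sphere1 d) : coneMap g x = g x := by
  simpa using coneMap_smul (g := g) zero_le_one hx

theorem norm1_coneMap (hg : MapsTo g (sphere1 d) (sphere1 d)) (x : Fin d → ℝ) :
    norm1 (coneMap g x) = norm1 x := by
  by_cases hx : x = 0
  · simp [hx]
  · have : norm1 (g ((norm1 x)⁻¹ • x)) = 1 := hg (inv_norm1_smul_mem hx)
    rw [coneMap, norm1_smul, this, mul_one, abs_of_nonneg (norm1_nonneg x)]

theorem coneMap_coneMap {g' : (Fin d → ℝ) → Fin d → ℝ} (hg : MapsTo g (sphere1 d) (sphere1 d))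
    (h : LeftInvOn g' g (sphere1 d)) (x : Fin d → ℝ) : coneMap g' (coneMap g x) = x := by
  by_cases hx : x = 0
  · simp [hx]
  · have h0 : norm1 x ≠ 0 := fun h => hx (norm1_eq_zero.1 h)
    have h1 := inv_norm1_smul_mem hx
    rw [coneMap.eq_1 g, coneMap_smul (norm1_nonneg x) (hg h1), h h1, smul_inv_smul₀ h0]

theorem plOn_coneMap (hg : PLOn g (sphere1 d)) : PLOn (coneMap g) (ball1 d) := by
  have hgr : IsCompact {p : (Fin d → ℝ) × (Fin d → ℝ) | p.1 ∈ sphere1 d ∧ p.2 = g p.1} := by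
    convert isCompact_sphere1.image_of_continuousOn (continuousOn_id.prodMk hg.cont) using 1
    ext ⟨x, y⟩
    constructor
    · rintro ⟨hx, hy⟩
      exact ⟨x, hx, Prod.ext rfl hy.symm⟩
    · rintro ⟨x', hx, h⟩
      obtain ⟨rfl, rfl⟩ := Prod.mk.inj h
      exact ⟨hx, rfl⟩
  have key : {p : (Fin d → ℝ) × (Fin d → ℝ) | p.1 ∈ ball1 d ∧ p.2 = coneMap g p.1} =
      {0} ∪ coneSet {p : (Fin d → ℝ) × (Fin d → ℝ) | p.1 ∈ sphere1 d ∧ p.2 = g p.1} := by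
    ext ⟨x, y⟩
    constructor
    · rintro ⟨hx, hy⟩
      obtain rfl : y = coneMap g x := hy
      by_cases h0 : x = 0
      · left
        simp [h0]
      · right
        have hn : norm1 x ≠ 0 := fun h => h0 (norm1_eq_zero.1 h)
        exact ⟨norm1 x, ⟨norm1_nonneg x, hx⟩, ((norm1 x)⁻¹ • x, g ((norm1 x)⁻¹ • x)),
          ⟨inv_norm1_smul_mem h0, rfl⟩, Prod.ext (smul_inv_smul₀ hn x).symm rfl⟩
    · rintro (h | ⟨t, ht, ⟨x', y'⟩, ⟨hx, hy⟩, h⟩)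
      · obtain ⟨rfl, rfl⟩ := Prod.mk.inj h
        exact ⟨by simp [ball1, norm1], by simp⟩
      · obtain ⟨rfl, rfl⟩ := Prod.mk.inj h
        have hx1 : norm1 x' = 1 := hx
        refine ⟨?_, ?_⟩
        · show norm1 (t • x') ≤ 1
          rw [norm1_smul, hx1, abs_of_nonneg ht.1, mul_one]
          exact ht.2
        · show t • y' = coneMap g (t • x')
          rw [coneMap_smul ht.1 hx, show y' = g x' from hy]
  have hsl : SL ({0} : Set ((Fin d → ℝ) × (Fin d → ℝ))) := by
    have := SL.eq (isAff_id (V := (Fin d → ℝ) × (Fin d → ℝ))) (isAff_const 0)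
    simpa using this
  refine ⟨continuousOn_of_isCompact_graph ?_, ?_⟩
  · rw [key]
    exact isCompact_singleton.union (isCompact_coneSet hgr)
  · rw [SLOn, key]
    exact hsl.union (hg.sl.coneSet hgr)

/-- The Alexander trick. -/
theorem isPairIso_coneMap (hg : PLOn g (sphere1 d)) (hb : BijOn g (sphere1 d) (sphere1 d)) :
    IsPairIso (coneMap g) (ball1 d) (sphere1 d) (ball1 d) (sphere1 d) := by
  set g' := Function.invFunOn g (sphere1 d)
  have hi := hb.invOn_invFunOn
  have hm' : MapsTo g' (sphere1 d) (sphere1 d) := hb.surjOn.mapsTo_invFunOn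
  refine ⟨isCompact_ball1, plOn_coneMap hg, ?_, fun x _ => ?_⟩
  · refine InvOn.bijOn (f' := coneMap g') ⟨fun x _ => coneMap_coneMap hb.mapsTo hi.1 x,
      fun x _ => coneMap_coneMap hm' hi.2 x⟩ (fun x hx => ?_) fun x hx => ?_
    · show norm1 _ ≤ 1
      rw [norm1_coneMap hb.mapsTo]; exact hx
    · show norm1 _ ≤ 1
      rw [norm1_coneMap hm']; exact hx
  · show norm1 _ = 1 ↔ norm1 x = 1
    rw [norm1_coneMap hb.mapsTo]

end Diamond

section Glue

variable {V : Type} [NormedAddCommGroup V] [NormedSpace ℝ V] [FiniteDimensional ℝ V] {d : ℕ}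
  {A B A₀ : Set V}

theorem plOn_cons {a : V → ℝ} {h : V → Fin d → ℝ} (ha : PLOn a A) (hh : PLOn h A) :
    PLOn (fun x => (Fin.cons (a x) (h x) : Fin (d + 1) → ℝ)) A := by
  refine PLOn.pi ha.dom fun i => ?_
  refine Fin.cases ?_ (fun j => ?_) i
  · simpa using ha
  · simpa using IsAff.comp_plOn (isAff_apply j) hh

/-- Two balls glued along their boundaries form a sphere. -/
theorem glue_of_eqOn {h k : V → Fin d → ℝ} (hh : IsPairIso h A A₀ (ball1 d) (sphere1 d))
    (hk : IsPairIso k B A₀ (ball1 d) (sphere1 d)) (hAB : A ∩ B = A₀) (he : EqOn h k A₀) :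
    PairIso (A ∪ B) ∅ (sphere1 (d + 1)) ∅ := by
  classical
  let H₁ : V → Fin (d + 1) → ℝ := fun x => Fin.cons (norm1 (h x) - 1) (h x)
  let H₂ : V → Fin (d + 1) → ℝ := fun x => Fin.cons (1 - norm1 (k x)) (k x)
  let H : V → Fin (d + 1) → ℝ := fun x => if x ∈ A then H₁ x else H₂ x
  have hA : ∀ x ∈ A, norm1 (h x) ≤ 1 := fun x hx => hh.bij.mapsTo hx
  have hB : ∀ x ∈ B, norm1 (k x) ≤ 1 := fun x hx => hk.bij.mapsTo hx
  have hA0 : ∀ x ∈ A, norm1 (h x) = 1 → x ∈ A₀ := fun x hx h1 => (hh.pair x hx).1 h1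
  have hB0 : ∀ x ∈ B, norm1 (k x) = 1 → x ∈ A₀ := fun x hx h1 => (hk.pair x hx).1 h1
  have hH₁ : ∀ x ∈ A, H x = H₁ x := fun x hx => if_pos hx
  have hH₂ : ∀ x ∈ B, H x = H₂ x := fun x hx => by
    by_cases hxA : x ∈ A
    · have hx0 : x ∈ A₀ := hAB ▸ ⟨hxA, hx⟩
      have h1 : norm1 (k x) = 1 := (hk.pair x hx).2 hx0
      rw [hH₁ x hxA]
      simp only [H₁, H₂, he hx0, h1, sub_self]
    · exact if_neg hxA
  have h1 : PLOn H₁ A := plOn_cons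
    (IsAff.comp_plOn (g := fun t : ℝ => t - 1) (by fun_prop)
      (plOn_norm1.comp hh.pl (mapsTo_univ _ _))) hh.pl
  have h2 : PLOn H₂ B := plOn_cons
    (IsAff.comp_plOn (g := fun t : ℝ => 1 - t) (by fun_prop)
      (plOn_norm1.comp hk.pl (mapsTo_univ _ _))) hk.pl
  refine ⟨H, hh.compact.union hk.compact, (h1.congr hH₁).union (h2.congr hH₂)
    hh.compact.isClosed hk.compact.isClosed, ⟨?_, ?_, ?_⟩, fun _ _ => Iff.rfl⟩
  · rintro x (hx | hx)
    · show norm1 _ = 1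
      rw [hH₁ x hx, norm1_cons, abs_of_nonpos (by linarith [hA x hx])]
      ring
    · show norm1 _ = 1
      rw [hH₂ x hx, norm1_cons, abs_of_nonneg (by linarith [hB x hx])]
      ring
  · have cross : ∀ x ∈ A, ∀ y ∈ B, H x = H y → x = y := by
      intro x hx y hy hxy
      rw [hH₁ x hx, hH₂ y hy] at hxy
      obtain ⟨e1, e2⟩ := Fin.cons_injective2 hxy
      have h1 : norm1 (h x) = 1 := by linarith [hA x hx, hB y hy]
      have h2 : norm1 (k y) = 1 := by linarith [hA x hx, hB y hy]
      have hx0 := hA0 x hx h1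
      have hxB : x ∈ B := (hAB.symm ▸ hx0 : x ∈ A ∩ B).2
      exact hk.bij.injOn hxB hy (by rw [← he hx0, e2])
    rintro x (hx | hx) y (hy | hy) hxy
    · rw [hH₁ x hx, hH₁ y hy] at hxy
      exact hh.bij.injOn hx hy (Fin.cons_injective2 hxy).2
    · exact cross x hx y hy hxy
    · exact (cross y hy x hx hxy.symm).symm
    · rw [hH₂ x hx, hH₂ y hy] at hxy
      exact hk.bij.injOn hx hy (Fin.cons_injective2 hxy).2
  · intro y hy
    have hy1 : |y 0| + norm1 (Fin.tail y) = 1 := (norm1_eq_add_tail y).symm.trans hy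
    have hmem : Fin.tail y ∈ ball1 d := by
      show norm1 _ ≤ 1
      linarith [abs_nonneg (y 0)]
    rcases le_total (y 0) 0 with h0 | h0
    · obtain ⟨x, hx, hxy⟩ := hh.bij.surjOn hmem
      refine ⟨x, Or.inl hx, ?_⟩
      rw [hH₁ x hx, ← Fin.cons_self_tail y]
      rw [abs_of_nonpos h0] at hy1
      simp only [H₁, hxy]
      congr 1
      linarith
    · obtain ⟨x, hx, hxy⟩ := hk.bij.surjOn hmem
      refine ⟨x, Or.inr hx, ?_⟩
      rw [hH₂ x hx, ← Fin.cons_self_tail y]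
      rw [abs_of_nonneg h0] at hy1
      simp only [H₂, hxy]
      congr 1
      linarith

theorem PairIso.glue (hA : PairIso A A₀ (ball1 d) (sphere1 d))
    (hB : PairIso B A₀ (ball1 d) (sphere1 d)) (hAB : A ∩ B = A₀) :
    PairIso (A ∪ B) ∅ (sphere1 (d + 1)) ∅ := by
  obtain ⟨h, hh⟩ := hA
  obtain ⟨k, hk⟩ := hB
  have hAA : ∀ x ∈ A₀, x ∈ A ∧ x ∈ B := fun x hx => (hAB.symm ▸ hx : x ∈ A ∩ B)
  have hp := hh.symm
  have hq := hk.symm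
  set p := Function.invFunOn h A
  set q := Function.invFunOn k B
  have hhp : InvOn p h A _ := hh.bij.invOn_invFunOn
  have hkq : InvOn q k B _ := hk.bij.invOn_invFunOn
  have hqm : ∀ y ∈ sphere1 d, q y ∈ A₀ := fun y hy => (hq.pair y (sphere1_subset hy)).2 hy
  have hpm : ∀ y ∈ sphere1 d, p y ∈ A₀ := fun y hy => (hp.pair y (sphere1_subset hy)).2 hy
  have hg : PLOn (fun y => h (q y)) (sphere1 d) :=
    hh.pl.comp (hq.pl.mono sl_sphere1 sphere1_subset) fun y hy => (hAA _ (hqm y hy)).1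
  have hb : BijOn (fun y => h (q y)) (sphere1 d) (sphere1 d) := by
    refine ⟨fun y hy => ?_, fun y hy z hz hyz => ?_, fun z hz => ?_⟩
    · exact (hh.pair _ (hAA _ (hqm y hy)).1).2 (hqm y hy)
    · exact hq.bij.injOn (sphere1_subset hy) (sphere1_subset hz)
        (hh.bij.injOn (hAA _ (hqm y hy)).1 (hAA _ (hqm z hz)).1 hyz)
    · have h1 := hpm z hz
      refine ⟨k (p z), (hk.pair _ (hAA _ h1).2).2 h1, ?_⟩
      show h (q (k (p z))) = z
      rw [hkq.1 (hAA _ h1).2, hhp.2 (sphere1_subset hz)]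
  refine glue_of_eqOn hh (hk.trans (isPairIso_coneMap hg hb)) hAB fun x hx => ?_
  show h x = coneMap _ (k x)
  rw [coneMap_eq ((hk.pair x (hAA x hx).2).2 hx), hkq.1 (hAA x hx).2]

end Glue

section Model

/-- A PL homeomorphism of `ℝ^k` onto the boundary of the positive orthant of `ℝ^(k+1)`. -/
noncomputable def orthantMap : ∀ k : ℕ, (Fin k → ℝ) → Fin (k + 1) → ℝ
  | 0, _ => 0
  | k + 1, y => Fin.cons (max (y 0) 0) fun j =>
      orthantMap k (Fin.tail y) j + max (-y 0) 0 / ((k : ℝ) + 1)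

/-- The boundary of the positive orthant. -/
def orthantBoundary (k : ℕ) : Set (Fin (k + 1) → ℝ) := {x | (∀ i, 0 ≤ x i) ∧ ∃ i, x i = 0}

@[simp] theorem orthantMap_succ_zero (k : ℕ) (y : Fin (k + 1) → ℝ) :
    orthantMap (k + 1) y 0 = max (y 0) 0 := rfl

@[simp] theorem orthantMap_succ_succ (k : ℕ) (y : Fin (k + 1) → ℝ) (j : Fin (k + 1)) :
    orthantMap (k + 1) y j.succ = orthantMap k (Fin.tail y) j + max (-y 0) 0 / ((k : ℝ) + 1) := rfl

theorem orthantMap_mem (k : ℕ) (y : Fin k → ℝ) : orthantMap k y ∈ orthantBoundary k := by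
  induction k with
  | zero => exact ⟨fun _ => le_rfl, 0, rfl⟩
  | succ k ih =>
    obtain ⟨h1, j, hj⟩ := ih (Fin.tail y)
    refine ⟨fun i => ?_, ?_⟩
    · refine Fin.cases ?_ (fun j => ?_) i
      · simp
      · rw [orthantMap_succ_succ]
        have := h1 j
        positivity
    · rcases le_total (y 0) 0 with h0 | h0
      · exact ⟨0, by simp [h0]⟩
      · exact ⟨j.succ, by simp [hj, h0]⟩

theorem sum_orthantMap (k : ℕ) (y : Fin k → ℝ) : ∑ i, orthantMap k y i = norm1 y := by
  induction k with
  | zero => simp [orthantMap, norm1]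
  | succ k ih =>
    rw [Fin.sum_univ_succ]
    simp only [orthantMap_succ_zero, orthantMap_succ_succ]
    rw [Finset.sum_add_distrib, ih, norm1_eq_add_tail]
    have hk : (k : ℝ) + 1 ≠ 0 := by positivity
    have : |y 0| = max (y 0) 0 + max (-y 0) 0 := by
      rcases le_total (y 0) 0 with h0 | h0
      · simp [h0, abs_of_nonpos h0]
      · simp [h0, abs_of_nonneg h0]
    rw [this]
    simp only [Finset.sum_const, Finset.card_univ, Fintype.card_fin, nsmul_eq_mul]
    push_cast
    rw [mul_div_cancel₀ _ hk]
    ring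

theorem orthantMap_injective (k : ℕ) : Function.Injective (orthantMap k) := by
  induction k with
  | zero => exact fun y z _ => Subsingleton.elim y z
  | succ k ih =>
    intro y z h
    have h0 : max (y 0) 0 = max (z 0) 0 := congrFun h 0
    have hs : ∀ j, orthantMap k (Fin.tail y) j + max (-y 0) 0 / ((k : ℝ) + 1) =
        orthantMap k (Fin.tail z) j + max (-z 0) 0 / ((k : ℝ) + 1) := fun j => congrFun h j.succ
    obtain ⟨hy, jy, hjy⟩ := orthantMap_mem k (Fin.tail y)
    obtain ⟨hz, jz, hjz⟩ := orthantMap_mem k (Fin.tail z)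
    have h1 : max (-y 0) 0 / ((k : ℝ) + 1) = max (-z 0) 0 / ((k : ℝ) + 1) :=
      le_antisymm (by linarith [hs jz, hy jz]) (by linarith [hs jy, hz jy])
    have ht : Fin.tail y = Fin.tail z := ih (funext fun j => by linarith [hs j])
    have hk : (k : ℝ) + 1 ≠ 0 := by positivity
    have h2 : max (-y 0) 0 = max (-z 0) 0 := by field_simp at h1; exact h1
    have h3 : ∀ a : ℝ, max a 0 - max (-a) 0 = a := max_zero_sub_eq_self
    rw [← Fin.cons_self_tail y, ← Fin.cons_self_tail z, ht, ← h3 (y 0), ← h3 (z 0), h0, h2]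

theorem exists_orthantMap_eq (k : ℕ) {x : Fin (k + 1) → ℝ} (hx : x ∈ orthantBoundary k) :
    ∃ y, orthantMap k y = x := by
  induction k with
  | zero =>
    obtain ⟨-, i, hi⟩ := hx
    refine ⟨0, funext fun j => ?_⟩
    rw [show j = i from Subsingleton.elim (α := Fin 1) j i, hi]
    rfl
  | succ k ih =>
    obtain ⟨hx0, i, hi⟩ := hx
    obtain ⟨j₀, hj₀⟩ := Finite.exists_min (Fin.tail x)
    set m := Fin.tail x j₀ with hm
    have hm0 : 0 ≤ m := hx0 _
    obtain ⟨y', hy'⟩ := ih (x := fun j => Fin.tail x j - m)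
      ⟨fun j => sub_nonneg.2 (hj₀ j), j₀, sub_self _⟩
    have hk : (k : ℝ) + 1 ≠ 0 := by positivity
    have h : max (x 0 - (k + 1) * m) 0 = x 0 ∧ max (-(x 0 - (k + 1) * m)) 0 / ((k : ℝ) + 1) = m := by
      have hor : x 0 = 0 ∨ m = 0 := by
        refine Fin.cases (fun h => Or.inl h) (fun j h => Or.inr ?_) i hi
        exact le_antisymm ((hj₀ j).trans_eq h) hm0
      rcases hor with h | h
      · have hkm : 0 ≤ ((k : ℝ) + 1) * m := by positivity
        rw [h, zero_sub, neg_neg, max_eq_right (neg_nonpos.2 hkm), max_eq_left hkm,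
          mul_div_cancel_left₀ _ hk]
        exact ⟨rfl, rfl⟩
      · simp [h, hx0 0]
    refine ⟨Fin.cons (x 0 - (k + 1) * m) y', funext fun j => ?_⟩
    refine Fin.cases ?_ (fun j => ?_) j
    · rw [orthantMap_succ_zero, Fin.cons_zero, h.1]
    · rw [orthantMap_succ_succ, Fin.cons_zero, Fin.tail_cons, h.2, hy']
      simp [Fin.tail]

theorem plOn_orthantMap (k : ℕ) : PLOn (orthantMap k) univ := by
  induction k with
  | zero => exact (isAff_const 0).plOn SL.univ
  | succ k ih =>
    have h0 : IsAff fun y : Fin (k + 1) → ℝ => y 0 := isAff_apply 0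
    have htail : IsAff (Fin.tail : (Fin (k + 1) → ℝ) → Fin k → ℝ) :=
      isAff_pi fun i => isAff_apply i.succ
    refine plOn_cons ((h0.plOn SL.univ).max ((isAff_const 0).plOn SL.univ)) ?_
    refine PLOn.pi SL.univ fun j => ?_
    refine PLOn.add (IsAff.comp_plOn (isAff_apply j) (ih.comp (htail.plOn SL.univ)
      (mapsTo_univ _ _))) ?_
    exact IsAff.comp_plOn (g := fun t : ℝ => t / ((k : ℝ) + 1)) (by fun_prop)
      ((h0.plOn SL.univ).neg.max ((isAff_const 0).plOn SL.univ))

theorem pairIso_sphere1_stdSphere (d : ℕ) : PairIso (sphere1 (d + 1)) ∅ (stdSphere d) ∅ := by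
  refine ⟨orthantMap (d + 1), isCompact_sphere1, (plOn_orthantMap _).mono sl_sphere1 (subset_univ _),
    ⟨fun y hy => ?_, (orthantMap_injective _).injOn, fun x hx => ?_⟩, fun _ _ => Iff.rfl⟩
  · obtain ⟨h1, h2⟩ := orthantMap_mem (d + 1) y
    exact ⟨⟨h1, (sum_orthantMap _ y).trans hy⟩, h2⟩
  · obtain ⟨y, rfl⟩ := exists_orthantMap_eq (d + 1) (x := x) ⟨hx.1.1, hx.2⟩
    exact ⟨y, (sum_orthantMap _ y).symm.trans hx.1.2, rfl⟩

end Model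

section Extremum

variable {n d : ℕ} {M : Set (Fin n → ℝ)} {f : (Fin n → ℝ) → ℝ}

/-- Near a nondegenerate minimum the sublevel sets are balls. -/
theorem exists_pairIso_ball (hM : IsCompact M) (hf : PLOn f M) {x : Fin n → ℝ}
    (hmin : ∀ y ∈ M, y ≠ x → f x < f y) {ψ : (Fin d → ℝ) → Fin n → ℝ}
    (hψ : IsChart M f x norm1 ψ) :
    ∃ δ > 0, ∀ s ∈ Ioo (f x) (f x + δ),
      PairIso (sub M f fun _ => s) (lev M f fun _ => s) (ball1 d) (sphere1 d) := by
  obtain ⟨U, hU, hxU, hUM⟩ := mem_nhdsWithin.1 hψ.nhds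
  obtain ⟨δ, hδ, hδU⟩ : ∃ δ > 0, ∀ y ∈ M, f y < f x + δ → y ∈ U := by
    have hK : IsCompact (M \ U) := hM.diff hU
    rcases (M \ U).eq_empty_or_nonempty with h0 | h0
    · exact ⟨1, one_pos, fun y hy _ => by
        by_contra hyU
        exact (h0 ▸ (⟨hy, hyU⟩ : y ∈ M \ U) : y ∈ (∅ : Set _)).elim⟩
    · obtain ⟨z, hz, hzmin⟩ := hK.exists_isMinOn h0 (hf.cont.mono sdiff_subset)
      have hzx : z ≠ x := fun h => hz.2 (h ▸ hxU)
      refine ⟨f z - f x, sub_pos.2 (hmin z hz.1 hzx), fun y hy hyz => ?_⟩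
      by_contra hyU
      have : f z ≤ f y := hzmin ⟨hy, hyU⟩
      linarith
  refine ⟨min δ 1, lt_min hδ one_pos, fun s hs => PairIso.symm ?_⟩
  set t := s - f x with ht
  have ht0 : 0 < t := sub_pos.2 hs.1
  have ht1 : t ≤ 1 := by linarith [hs.2, min_le_right δ 1]
  have htδ : t < δ := by linarith [hs.2, min_le_left δ 1]
  have hnorm : ∀ y : Fin d → ℝ, norm1 (t • y) = t * norm1 y := fun y => by
    rw [norm1_smul, abs_of_pos ht0]
  have hmaps : MapsTo (fun y : Fin d → ℝ => t • y) (ball1 d) (cube d) := fun y hy =>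
    ball1_subset_cube (by
      show norm1 (t • y) ≤ 1
      rw [hnorm]
      exact mul_le_one₀ ht1 (norm1_nonneg y) hy)
  have hval : ∀ y ∈ ball1 d, f (ψ (t • y)) = f x + t * norm1 y := fun y hy => by
    rw [hψ.val _ (hmaps hy), hnorm]
  refine ⟨fun y => ψ (t • y), isCompact_ball1,
    hψ.pl.comp (IsAff.plOn (by fun_prop) sl_ball1) hmaps, ⟨fun y hy => ?_, fun y hy z hz h => ?_,
    fun z hz => ?_⟩, fun y hy => ?_⟩
  · refine ⟨hψ.maps (hmaps hy), ?_⟩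
    show f (ψ (t • y)) ≤ s
    rw [hval y hy]
    have : t * norm1 y ≤ t * 1 := by gcongr; exact hy
    linarith
  · exact smul_right_injective _ ht0.ne' (hψ.inj (hmaps hy) (hmaps hz) h)
  · have hzs : f z ≤ s := hz.2
    obtain ⟨y, hy, rfl⟩ := hUM ⟨hδU z hz.1 (by linarith), hz.1⟩
    refine ⟨t⁻¹ • y, ?_, ?_⟩
    · show norm1 (t⁻¹ • y) ≤ 1
      rw [norm1_smul, abs_of_pos (inv_pos.2 ht0), inv_mul_le_one₀ ht0]
      rw [hψ.val y hy] at hzs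
      linarith
    · show ψ (t • t⁻¹ • y) = ψ y
      rw [smul_inv_smul₀ ht0.ne']
  · have h1 : ψ (t • y) ∈ lev M f (fun _ => s) ↔ f (ψ (t • y)) = s :=
      and_iff_right (hψ.maps (hmaps hy))
    rw [h1, hval y hy]
    show f x + t * norm1 y = s ↔ norm1 y = 1
    constructor
    · intro h
      have : t * norm1 y = t * 1 := by linarith
      exact mul_left_cancel₀ ht0.ne' this
    · intro h
      rw [h]
      linarith

/-- The PL Reeb theorem for a compact semilinear set. -/
theorem pairIso_stdSphere (hM : IsCompact M) (hf : PLOn f M) {p q : Fin n → ℝ}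
    (hpq : p ≠ q) (hmin : ∀ y ∈ M, y ≠ p → f p < f y) (hq : q ∈ M)
    (hmax : ∀ y ∈ M, y ≠ q → f y < f q) {ψ χ : (Fin d → ℝ) → Fin n → ℝ}
    (hψ : IsChart M f p norm1 ψ) (hχ : IsChart M f q (fun y => -norm1 y) χ)
    (hpush : ∀ x ∈ M, x ≠ p → x ≠ q → Pushable M f (f x) x) :
    PairIso M ∅ (stdSphere d) ∅ := by
  have hlt : f p < f q := hmin q hq hpq.symm
  obtain ⟨δ, hδ, h1⟩ := exists_pairIso_ball hM hf hmin hψ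
  have hχ' : IsChart M (fun y => -f y) q norm1 χ := by simpa using hχ.neg
  obtain ⟨δ', hδ', h2⟩ := exists_pairIso_ball hM hf.neg
    (fun y hy hyq => neg_lt_neg (hmax y hy hyq)) hχ'
  obtain ⟨s, hs1, hs2⟩ := exists_between (lt_min hlt (lt_add_of_pos_right (f p) hδ))
  obtain ⟨t, ht1, ht2⟩ := exists_between (max_lt hlt (sub_lt_self (f q) hδ'))
  have hs : s ∈ Ioo (f p) (f q) := ⟨hs1, hs2.trans_le (min_le_left _ _)⟩
  have ht : t ∈ Ioo (f p) (f q) := ⟨(le_max_left _ _).trans_lt ht1, ht2⟩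
  have hlev : LevelIso M f t s := levelIso_of_pushable hM hf (fun x hx hxI =>
    hpush x hx (fun h => by simp [h] at hxI) (fun h => by simp [h] at hxI)) ht hs
  have hA := hlev.trans (h1 s ⟨hs1, hs2.trans_le (min_le_right _ _)⟩)
  have hB := h2 (-t) ⟨neg_lt_neg ht2, by linarith [(le_max_right _ _).trans_lt ht1]⟩
  have hlevB : lev M (fun y => -f y) (fun _ => -t) = lev M f fun _ => t := by
    ext y
    exact and_congr_right fun _ => neg_inj
  rw [hlevB] at hB
  have hAB : sub M f (fun _ => t) ∩ sub M (fun y => -f y) (fun _ => -t) = lev M f fun _ => t := by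
    ext y
    constructor
    · rintro ⟨⟨hy, h1⟩, -, h2⟩
      exact ⟨hy, le_antisymm h1 (neg_le_neg_iff.1 h2)⟩
    · rintro ⟨hy, h1⟩
      exact ⟨⟨hy, le_of_eq h1⟩, hy, neg_le_neg (ge_of_eq h1)⟩
  have hU : sub M f (fun _ => t) ∪ sub M (fun y => -f y) (fun _ => -t) = M := by
    ext y
    constructor
    · rintro (h | h) <;> exact h.1
    · intro hy
      rcases le_total (f y) t with h | h
      · exact Or.inl ⟨hy, h⟩
      · exact Or.inr ⟨hy, neg_le_neg h⟩
  have := (PairIso.glue hA hB hAB).trans (pairIso_sphere1_stdSphere d)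
  rwa [hU] at this

end Extremum

section Noncritical

variable {n d : ℕ} {M : Set (Fin n → ℝ)} {f : (Fin n → ℝ) → ℝ}

/-- A point behaving like a regular point of `f`. -/
structure Noncritical (M : Set (Fin n → ℝ)) (f : (Fin n → ℝ) → ℝ) (x : Fin n → ℝ) : Prop where
  pushable : Pushable M f (f x) x
  lower : ∃ y ∈ M, f y < f x
  upper : ∃ y ∈ M, f x < f y

theorem single_mem_cube (j : Fin d) {t : ℝ} (ht : t ∈ Icc (-1 : ℝ) 1) :
    (Pi.single j t : Fin d → ℝ) ∈ cube d := by
  refine mem_cube.2 fun i => ?_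
  by_cases hi : i = j
  · subst hi
    simpa using ht
  · simp [hi]

theorem IsChart.noncritical {x : Fin n → ℝ} {j : Fin d} {ψ : (Fin d → ℝ) → Fin n → ℝ}
    (h : IsChart M f x (fun y => y j) ψ) (hM : IsCompact M) (hf : PLOn f M) (hx : x ∈ M) :
    Noncritical M f x := by
  have h1 : (Pi.single j (-1) : Fin d → ℝ) ∈ cube d := single_mem_cube j (by norm_num)
  have h2 : (Pi.single j 1 : Fin d → ℝ) ∈ cube d := single_mem_cube j (by norm_num)
  exact ⟨h.pushable hM hf hx, ⟨_, h.maps h1, by simp [h.val _ h1]⟩,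
    ⟨_, h.maps h2, by simp [h.val _ h2]⟩⟩

theorem noncritical_of_segment {F : Set (Finset (Fin n → ℝ))} (hF : IsTri F)
    (hfa : AffineOnTri f F) (hM : IsCompact (triSpace F)) (hf : PLOn f (triSpace F))
    {μ : (Fin n → ℝ) →₀ ℝ} (hμ : μ ∈ weights F) {a b : Fin n → ℝ} (ha : a ∈ μ.support)
    (hb : b ∈ μ.support) (hab : f a < f b) : Noncritical (triSpace F) f (bary μ) := by
  obtain ⟨U, -, hxU, u, ε, hε, hseg⟩ := exists_segment hF hfa hμ ha hb hab
  have h := hseg _ ⟨μ, hμ, rfl⟩ hxU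
  obtain ⟨h1, h1'⟩ := h (-ε) ⟨le_rfl, by linarith⟩
  obtain ⟨h2, h2'⟩ := h ε ⟨by linarith, le_rfl⟩
  exact ⟨pushable_of_segment hF hfa hM hf hμ ha hb hab, ⟨_, h1, by linarith⟩, ⟨_, h2, by linarith⟩⟩

/-- The model function of a nondegenerate critical point of index `k`. -/
def morseModel (k : ℕ) (x : Fin d → ℝ) : ℝ := ∑ i : Fin d, if (i : ℕ) < k then -|x i| else |x i|

theorem morseModel_single (k : ℕ) (j : Fin d) :
    morseModel k (Pi.single j 1) = if (j : ℕ) < k then -1 else 1 := by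
  rw [morseModel, Finset.sum_eq_single j]
  · simp
  · intro i _ hi
    simp [hi]
  · simp

theorem IsChart.morseModel_eq_norm1 {x : Fin n → ℝ} {k : ℕ} {ψ : (Fin d → ℝ) → Fin n → ℝ}
    (hk : k ≤ d) (h : IsChart M f x (morseModel k) ψ) (hx : ∀ y ∈ M, f x ≤ f y) :
    (morseModel k : (Fin d → ℝ) → ℝ) = norm1 := by
  have hk0 : k = 0 := by
    by_contra hk0
    have h1 : (Pi.single ⟨0, by omega⟩ 1 : Fin d → ℝ) ∈ cube d := single_mem_cube _ (by norm_num)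
    have h2 := hx _ (h.maps h1)
    rw [h.val _ h1, morseModel_single, if_pos (by simpa using Nat.pos_of_ne_zero hk0)] at h2
    linarith
  subst hk0
  funext y
  simp [morseModel, norm1]

theorem IsChart.morseModel_eq_neg_norm1 {x : Fin n → ℝ} {k : ℕ} {ψ : (Fin d → ℝ) → Fin n → ℝ}
    (h : IsChart M f x (morseModel k) ψ) (hx : ∀ y ∈ M, f y ≤ f x) :
    (morseModel k : (Fin d → ℝ) → ℝ) = fun y => -norm1 y := by
  have hkd : d ≤ k := by
    by_contra! hkd
    have h1 : (Pi.single ⟨k, hkd⟩ 1 : Fin d → ℝ) ∈ cube d := single_mem_cube _ (by norm_num)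
    have h2 := hx _ (h.maps h1)
    rw [h.val _ h1, morseModel_single, if_neg (by simp)] at h2
    linarith
  funext y
  rw [morseModel, norm1, ← Finset.sum_neg_distrib]
  exact Finset.sum_congr rfl fun i _ => if_pos (i.2.trans_le hkd)

theorem pairIso_stdSphere_of_ncard (hM : IsCompact M) (hf : PLOn f M) {Z : Set (Fin n → ℝ)}
    (hZM : Z ⊆ M) (hZ : Z.ncard = 2) (hinj : InjOn f Z)
    (hcrit : ∀ z ∈ Z, ∃ k ≤ d, ∃ ψ : (Fin d → ℝ) → Fin n → ℝ, IsChart M f z (morseModel k) ψ)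
    (hreg : ∀ x ∈ M, x ∉ Z → Noncritical M f x) : PairIso M ∅ (stdSphere d) ∅ := by
  obtain ⟨a, b, hab, rfl⟩ := ncard_eq_two.1 hZ
  have hne : M.Nonempty := ⟨a, hZM (by simp)⟩
  obtain ⟨p, hpM, hp⟩ := hM.exists_isMinOn hne hf.cont
  obtain ⟨q, hqM, hq⟩ := hM.exists_isMaxOn hne hf.cont
  have hmin : ∀ x ∈ M, (∀ y ∈ M, f x ≤ f y) → x ∈ ({a, b} : Set _) := fun x hx h => by
    by_contra hxZ
    obtain ⟨y, hy, hyx⟩ := (hreg x hx hxZ).lower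
    exact (h y hy).not_gt hyx
  have hmax : ∀ x ∈ M, (∀ y ∈ M, f y ≤ f x) → x ∈ ({a, b} : Set _) := fun x hx h => by
    by_contra hxZ
    obtain ⟨y, hy, hyx⟩ := (hreg x hx hxZ).upper
    exact (h y hy).not_gt hyx
  have hpZ := hmin p hpM hp
  have hqZ := hmax q hqM hq
  have hpq : p ≠ q := by
    rintro rfl
    have ha : f a = f p := le_antisymm (hq (hZM (by simp))) (hp (hZM (by simp)))
    have hb : f b = f p := le_antisymm (hq (hZM (by simp))) (hp (hZM (by simp)))
    exact hab (hinj (by simp) (by simp) (ha.trans hb.symm))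
  have hsub : ∀ x ∈ ({a, b} : Set _), x = p ∨ x = q := by
    rintro x (rfl | rfl) <;> rcases hpZ with rfl | rfl <;> rcases hqZ with rfl | rfl <;> simp_all
  have hlt : f p < f q := (hp hqM).lt_of_ne fun h => hpq (hinj hpZ hqZ h)
  obtain ⟨k, hk, ψ, hψ⟩ := hcrit p hpZ
  obtain ⟨l, -, χ, hχ⟩ := hcrit q hqZ
  rw [hψ.morseModel_eq_norm1 hk hp] at hψ
  rw [hχ.morseModel_eq_neg_norm1 hq] at hχ
  refine pairIso_stdSphere hM hf hpq (fun y hy hyp => ?_) hqM (fun y hy hyq => ?_) hψ hχ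
    fun x hx hxp hxq => (hreg x hx fun h => (hsub x h).elim hxp hxq).pushable
  · by_contra! h
    rcases hsub y (hmin y hy fun z hz => h.trans (hp hz)) with rfl | rfl
    · exact hyp rfl
    · exact h.not_gt hlt
  · by_contra! h
    rcases hsub y (hmax y hy fun z hz => (hq hz).trans h) with rfl | rfl
    · exact h.not_gt hlt
    · exact hyq rfl

end Noncritical

section Transfer

variable {E : Type} [NormedAddCommGroup E] [NormedSpace ℝ E]

/-- Linear coordinates on the span of a set. -/
structure IsCoords {n : ℕ} (S : Set E) (ι : (Fin n → ℝ) →ₗ[ℝ] E) (π : E →ₗ[ℝ] Fin n → ℝ) :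
    Prop where
  left : ∀ y, π (ι y) = y
  right : ∀ x ∈ S, ι (π x) = x

theorem exists_isCoords {S : Set E} (A : Set E) (hA : A.Finite) (hS : S ⊆ Submodule.span ℝ A) :
    ∃ (n : ℕ) (ι : (Fin n → ℝ) →ₗ[ℝ] E) (π : E →ₗ[ℝ] Fin n → ℝ), IsCoords S ι π := by
  have : FiniteDimensional ℝ (Submodule.span ℝ A) := FiniteDimensional.span_of_finite ℝ hA
  let e := (Module.finBasis ℝ (Submodule.span ℝ A)).equivFun
  let ι := (Submodule.span ℝ A).subtype ∘ₗ e.symm.toLinearMap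
  have hι : Function.Injective ι := Subtype.val_injective.comp e.symm.injective
  obtain ⟨π, hπ⟩ := ι.exists_leftInverse_of_injective (LinearMap.ker_eq_bot.2 hι)
  have hl : ∀ y, π (ι y) = y := fun y => LinearMap.congr_fun hπ y
  refine ⟨_, ι, π, hl, fun x hx => ?_⟩
  have hx' : ι (e ⟨x, hS hx⟩) = x := by simp [ι]
  rw [← hx', hl]

variable {n : ℕ} {S : Set E} {ι : (Fin n → ℝ) →ₗ[ℝ] E} {π : E →ₗ[ℝ] Fin n → ℝ}

theorem IsCoords.injOn (h : IsCoords S ι π) : InjOn π S := fun x hx y hy hxy => by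
  rw [← h.right x hx, hxy, h.right y hy]

theorem IsCoords.image_image (h : IsCoords S ι π) : ι '' (π '' S) = S := by
  rw [Set.image_image]
  exact (image_congr h.right).trans (image_id' S)

theorem isCompact_graph {V W : Type} [NormedAddCommGroup V] [NormedAddCommGroup W] {φ : V → W}
    {S : Set V} (hS : IsCompact S) (hφ : ContinuousOn φ S) :
    IsCompact {p : V × W | p.1 ∈ S ∧ p.2 = φ p.1} := by
  convert hS.image_of_continuousOn (continuousOn_id.prodMk hφ) using 1
  ext ⟨x, y⟩
  constructor
  · rintro ⟨hx, hy⟩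
    exact ⟨x, hx, Prod.ext rfl hy.symm⟩
  · rintro ⟨x', hx, h⟩
    obtain ⟨rfl, rfl⟩ := Prod.mk.inj h
    exact ⟨hx, rfl⟩

theorem IsCoords.arePLHomeo (h : IsCoords S ι π) {m : ℕ} {T : Set (Fin m → ℝ)}
    (H : PairIso (π '' S) ∅ T ∅) : ArePLHomeo S T := by
  obtain ⟨φ, hφ⟩ := H
  have hψ := hφ.symm
  have hinv : InvOn (Function.invFunOn φ (π '' S)) φ (π '' S) T := hφ.bij.invOn_invFunOn
  set ψ := Function.invFunOn φ (π '' S)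
  refine ⟨fun x => φ (π x), hφ.bij.comp h.injOn.bijOn_image, ?_, fun y => ι (ψ y), ?_,
    fun x hx => ?_, fun y hy => ?_⟩
  · have := isPLMapOn_of_sl hφ.pl.sl (isCompact_graph hφ.compact hφ.pl.cont)
      (ι ∘ₗ LinearMap.fst ℝ _ _) (LinearMap.snd ℝ _ _) (φ := fun x => φ (π x))
      (fun p hp p' hp' hpp => ?_) fun p hp => ?_
    · convert this using 1
      conv_lhs => rw [← h.image_image]
      ext x
      constructor
      · rintro ⟨y, hy, rfl⟩
        exact ⟨(y, φ y), ⟨hy, rfl⟩, rfl⟩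
      · rintro ⟨p, hp, rfl⟩
        exact ⟨p.1, hp.1, rfl⟩
    · have h1 : p.1 = p'.1 := (Function.LeftInverse.injective h.left) hpp
      exact Prod.ext h1 (by rw [hp.2, hp'.2, h1])
    · show φ (π (ι p.1)) = p.2
      rw [h.left, hp.2]
  · have := isPLMapOn_of_sl hψ.pl.sl (isCompact_graph hψ.compact hψ.pl.cont)
      (LinearMap.fst ℝ _ _) (ι ∘ₗ LinearMap.snd ℝ _ _) (φ := fun x => ι (ψ x))
      (fun p hp p' hp' hpp => ?_) fun p hp => ?_
    · convert this using 1
      ext y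
      constructor
      · intro hy
        exact ⟨(y, ψ y), ⟨hy, rfl⟩, rfl⟩
      · rintro ⟨p, hp, rfl⟩
        exact hp.1
    · have h1 : p.1 = p'.1 := hpp
      exact Prod.ext h1 (by rw [hp.2, hp'.2, h1])
    · show ι (ψ p.1) = ι p.2
      rw [hp.2]
  · show ι (ψ (φ (π x))) = x
    rw [hinv.1 (mem_image_of_mem π hx), h.right x hx]
  · show φ (π (ι (ψ y))) = y
    rw [h.left, hinv.2 hy]

theorem IsCoords.plOn (h : IsCoords S ι π) {f : E → ℝ} (hf : IsPLMapOn f S) :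
    IsCompact (π '' S) ∧ PLOn (fun y => f (ι y)) (π '' S) := by
  obtain ⟨h1, h2⟩ := hf.sl_image π LinearMap.id
  have he : (fun x => (π x, LinearMap.id (R := ℝ) (f x))) '' S =
      {p : (Fin n → ℝ) × ℝ | p.1 ∈ π '' S ∧ p.2 = f (ι p.1)} := by
    ext ⟨y, t⟩
    constructor
    · rintro ⟨x, hx, hxy⟩
      obtain ⟨rfl, rfl⟩ := Prod.mk.inj hxy
      exact ⟨⟨x, hx, rfl⟩, by simp [h.right x hx]⟩
    · rintro ⟨⟨x, hx, rfl⟩, ht⟩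
      refine ⟨x, hx, Prod.ext rfl ?_⟩
      simpa [h.right x hx] using ht.symm
  rw [he] at h1 h2
  refine ⟨?_, continuousOn_of_isCompact_graph h2, h1⟩
  have hfst : π '' S = Prod.fst '' {p : (Fin n → ℝ) × ℝ | p.1 ∈ π '' S ∧ p.2 = f (ι p.1)} := by
    ext y
    constructor
    · intro hy
      exact ⟨(y, f (ι y)), ⟨hy, rfl⟩, rfl⟩
    · rintro ⟨p, hp, rfl⟩
      exact hp.1
  rw [hfst]
  exact h2.image continuous_fst

variable {d : ℕ} {K : SimplicialComplex ℝ E} {f : E → ℝ}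

theorem IsCoords.exists_isChart (h : IsCoords K.space ι π) {v : E} (hv : v ∈ K.space)
    {g : (Fin d → ℝ) → ℝ} (hc : K.HasPLChartAt f v d g) :
    ∃ ψ, IsChart (π '' K.space) (fun y => f (ι y)) (π v) g ψ := by
  obtain ⟨N, φ, hNK, hN, hφv, ⟨hbij, -, ψ, hψpl, hl, hr⟩, hval⟩ := hc
  have hψN : ∀ y ∈ cube d, ψ y ∈ N := fun y hy => by
    obtain ⟨x, hx, rfl⟩ := hbij.surjOn hy
    rwa [hl x hx]
  obtain ⟨h1, h2⟩ := hψpl.sl_image LinearMap.id π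
  have he : (fun x => (LinearMap.id (R := ℝ) x, π (ψ x))) '' cube d =
      {p : (Fin d → ℝ) × (Fin n → ℝ) | p.1 ∈ cube d ∧ p.2 = π (ψ p.1)} := by
    ext ⟨x, y⟩
    constructor
    · rintro ⟨x', hx, hxy⟩
      obtain ⟨rfl, rfl⟩ := Prod.mk.inj hxy
      exact ⟨hx, rfl⟩
    · rintro ⟨hx, hy⟩
      exact ⟨x, hx, Prod.ext rfl hy.symm⟩
  have hvN : v ∈ N := mem_of_mem_nhdsWithin hv hN
  refine ⟨fun y => π (ψ y), ⟨continuousOn_of_isCompact_graph ?_, ?_⟩, fun y hy z hz hyz => ?_,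
    fun y hy => mem_image_of_mem π (hNK (hψN y hy)), ?_, fun y hy => ?_,
    hψpl.exists_lipschitz π convex_cube, ?_⟩
  · rw [← he]; exact h2
  · rw [SLOn, ← he]; exact h1
  · have := h.injOn (hNK (hψN y hy)) (hNK (hψN z hz)) hyz
    rw [← hr y hy, this, hr z hz]
  · rw [← hφv, hl v hvN]
  · show f (ι (π (ψ y))) = f (ι (π v)) + g y
    rw [h.right _ (hNK (hψN y hy)), h.right v hv, hval _ (hψN y hy), hr y hy]
  · obtain ⟨U, hU, hvU, hUN⟩ := mem_nhdsWithin.1 hN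
    refine mem_nhdsWithin.2 ⟨ι ⁻¹' U, hU.preimage ι.continuous_of_finiteDimensional, ?_, ?_⟩
    · show ι (π v) ∈ U
      rwa [h.right v hv]
    · rintro _ ⟨hyU, x, hx, rfl⟩
      have hxN : x ∈ N := hUN ⟨h.right x hx ▸ hyU, hx⟩
      refine ⟨φ x, hbij.mapsTo hxN, ?_⟩
      show π (ψ (φ x)) = π x
      rw [hl x hxN]

theorem mem_space_of_mem {s : Finset E} (hs : s ∈ K.faces) {x : E} (hx : x ∈ s) : x ∈ K.space :=
  mem_iUnion₂.2 ⟨s, hs, subset_convexHull ℝ _ hx⟩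

theorem mem_vertices_of_mem {s : Finset E} (hs : s ∈ K.faces) {x : E} (hx : x ∈ s) :
    x ∈ K.vertices :=
  K.down_closed hs (Finset.singleton_subset_iff.2 hx) (Finset.singleton_nonempty x)

theorem space_subset_span : K.space ⊆ Submodule.span ℝ (⋃ s ∈ K.faces, (s : Set E)) := by
  refine iUnion₂_subset fun s hs => convexHull_min ?_ (Submodule.convex _)
  exact (subset_biUnion_of_mem (u := fun s : Finset E => (s : Set E)) hs).trans
    Submodule.subset_span

theorem IsCoords.affineOnTri [DecidableEq (Fin n → ℝ)] (h : IsCoords K.space ι π)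
    (hf : ∀ s ∈ K.faces, AffineOnSimplex f s) :
    AffineOnTri (fun y => f (ι y)) ((fun s : Finset E => s.image π) '' K.faces) := by
  classical
  rintro μ ⟨hμ, s, hs, hsμ⟩
  set ν := Finsupp.mapDomain ι μ with hνdef
  have hν : IsWeight ν := hμ.mapDomain ι
  have hsub : ν.support ⊆ s := by
    refine Finsupp.mapDomain_support.trans ?_
    rw [← hsμ]
    intro x hx
    simp only [Finset.mem_image] at hx
    obtain ⟨_, ⟨x', hx', rfl⟩, rfl⟩ := hx
    rwa [h.right _ (mem_space_of_mem hs hx')]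
  have hb : bary ν = ι (bary μ) := by
    rw [bary, hνdef, Finsupp.linearCombination_mapDomain]
    simp [bary, Finsupp.linearCombination_apply, map_finsuppSum]
  have h1 := hf s hs ν (fun x _ => hν.1 x) ((mass_eq_sum hsub).symm.trans hν.2)
  rw [← bary_eq_sum hsub, hb] at h1
  show f (ι (bary μ)) = _
  have h2 : Finsupp.linearCombination ℝ f ν = ∑ x ∈ s, ν x • f x := by
    rw [Finsupp.linearCombination_apply, Finsupp.sum_of_support_subset _ hsub _ (by simp)]
  rw [h1, ← h2, hνdef, Finsupp.linearCombination_mapDomain]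
  rfl

end Transfer

end PLReeb

open Geometry

/-- **PL Reeb theorem.** Let `M` be a compact PL `d`-manifold and `f` a PL Morse
function on `M` with exactly two critical points (vertices that are not strongly
regular). Then `M` is PL homeomorphic to the `d`-sphere. -/
theorem pl_reeb_theorem
    {E : Type} [NormedAddCommGroup E] [NormedSpace ℝ E]
    (K : SimplicialComplex ℝ E) (d : ℕ) (hK : K.IsCombinatorialManifold d)
    (f : E → ℝ) (hf : K.IsPLMorse f d)
    (h2 : {v ∈ K.vertices | ¬ K.StronglyRegularAt f v d}.ncard = 2) :
    IsPLSphere K.space d := by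
  classical
  have hfin := hK.finite
  obtain ⟨n, ι, π, hc⟩ := PLReeb.exists_isCoords (⋃ s ∈ K.faces, (s : Set E))
    (hfin.biUnion fun s _ => s.finite_toSet) PLReeb.space_subset_span
  have hspace := PLReeb.space_eq_triSpace K hfin
  obtain ⟨hF, hFs⟩ := (PLReeb.isTri_faces K hfin).image π (hspace ▸ hc.injOn)
  rw [← hspace] at hFs
  obtain ⟨hM, hPL⟩ := hc.plOn ⟨K, hfin, rfl, hf.1.affineOn⟩
  have hfa := hc.affineOnTri hf.1.affineOn
  have hvs : K.vertices ⊆ K.space := fun v hv =>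
    PLReeb.mem_space_of_mem hv (Finset.mem_singleton_self v)
  refine hc.arePLHomeo (PLReeb.pairIso_stdSphere_of_ncard hM hPL
    (Z := π '' {v ∈ K.vertices | ¬ K.StronglyRegularAt f v d}) ?_ ?_ ?_ ?_ ?_)
  · exact image_mono fun v hv => hvs hv.1
  · rw [(hc.injOn.mono fun v hv => hvs hv.1).ncard_image, h2]
  · rintro _ ⟨v, hv, rfl⟩ _ ⟨w, hw, rfl⟩ hvw
    simp only [hc.right v (hvs hv.1), hc.right w (hvs hw.1)] at hvw
    rw [hf.1.injOn hv.1 hw.1 hvw]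
  · rintro _ ⟨v, hv, rfl⟩
    obtain ⟨k, hk, hchart⟩ := (hf.2 v hv.1).resolve_left hv.2
    exact ⟨k, hk, hc.exists_isChart (hvs hv.1) hchart⟩
  · intro x hx hxZ
    have hx' := hx
    rw [← hFs] at hx'
    obtain ⟨μ, hμ, rfl⟩ := hx'
    have hvert : ∀ a ∈ μ.support, ∃ v ∈ K.vertices, π v = a := fun a ha => by
      obtain ⟨s, hs, hsμ⟩ := hμ.2
      rw [← hsμ] at ha
      obtain ⟨v, hv, rfl⟩ := Finset.mem_image.1 ha
      exact ⟨v, PLReeb.mem_vertices_of_mem hs hv, rfl⟩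
    obtain ⟨a, ha⟩ := hμ.1.support_nonempty
    obtain ⟨v, hv, rfl⟩ := hvert a ha
    by_cases hsub : ∀ b ∈ μ.support, b = π v
    · have hb : PLReeb.bary μ = π v := by
        have hs : μ.support ⊆ {π v} := fun b hb => Finset.mem_singleton.2 (hsub b hb)
        have hm := (PLReeb.mass_eq_sum hs).symm.trans hμ.1.2
        rw [Finset.sum_singleton] at hm
        rw [PLReeb.bary_eq_sum hs, Finset.sum_singleton, hm, one_smul]
      rw [hb] at hx hxZ ⊢
      have hreg : K.StronglyRegularAt f v d := by
        by_contra hreg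
        exact hxZ ⟨v, ⟨hv, hreg⟩, rfl⟩
      obtain ⟨_, hchart⟩ := hreg
      obtain ⟨ψ, hψ⟩ := hc.exists_isChart (hvs hv) hchart
      exact hψ.noncritical hM hPL hx
    · push Not at hsub
      obtain ⟨b, hbμ, hbv⟩ := hsub
      obtain ⟨w, hw, rfl⟩ := hvert b hbμ
      have hne : f (ι (π v)) ≠ f (ι (π w)) := fun h => by
        rw [hc.right v (hvs hv), hc.right w (hvs hw)] at h
        exact hbv (by rw [hf.1.injOn hv hw h])
      rw [← hFs] at hM hPL ⊢
      rcases hne.lt_or_gt with h | h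
      · exact PLReeb.noncritical_of_segment hF hfa hM hPL hμ ha hbμ h
      · exact PLReeb.noncritical_of_segment hF hfa hM hPL hμ hbμ ha h
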